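/- arXiv:1803.11296 — 2 statements merged into one kernel-verified Lean document; each statement's English description precedes it below -/
import Mathlib

section
/- Let (X,d_ℓ,μ_ℓ) be the cable system corresponding to a good embedding of a planar graph with carrier ℝ², and let d₁ denote the metric on X obtained from the unit length function ℓ ≡ 1. Then for every pair of disjoint continua E, F ⊂ X one has Mod(E,F) ≥ 1/dist₁(E,F), where the modulus Mod(E,F) may equivalently be computed with respect to (d_ℓ,μ_ℓ) or (d₁,μ₁) (these agree by conformal invariance of the modulus on cable systems). -/
open MeasureTheory Set Metric Filter
open scoped ENNReal NNReal

noncomputable section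

variable {V : Type*} {X : Type*}

/-- A *distortion function*: a homeomorphism of `[0,∞)` onto itself. -/
def IsDistortion (η : ℝ → ℝ) : Prop :=
  StrictMonoOn η (Set.Ici 0) ∧ ContinuousOn η (Set.Ici 0) ∧ η 0 = 0 ∧
    Set.MapsTo η (Set.Ici 0) (Set.Ici 0) ∧ Set.SurjOn η (Set.Ici 0) (Set.Ici 0)

/-- Two distance functions on the same set are *quasisymmetric* if the identity map is an
`η`-quasisymmetry for some distortion function `η`. -/
def QSPair {A : Type*} (d₁ d₂ : A → A → ℝ) : Prop :=
  ∃ η : ℝ → ℝ, IsDistortion η ∧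
    ∀ x a b : A, x ≠ b → d₂ x a / d₂ x b ≤ η (d₁ x a / d₁ x b)

/-- A graph has polynomial growth with volume growth exponent `d`:
`C⁻¹ r^d ≤ |B_G(x,r)| ≤ C r^d` for all vertices `x` and all `r ≥ 1`. -/
def HasPolynomialGrowth (G : SimpleGraph V) (d : ℝ) : Prop :=
  ∃ C : ℝ, 1 < C ∧ ∀ (x : V) (r : ℝ), 1 ≤ r →
    C⁻¹ * r ^ d ≤ (Nat.card {y : V | (G.dist x y : ℝ) < r} : ℝ) ∧
    (Nat.card {y : V | (G.dist x y : ℝ) < r} : ℝ) ≤ C * r ^ d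

/-- `IsCableSystem G ℓ μ vtx em` says that the metric measure space `X` (with its ambient
metric `dist` and measure `μ`) is the cable system of the graph `G` with length function `ℓ`:
each edge `{u,v}` of `G` corresponds to an isometrically embedded arc
`em u v : [0, ℓ u v] → X` (an arclength parametrisation), the arcs glue at the vertices and
cover `X`, the metric is the induced (maximal) length metric, and on each edge `μ` equals
`ℓ(e)` times arclength measure. -/
structure IsCableSystem (G : SimpleGraph V) (ℓ : V → V → ℝ) [MetricSpace X]
    [MeasurableSpace X] (μ : Measure X) (vtx : V → X) (em : V → V → ℝ → X) : Prop where
  len_pos : ∀ u v, G.Adj u v → 0 < ℓ u v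
  len_symm : ∀ u v, ℓ u v = ℓ v u
  edge_start : ∀ u v, G.Adj u v → em u v 0 = vtx u
  edge_flip : ∀ u v, G.Adj u v → ∀ s, em u v s = em v u (ℓ u v - s)
  edge_lip : ∀ u v, G.Adj u v → ∀ s ∈ Icc 0 (ℓ u v), ∀ t ∈ Icc 0 (ℓ u v),
    dist (em u v s) (em u v t) ≤ |s - t|
  edge_inj : ∀ u v, G.Adj u v → InjOn (em u v) (Icc 0 (ℓ u v))
  cover : ∀ x : X, ∃ u v s, G.Adj u v ∧ s ∈ Icc 0 (ℓ u v) ∧ em u v s = x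
  interior_disjoint : ∀ u v u' v', G.Adj u v → G.Adj u' v' →
    ∀ s ∈ Ioo 0 (ℓ u v), ∀ s' ∈ Ioo 0 (ℓ u' v'), em u v s = em u' v' s' →
      (u = u' ∧ v = v' ∧ s = s') ∨ (u = v' ∧ v = u' ∧ s = ℓ u v - s')
  isBorel : BorelSpace X
  dist_maximal : ∀ d' : X → X → ℝ, (∀ x, d' x x = 0) → (∀ x y, d' x y = d' y x) →
    (∀ x y z, d' x z ≤ d' x y + d' y z) →
    (∀ u v, G.Adj u v → ∀ s ∈ Icc 0 (ℓ u v), ∀ t ∈ Icc 0 (ℓ u v),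
      d' (em u v s) (em u v t) ≤ |s - t|) →
    ∀ x y, d' x y ≤ dist x y
  measure_edge : ∀ u v, G.Adj u v → ∀ A : Set ℝ, MeasurableSet A → A ⊆ Icc 0 (ℓ u v) →
    μ (em u v '' A) = ENNReal.ofReal (ℓ u v) * volume A

/-- `HasGradMod G ℓ em f g` : `f` is absolutely continuous (continuous on `X` and absolutely
continuous along each edge) and `g` is (a version of) the length of its gradient `|∇_ℓ f|`,
i.e. `g ≥ 0` and on each edge `f` is the integral of a signed derivative `h` with `|h| = g`
along the edge a.e. -/
def HasGradMod [TopologicalSpace X] (G : SimpleGraph V) (ℓ : V → V → ℝ)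
    (em : V → V → ℝ → X) (f g : X → ℝ) : Prop :=
  Continuous f ∧ (∀ x, 0 ≤ g x) ∧
    ∀ u v, G.Adj u v → ∃ h : ℝ → ℝ, IntegrableOn h (Icc 0 (ℓ u v)) ∧
      (∀ᵐ t ∂(volume.restrict (Icc 0 (ℓ u v))), |h t| = g (em u v t)) ∧
      ∀ t ∈ Icc 0 (ℓ u v), f (em u v t) = f (em u v 0) + ∫ s in Ioc 0 t, h s

/-- `HasEdgeDeriv G ℓ em f h` : `f` is absolutely continuous with (signed) edgewise derivative
`h u v : [0, ℓ u v] → ℝ` with respect to arclength along the (oriented) edge `(u,v)`. -/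
def HasEdgeDeriv [TopologicalSpace X] (G : SimpleGraph V) (ℓ : V → V → ℝ)
    (em : V → V → ℝ → X) (f : X → ℝ) (h : V → V → ℝ → ℝ) : Prop :=
  Continuous f ∧ ∀ u v, G.Adj u v → IntegrableOn (h u v) (Icc 0 (ℓ u v)) ∧
    ∀ t ∈ Icc 0 (ℓ u v), f (em u v t) = f (em u v 0) + ∫ s in Ioc 0 t, h u v s

/-- The Dirichlet energy `D(f,f) = ∫_X |∇_ℓ f|² dμ_ℓ` of an absolutely continuous function
(equal to `⊤` if `f` is not absolutely continuous). -/
def dirEnergy [TopologicalSpace X] [MeasurableSpace X] (G : SimpleGraph V)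
    (ℓ : V → V → ℝ) (em : V → V → ℝ → X) (μ : Measure X) (f : X → ℝ) : ℝ≥0∞ :=
  ⨅ (g : X → ℝ) (_ : HasGradMod G ℓ em f g), ∫⁻ x, ENNReal.ofReal (g x ^ 2) ∂μ

/-- `f` belongs to `F_D`: the closure, in the norm `(D(·,·) + ‖·‖²_{L²(μ)})^{1/2}`, of the
set of absolutely continuous, finite-energy functions with compact support contained in
`Dom`. -/
def MemFD [TopologicalSpace X] [MeasurableSpace X] (G : SimpleGraph V) (ℓ : V → V → ℝ)
    (em : V → V → ℝ → X) (μ : Measure X) (Dom : Set X) (f : X → ℝ) : Prop :=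
  ∃ F : ℕ → X → ℝ,
    (∀ n, (∃ g, HasGradMod G ℓ em (F n) g) ∧ HasCompactSupport (F n) ∧
      tsupport (F n) ⊆ Dom ∧ dirEnergy G ℓ em μ (F n) < ⊤) ∧
    Tendsto (fun n => dirEnergy G ℓ em μ (fun x => F n x - f x)
      + ∫⁻ x, ENNReal.ofReal ((F n x - f x) ^ 2) ∂μ) atTop (nhds 0)

/-- The capacity `Cap_D(A)`: the infimum of the Dirichlet energy over all `f ∈ F_D` with
`f ≥ 1` on a neighbourhood of `A`. -/
def capacity [TopologicalSpace X] [MeasurableSpace X] (G : SimpleGraph V) (ℓ : V → V → ℝ)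
    (em : V → V → ℝ → X) (μ : Measure X) (Dom A : Set X) : ℝ≥0∞ :=
  ⨅ (f : X → ℝ) (_ : MemFD G ℓ em μ Dom f ∧
      ∃ U : Set X, IsOpen U ∧ A ⊆ U ∧ ∀ x ∈ U, 1 ≤ f x),
    dirEnergy G ℓ em μ f

/-- The capacity upper bound `(cap_≤)`: there exist `C, M ≥ 1` with
`Cap_{B(x,Mr)}(B(x,r)) ≤ C` for all `x ∈ X` and `r ≥ 1`. -/
def CapLE [MetricSpace X] [MeasurableSpace X] (G : SimpleGraph V) (ℓ : V → V → ℝ)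
    (em : V → V → ℝ → X) (μ : Measure X) : Prop :=
  ∃ C M : ℝ, 1 ≤ C ∧ 1 ≤ M ∧ ∀ (x : X) (r : ℝ), 1 ≤ r →
    capacity G ℓ em μ (ball x (M * r)) (ball x r) ≤ ENNReal.ofReal C

/-- A curve in `X`: the data of an interval `[a,b]` and a map `ℝ → X` (to be continuous
on `[a,b]`). -/
abbrev CurveData (X : Type*) : Type _ := ℝ × ℝ × (ℝ → X)

/-- `g : [0,L] → X` is a `1`-Lipschitz parametrisation of the curve `c` on `[c.1, c.2.1]`
(such a parametrisation exists iff `c` is rectifiable, and the infimum of `∫_0^L ρ∘g` over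
all such parametrisations is the arclength line integral `∫_c ρ ds`). -/
def IsLipParamOf [PseudoMetricSpace X] (g : ℝ → X) (L : ℝ) (c : CurveData X) : Prop :=
  0 ≤ L ∧ LipschitzOnWith 1 g (Icc 0 L) ∧
    ∃ φ : ℝ → ℝ, MonotoneOn φ (Icc c.1 c.2.1) ∧ φ '' Icc c.1 c.2.1 = Icc 0 L ∧
      ∀ t ∈ Icc c.1 c.2.1, g (φ t) = c.2.2 t

/-- `ρ` is admissible for the curve family `Γ`: every (locally) rectifiable curve of `Γ` has
arclength line integral `∫_γ ρ ds ≥ 1`; equivalently `∫_{[0,L]} ρ ∘ g ≥ 1` for every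
`1`-Lipschitz parametrisation `g : [0,L] → X` of a curve of `Γ`. -/
def ModAdmissible [PseudoMetricSpace X] (Γ : Set (CurveData X)) (ρ : X → ℝ≥0∞) : Prop :=
  ∀ c ∈ Γ, ∀ (g : ℝ → X) (L : ℝ), IsLipParamOf g L c → 1 ≤ ∫⁻ t in Icc 0 L, ρ (g t)

/-- The `2`-modulus of a curve family. -/
def modulus [PseudoMetricSpace X] [MeasurableSpace X] (μ : Measure X)
    (Γ : Set (CurveData X)) : ℝ≥0∞ :=
  ⨅ (ρ : X → ℝ≥0∞) (_ : Measurable ρ ∧ ModAdmissible Γ ρ), ∫⁻ x, ρ x ^ 2 ∂μ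

/-- The family of curves joining `E` and `F`. -/
def JoiningCurves [TopologicalSpace X] (E F : Set X) : Set (CurveData X) :=
  {c | c.1 ≤ c.2.1 ∧ ContinuousOn c.2.2 (Icc c.1 c.2.1) ∧ c.2.2 c.1 ∈ E ∧ c.2.2 c.2.1 ∈ F}

/-- Distance between two sets. -/
def setDist [PseudoMetricSpace X] (E F : Set X) : ℝ :=
  sInf ((fun q : X × X => dist q.1 q.2) '' E ×ˢ F)

/-- The Poincaré inequality `PI(Ψ)` for the cable system. -/
def PoincareIneq [MetricSpace X] [MeasurableSpace X] (G : SimpleGraph V) (ℓ : V → V → ℝ)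
    (em : V → V → ℝ → X) (μ : Measure X) (Ψ : ℝ → ℝ) : Prop :=
  ∃ C M : ℝ, 1 ≤ C ∧ 1 ≤ M ∧
    ∀ f g : X → ℝ, HasGradMod G ℓ em f g → (∫⁻ x, ENNReal.ofReal (g x ^ 2) ∂μ) < ⊤ →
      ∀ (x : X) (r : ℝ), 0 < r → ENNReal.ofReal (2 * r) < EMetric.diam (univ : Set X) →
        ∫⁻ y in ball x r, ENNReal.ofReal ((f y - ⨍ z in ball x r, f z ∂μ) ^ 2) ∂μ ≤
          ENNReal.ofReal (C * Ψ r) * ∫⁻ y in ball x (M * r), ENNReal.ofReal (g y ^ 2) ∂μ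

/-- Annular quasi-convexity at large scales. -/
def AnnularQCLargeScales (X : Type*) [PseudoMetricSpace X] : Prop :=
  ∃ R C : ℝ, 0 < R ∧ 0 < C ∧ ∀ (x : X) (r : ℝ), R ≤ r →
    ∀ y ∈ ball x (2 * r) \ ball x r, ∀ z ∈ ball x (2 * r) \ ball x r,
      ∃ (a b : ℝ) (γ : ℝ → X), a ≤ b ∧ ContinuousOn γ (Icc a b) ∧ γ a = y ∧ γ b = z ∧
        ∀ t ∈ Icc a b, γ t ∈ ball x (C * r) \ ball x (r / C)


/-- The union of the (straight-line) edges of an embedding `p` of the planar graph `G`. -/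
def edgeUnion (G : SimpleGraph V) (p : V → EuclideanSpace ℝ (Fin 2)) :
    Set (EuclideanSpace ℝ (Fin 2)) :=
  ⋃ (u : V) (v : V) (_ : G.Adj u v), segment ℝ (p u) (p v)

/-- `p` is a `(D,η)`-good straight-line embedding of `G` in the plane:
vertices are distinct, edges are straight segments meeting only at common endpoints,
adjacent edges have comparable lengths (ratio in `[1/D, D]`), and every face (connected
component of the complement of the union of the edges) is the interior of a convex polygon
whose consecutive vertices are adjacent in `G` and all of whose inner angles are `≤ π − η`. -/
def IsGoodEmbedding (G : SimpleGraph V) (p : V → EuclideanSpace ℝ (Fin 2))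
    (D η : ℝ) : Prop :=
  0 < D ∧ 0 < η ∧ η < Real.pi ∧ Function.Injective p ∧
  (∀ u v u' v', G.Adj u v → G.Adj u' v' → s(u, v) ≠ s(u', v') →
    segment ℝ (p u) (p v) ∩ segment ℝ (p u') (p v') ⊆
      ({p u, p v} ∩ {p u', p v'} : Set (EuclideanSpace ℝ (Fin 2)))) ∧
  (∀ u v w, G.Adj u v → G.Adj u w → dist (p u) (p v) ≤ D * dist (p u) (p w)) ∧
  (∀ x, x ∉ edgeUnion G p → ∃ n : ℕ, 3 ≤ n ∧ ∃ w : ZMod n → V,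
    (∀ i, G.Adj (w i) (w (i + 1))) ∧
    connectedComponentIn (edgeUnion G p)ᶜ x = interior (convexHull ℝ (Set.range (p ∘ w))) ∧
    (∀ i : ZMod n, EuclideanGeometry.angle (p (w (i - 1))) (p (w i)) (p (w (i + 1)))
      ≤ Real.pi - η))

/-- The carrier of the embedding: the union of the closed faces. -/
def carrier (G : SimpleGraph V) (p : V → EuclideanSpace ℝ (Fin 2)) :
    Set (EuclideanSpace ℝ (Fin 2)) :=
  ⋃ x ∈ (edgeUnion G p)ᶜ, closure (connectedComponentIn (edgeUnion G p)ᶜ x)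

/-- Separation radius of a vertex `w` : the minimal length of an edge containing `w`. -/
def vtxSepRad (G : SimpleGraph V) (ℓ : V → V → ℝ) (w : V) : ℝ :=
  sInf {a | ∃ v, G.Adj w v ∧ a = ℓ w v}

open Classical in
/-- Separation radius of a point of the cable system: for a vertex, the minimal length of an
edge containing it; for a point in the interior of an edge `{u,v}`, the minimum of the
separation radii of `u` and `v`. -/
def sepRad (G : SimpleGraph V) (ℓ : V → V → ℝ) (vtx : V → X) (em : V → V → ℝ → X)
    (x : X) : ℝ :=
  if h : ∃ w, vtx w = x then vtxSepRad G ℓ h.choose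
  else sInf {a | ∃ u v s, G.Adj u v ∧ s ∈ Ioo 0 (ℓ u v) ∧ em u v s = x ∧
    a = min (vtxSepRad G ℓ u) (vtxSepRad G ℓ v)}


/-! ### Measure-theoretic preliminaries -/

/-- An inequality between two measures can be checked on the members of a countable cover. -/
theorem measure_le_of_countable_cover {α ι : Type*} [MeasurableSpace α] [Countable ι]
    (ν μ : Measure α) (S : ι → Set α) (hS : ∀ i, MeasurableSet (S i))
    (h : ∀ i B, MeasurableSet B → B ⊆ S i → ν B ≤ μ B)
    {B : Set α} (hB : MeasurableSet B) (hBS : B ⊆ ⋃ i, S i) : ν B ≤ μ B := by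
  obtain ⟨_⟩ := nonempty_encodable ι
  set S' : ℕ → Set α := fun n => ⋃ b ∈ Encodable.decode₂ ι n, S b with hS'
  have hm : ∀ n, MeasurableSet (S' n) := fun n =>
    Encodable.iUnion_decode₂_cases (C := fun s => MeasurableSet s) MeasurableSet.empty hS
  have hle : ∀ n, ∀ B, MeasurableSet B → B ⊆ S' n → ν B ≤ μ B := fun n =>
    Encodable.iUnion_decode₂_cases (f := S)
      (C := fun s => ∀ B, MeasurableSet B → B ⊆ s → ν B ≤ μ B)
      (fun B _ hB => by rw [Set.subset_empty_iff.1 hB]; simp) h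
  have hU : ⋃ n, S' n = ⋃ i, S i := Encodable.iUnion_decode₂ S
  have hdm : ∀ n, MeasurableSet (B ∩ disjointed S' n) := fun n =>
    hB.inter (MeasurableSet.disjointed hm n)
  have hdd : Pairwise (Function.onFun Disjoint fun n => B ∩ disjointed S' n) := fun i j hij =>
    (disjoint_disjointed S' hij).mono inter_subset_right inter_subset_right
  have hBe : B = ⋃ n, B ∩ disjointed S' n := by
    rw [← inter_iUnion, iUnion_disjointed, hU, inter_eq_left.2 hBS]
  rw [hBe, measure_iUnion hdd hdm, measure_iUnion hdd hdm]
  exact ENNReal.tsum_le_tsum fun n =>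
    hle n _ (hdm n) (inter_subset_right.trans (disjointed_subset S' n))

/-- The Cauchy-Schwarz inequality on an interval of length `L`. -/
theorem inv_length_le_lintegral_sq {L : ℝ} (hL : 0 < L) (f : ℝ → ℝ≥0∞)
    (hf : 1 ≤ ∫⁻ t in Icc 0 L, f t) :
    ENNReal.ofReal (1 / L) ≤ ∫⁻ t in Icc 0 L, f t ^ 2 := by
  have hpt : ∀ a : ℝ≥0∞, 2 * a ≤ ENNReal.ofReal L * a ^ 2 + ENNReal.ofReal (1 / L) := by
    intro a
    induction a using ENNReal.recTopCoe with
    | top => simp [ENNReal.mul_top, hL]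
    | coe a =>
      rw [← ENNReal.ofReal_coe_nnreal, ← ENNReal.ofReal_pow (by positivity),
        ← ENNReal.ofReal_mul hL.le, ← ENNReal.ofReal_add (by positivity) (by positivity),
        show (2 : ℝ≥0∞) = ENNReal.ofReal 2 by simp, ← ENNReal.ofReal_mul (by norm_num)]
      apply ENNReal.ofReal_le_ofReal
      have h : L * (a : ℝ) ^ 2 + 1 / L - 2 * a = (L * a - 1) ^ 2 / L := by
        field_simp
        ring
      have : 0 ≤ (L * (a : ℝ) - 1) ^ 2 / L := by positivity
      linarith
  have h1 : ENNReal.ofReal L * ∫⁻ t in Icc 0 L, f t ^ 2 =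
      ∫⁻ t in Icc 0 L, ENNReal.ofReal L * f t ^ 2 :=
    (lintegral_const_mul' _ _ ENNReal.ofReal_ne_top).symm
  have h2 : (2 : ℝ≥0∞) ≤ ENNReal.ofReal L * (∫⁻ t in Icc 0 L, f t ^ 2) + 1 := by
    calc (2 : ℝ≥0∞) ≤ 2 * ∫⁻ t in Icc 0 L, f t := by
          simpa using mul_le_mul_right hf (2 : ℝ≥0∞)
      _ = ∫⁻ t in Icc 0 L, 2 * f t := (lintegral_const_mul' _ _ (by simp)).symm
      _ ≤ ∫⁻ t in Icc 0 L, (ENNReal.ofReal L * f t ^ 2 + ENNReal.ofReal (1 / L)) :=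
          lintegral_mono fun t => hpt _
      _ = ENNReal.ofReal L * (∫⁻ t in Icc 0 L, f t ^ 2) + 1 := by
          rw [lintegral_add_right _ measurable_const, h1]
          congr 1
          rw [lintegral_const, Measure.restrict_apply_univ, Real.volume_Icc,
            ← ENNReal.ofReal_mul (by positivity)]
          simp [hL.ne']
  have h3 : (1 : ℝ≥0∞) ≤ ENNReal.ofReal L * ∫⁻ t in Icc 0 L, f t ^ 2 := by
    rw [show (2 : ℝ≥0∞) = 1 + 1 by norm_num] at h2
    exact (ENNReal.add_le_add_iff_right ENNReal.one_ne_top).1 h2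
  rw [one_div, ENNReal.ofReal_inv_of_pos hL]
  exact ENNReal.inv_le_iff_le_mul (by simp [hL]) (by simp) |>.2 h3

/-! ### Edge paths -/

/-- `EdgePath G ℓ em x y L`: the points `x` and `y` are joined by a finite concatenation of
pieces of edges of total length `L`. -/
inductive EdgePath (G : SimpleGraph V) (ℓ : V → V → ℝ) (em : V → V → ℝ → X) (x : X) :
    X → ℝ → Prop
  | nil : EdgePath G ℓ em x x 0
  | snoc {L : ℝ} {u v : V} {s t : ℝ} : EdgePath G ℓ em x (em u v s) L → G.Adj u v →
      s ∈ Icc 0 (ℓ u v) → t ∈ Icc 0 (ℓ u v) → EdgePath G ℓ em x (em u v t) (L + |s - t|)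

namespace EdgePath

variable {G : SimpleGraph V} {ℓ : V → V → ℝ} {em : V → V → ℝ → X} {x y z : X} {L M : ℝ}

theorem nonneg (h : EdgePath G ℓ em x y L) : 0 ≤ L := by
  induction h with
  | nil => exact le_rfl
  | snoc _ _ _ _ ih => positivity

theorem append (h : EdgePath G ℓ em x y L) (h' : EdgePath G ℓ em y z M) :
    EdgePath G ℓ em x z (L + M) := by
  induction h' with
  | nil => simpa using h
  | snoc _ ha hs ht ih => rw [← add_assoc]; exact ih.snoc ha hs ht

theorem single {u v : V} {s t : ℝ} (ha : G.Adj u v) (hs : s ∈ Icc 0 (ℓ u v))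
    (ht : t ∈ Icc 0 (ℓ u v)) : EdgePath G ℓ em (em u v s) (em u v t) |s - t| := by
  simpa using (EdgePath.nil (G := G) (ℓ := ℓ) (em := em)).snoc ha hs ht

theorem reverse (h : EdgePath G ℓ em x y L) : EdgePath G ℓ em y x L := by
  induction h with
  | nil => exact nil
  | snoc _ ha hs ht ih =>
    rw [add_comm, abs_sub_comm]
    exact (single ha ht hs).append ih

end EdgePath

namespace IsCableSystem

variable {G : SimpleGraph V} {ℓ : V → V → ℝ} [MetricSpace X] [MeasurableSpace X]
  {μ : Measure X} {vtx : V → X} {em : V → V → ℝ → X}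

theorem edge_end (hcs : IsCableSystem G ℓ μ vtx em) {u v : V} (h : G.Adj u v) :
    em u v (ℓ u v) = vtx v := by
  rw [hcs.edge_flip u v h, sub_self, hcs.edge_start v u h.symm]

theorem left_mem (hcs : IsCableSystem G ℓ μ vtx em) {u v : V} (h : G.Adj u v) :
    (0 : ℝ) ∈ Icc 0 (ℓ u v) := ⟨le_rfl, (hcs.len_pos u v h).le⟩

theorem right_mem (hcs : IsCableSystem G ℓ μ vtx em) {u v : V} (h : G.Adj u v) :
    ℓ u v ∈ Icc 0 (ℓ u v) := ⟨(hcs.len_pos u v h).le, le_rfl⟩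

theorem dist_le_of_edgePath (hcs : IsCableSystem G ℓ μ vtx em) {x y : X} {L : ℝ}
    (h : EdgePath G ℓ em x y L) : dist x y ≤ L := by
  induction h with
  | nil => simp
  | snoc _ ha hs ht ih =>
    exact (dist_triangle _ _ _).trans (add_le_add ih (hcs.edge_lip _ _ ha _ hs _ ht))

theorem exists_edgePath (hcs : IsCableSystem G ℓ μ vtx em) (hG : G.Connected) (x y : X) :
    ∃ L, EdgePath G ℓ em x y L := by
  have hv : ∀ u v : V, ∃ L, EdgePath G ℓ em (vtx u) (vtx v) L := by
    intro u v
    obtain ⟨w⟩ := hG.preconnected u v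
    induction w with
    | nil => exact ⟨0, .nil⟩
    | cons h _ ih =>
      obtain ⟨L, hL⟩ := ih
      have := EdgePath.single (em := em) h (hcs.left_mem h) (hcs.right_mem h)
      rw [hcs.edge_start _ _ h, hcs.edge_end h] at this
      exact ⟨_, this.append hL⟩
  obtain ⟨u, v, s, h, hs, rfl⟩ := hcs.cover x
  obtain ⟨u', v', s', h', hs', rfl⟩ := hcs.cover y
  obtain ⟨L, hL⟩ := hv u u'
  rw [← hcs.edge_start _ _ h, ← hcs.edge_start _ _ h'] at hL
  exact ⟨_, ((EdgePath.single h hs (hcs.left_mem h)).append hL).append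
    (EdgePath.single h' (hcs.left_mem h') hs')⟩

/-- The distance of a cable system is the infimum of the lengths of edge paths. -/
theorem exists_edgePath_lt (hcs : IsCableSystem G ℓ μ vtx em) (hG : G.Connected) {x y : X}
    {r : ℝ} (hr : dist x y < r) : ∃ L < r, EdgePath G ℓ em x y L := by
  set d : X → X → ℝ := fun x y => sInf {L | EdgePath G ℓ em x y L}
  have hbdd : ∀ x y, BddBelow {L | EdgePath G ℓ em x y L} := fun x y => ⟨0, fun L h => h.nonneg⟩
  have hne : ∀ x y, {L | EdgePath G ℓ em x y L}.Nonempty := fun x y => hcs.exists_edgePath hG x y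
  have hnn : ∀ x y, 0 ≤ d x y := fun x y => le_csInf (hne x y) fun L h => h.nonneg
  have hd : d x y ≤ dist x y := by
    refine hcs.dist_maximal d (fun x => le_antisymm (csInf_le (hbdd x x) .nil) (hnn x x))
      (fun x y => ?_) (fun x y z => ?_) (fun u v h s hs t ht => ?_) x y
    · exact congrArg sInf (Set.ext fun L => ⟨EdgePath.reverse, EdgePath.reverse⟩)
    · refine le_of_forall_pos_lt_add fun ε hε => ?_
      obtain ⟨L, hL, hL'⟩ := exists_lt_of_csInf_lt (hne x y)
        (show d x y < d x y + ε / 2 by linarith)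
      obtain ⟨M, hM, hM'⟩ := exists_lt_of_csInf_lt (hne y z)
        (show d y z < d y z + ε / 2 by linarith)
      have := csInf_le (hbdd x z) (EdgePath.append hL hM)
      change d x z ≤ _ at this
      linarith
    · exact csInf_le (hbdd _ _) (EdgePath.single h hs ht)
  obtain ⟨L, hL, hL'⟩ := exists_lt_of_csInf_lt (hne x y) (hd.trans_lt hr)
  exact ⟨L, hL', hL⟩

theorem continuousOn_edge (hcs : IsCableSystem G ℓ μ vtx em) {u v : V} (h : G.Adj u v) :
    ContinuousOn (em u v) (Icc 0 (ℓ u v)) := by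
  refine LipschitzOnWith.continuousOn (K := 1) (LipschitzOnWith.of_dist_le_mul ?_)
  intro s hs t ht
  simpa [Real.dist_eq] using hcs.edge_lip u v h s hs t ht

theorem measurableSet_edge_image (hcs : IsCableSystem G ℓ μ vtx em) {u v : V} (h : G.Adj u v)
    {A : Set ℝ} (hA : MeasurableSet A) (hAs : A ⊆ Icc 0 (ℓ u v)) :
    MeasurableSet (em u v '' A) := by
  have := hcs.isBorel
  exact hA.image_of_continuousOn_injOn ((hcs.continuousOn_edge h).mono hAs)
    ((hcs.edge_inj u v h).mono hAs)

theorem measurableSet_edge_preimage (hcs : IsCableSystem G ℓ μ vtx em) {u v : V}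
    (h : G.Adj u v) {B : Set X} (hB : MeasurableSet B) {A : Set ℝ} (hA : MeasurableSet A)
    (hAs : A ⊆ Icc 0 (ℓ u v)) : MeasurableSet (A ∩ em u v ⁻¹' B) := by
  have := hcs.isBorel
  have h1 : Measurable (A.domRestrict (em u v)) :=
    (((hcs.continuousOn_edge h).mono hAs).domRestrict).measurable
  have h2 := hA.subtype_image (h1 hB)
  convert h2 using 1
  ext t
  simp only [mem_inter_iff, mem_preimage, mem_image, Subtype.exists, exists_and_right,
    exists_eq_right, Set.domRestrict_apply]
  exact ⟨fun h => ⟨h.1, h.2⟩, fun ⟨h, h'⟩ => ⟨h, h'⟩⟩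

theorem countable_vertices (hG : G.Connected) (hlf : ∀ v : V, (G.neighborSet v).Finite) :
    Countable V := by
  obtain ⟨v₀⟩ := hG.nonempty
  have hfin : ∀ n : ℕ, {v | ∃ w : G.Walk v₀ v, w.length = n}.Finite := by
    intro n
    induction n with
    | zero =>
      refine (finite_singleton v₀).subset ?_
      rintro v ⟨w, hw⟩
      exact (SimpleGraph.Walk.eq_of_length_eq_zero hw).symm
    | succ n ih =>
      refine (ih.biUnion fun v _ => hlf v).subset ?_
      rintro v ⟨w, hw⟩
      have hnn : ¬ w.Nil := by
        intro hn
        rw [SimpleGraph.Walk.length_eq_zero_iff.2 hn] at hw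
        omega
      refine mem_iUnion₂.2 ⟨w.penultimate, ⟨w.dropLast, ?_⟩, ?_⟩
      · simp [SimpleGraph.Walk.dropLast, hw]
      · exact w.adj_penultimate hnn
  refine countable_univ_iff.1 ((countable_iUnion fun n => (hfin n).countable).mono ?_)
  intro v _
  obtain ⟨w⟩ := hG.preconnected v₀ v
  exact mem_iUnion.2 ⟨w.length, w, rfl⟩

end IsCableSystem

/-! ### The lower bound by the distance for unit edge lengths -/

/-- `LipPath K x y L`: the points `x` and `y` are joined inside `K` by a `1`-Lipschitz curve
parametrised on `[0, L]`. -/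
def LipPath [PseudoMetricSpace X] (K : Set X) (x y : X) (L : ℝ) : Prop :=
  0 ≤ L ∧ ∃ γ : ℝ → X, LipschitzOnWith 1 γ (Icc 0 L) ∧ γ 0 = x ∧ γ L = y ∧
    ∀ t ∈ Icc 0 L, γ t ∈ K

namespace LipPath

theorem of_subinterval [PseudoMetricSpace X] {K : Set X} {γ : ℝ → X} {a b : ℝ} (hab : a ≤ b)
    (hγ : LipschitzOnWith 1 γ (Icc a b)) (hK : ∀ t ∈ Icc a b, γ t ∈ K) :
    LipPath K (γ a) (γ b) (b - a) := by
  refine ⟨sub_nonneg.2 hab, fun t => γ (a + t), ?_, by simp, by simp, fun t ht => hK _ ?_⟩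
  · refine LipschitzOnWith.of_dist_le_mul fun s hs t ht => ?_
    have := hγ.dist_le_mul (a + s) ⟨by linarith [hs.1], by linarith [hs.2]⟩ (a + t)
      ⟨by linarith [ht.1], by linarith [ht.2]⟩
    simpa using this
  · exact ⟨by linarith [ht.1], by linarith [ht.2]⟩

theorem mono [PseudoMetricSpace X] {K K' : Set X} {x y : X} {L : ℝ} (h : LipPath K x y L)
    (hK : K ⊆ K') : LipPath K' x y L :=
  ⟨h.1, h.2.imp fun _ hγ => ⟨hγ.1, hγ.2.1, hγ.2.2.1, fun t ht => hK (hγ.2.2.2 t ht)⟩⟩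

theorem reverse [PseudoMetricSpace X] {K : Set X} {x y : X} {L : ℝ} (h : LipPath K x y L) :
    LipPath K y x L := by
  obtain ⟨hL, γ, hγ, h0, h1, hK⟩ := h
  refine ⟨hL, fun t => γ (L - t), ?_, by simpa, by simpa, fun t ht => hK _ ?_⟩
  · refine LipschitzOnWith.of_dist_le_mul fun s hs t ht => ?_
    have := hγ.dist_le_mul (L - s) ⟨by linarith [hs.2], by linarith [hs.1]⟩ (L - t)
      ⟨by linarith [ht.2], by linarith [ht.1]⟩
    rwa [dist_sub_left] at this
  · exact ⟨by linarith [ht.2], by linarith [ht.1]⟩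

theorem append [PseudoMetricSpace X] {K : Set X} {x y z : X} {L M : ℝ} (h : LipPath K x y L)
    (h' : LipPath K y z M) : LipPath K x z (L + M) := by
  obtain ⟨hL, γ, hγ, h0, h1, hK⟩ := h
  obtain ⟨hM, γ', hγ', h0', h1', hK'⟩ := h'
  have hleft : ∀ t, t ≤ L → (if t ≤ L then γ t else γ' (t - L)) = γ t := fun t ht => if_pos ht
  have hright : ∀ t, L ≤ t → (if t ≤ L then γ t else γ' (t - L)) = γ' (t - L) := by
    intro t ht
    split_ifs with h
    · obtain rfl := le_antisymm h ht
      rw [sub_self, h1, h0']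
    · rfl
  refine ⟨by positivity, fun t => if t ≤ L then γ t else γ' (t - L), ?_, ?_, ?_, ?_⟩
  · have key : ∀ s ∈ Icc 0 (L + M), ∀ t ∈ Icc 0 (L + M), s ≤ t →
        dist (if s ≤ L then γ s else γ' (s - L)) (if t ≤ L then γ t else γ' (t - L)) ≤
          t - s := by
      intro s hs t ht hst
      rcases le_total t L with h | h
      · rw [hleft t h, hleft s (hst.trans h)]
        have := hγ.dist_le_mul s ⟨hs.1, hst.trans h⟩ t ⟨ht.1, h⟩
        rw [Real.dist_eq, abs_sub_comm, abs_of_nonneg (sub_nonneg.2 hst)] at this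
        simpa using this
      · have hγt : ∀ s ∈ Icc L (L + M), s ≤ t → dist (γ' (s - L)) (γ' (t - L)) ≤ t - s := by
          intro s hs hst
          have := hγ'.dist_le_mul (s - L) ⟨by linarith [hs.1], by linarith [hs.2]⟩ (t - L)
            ⟨by linarith, by linarith [ht.2]⟩
          rw [Real.dist_eq, abs_sub_comm, abs_of_nonneg (by linarith)] at this
          simpa using this
        rw [hright t h]
        rcases le_total s L with h2 | h2
        · rw [hleft s h2]
          have e1 := hγ.dist_le_mul s ⟨hs.1, h2⟩ L ⟨hL, le_rfl⟩
          rw [Real.dist_eq, abs_sub_comm, abs_of_nonneg (by linarith)] at e1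
          have e2 := hγt L ⟨le_rfl, by linarith⟩ h
          rw [sub_self, h0', ← h1] at e2
          have := dist_triangle (γ s) (γ L) (γ' (t - L))
          simp only [NNReal.coe_one, one_mul] at e1
          linarith
        · rw [hright s h2]
          exact hγt s ⟨h2, hs.2⟩ hst
    refine LipschitzOnWith.of_dist_le_mul fun s hs t ht => ?_
    rw [NNReal.coe_one, one_mul, Real.dist_eq]
    rcases le_total s t with h | h
    · rw [abs_sub_comm, abs_of_nonneg (sub_nonneg.2 h)]
      exact key s hs t ht h
    · rw [dist_comm, abs_of_nonneg (sub_nonneg.2 h)]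
      exact key t ht s hs h
  · simpa [hL] using h0
  · dsimp only
    rw [hright (L + M) (by linarith), add_sub_cancel_left, h1']
  · intro t ht
    dsimp only
    split_ifs with h
    · exact hK t ⟨ht.1, h⟩
    · exact hK' _ ⟨by linarith, by linarith [ht.2]⟩

/-- In a compact set the infimum of the lengths of the curves joining two points is attained. -/
theorem exists_minimal [MetricSpace X] {K : Set X} (hKc : IsCompact K) {x y : X} {L : ℝ}
    (h : LipPath K x y L) :
    ∃ L₀ ≤ L, LipPath K x y L₀ ∧ ∀ M, LipPath K x y M → L₀ ≤ M := by
  have hbdd : BddBelow {M | LipPath K x y M} := ⟨0, fun M hM => hM.1⟩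
  have hne : {M | LipPath K x y M}.Nonempty := ⟨L, h⟩
  set L₀ := sInf {M | LipPath K x y M} with hL₀
  have h0 : 0 ≤ L₀ := le_csInf hne fun M hM => hM.1
  refine ⟨L₀, csInf_le hbdd h, ?_, fun M hM => csInf_le hbdd hM⟩
  obtain ⟨M, -, hMt, hM⟩ := exists_seq_tendsto_sInf hne hbdd
  choose hM0 γ hγ hγ0 hγ1 hγK using hM
  have hle : ∀ n, L₀ ≤ M n := fun n => csInf_le hbdd ⟨hM0 n, γ n, hγ n, hγ0 n, hγ1 n, hγK n⟩
  set U : Ultrafilter ℕ := Filter.hyperfilter ℕ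
  have hU : (U : Filter ℕ) ≤ atTop := Nat.hyperfilter_le_atTop
  have hlim : ∀ t ∈ Icc 0 L₀, ∃ z ∈ K, Tendsto (fun n => γ n t) U (nhds z) := by
    intro t ht
    have := hKc.ultrafilter_le_nhds (U.map fun n => γ n t) ?_
    · exact this
    · rw [le_principal_iff, Ultrafilter.mem_coe, Ultrafilter.mem_map]
      exact Filter.Eventually.of_forall fun n => hγK n t ⟨ht.1, ht.2.trans (hle n)⟩
  have : Nonempty X := ⟨x⟩
  choose! g hgK hg using hlim
  refine ⟨h0, g, ?_, ?_, ?_, hgK⟩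
  · refine LipschitzOnWith.of_dist_le_mul fun s hs t ht => ?_
    refine le_of_tendsto ((hg s hs).dist (hg t ht)) (Filter.Eventually.of_forall fun n => ?_)
    exact (hγ n).dist_le_mul s ⟨hs.1, hs.2.trans (hle n)⟩ t ⟨ht.1, ht.2.trans (hle n)⟩
  · refine tendsto_nhds_unique (hg 0 ⟨le_rfl, h0⟩) ?_
    simp only [hγ0]
    exact tendsto_const_nhds
  · refine tendsto_nhds_unique (hg L₀ ⟨h0, le_rfl⟩) ?_
    rw [tendsto_iff_dist_tendsto_zero]
    have hz : Tendsto (fun n => M n - L₀) U (nhds 0) := by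
      have := (hMt.mono_left hU).sub_const L₀
      rwa [← hL₀, sub_self] at this
    refine squeeze_zero (fun n => dist_nonneg) (fun n => ?_) hz
    rw [← hγ1 n]
    have := (hγ n).dist_le_mul L₀ ⟨h0, hle n⟩ (M n) ⟨hM0 n, le_rfl⟩
    rw [Real.dist_eq, abs_sub_comm, abs_of_nonneg (sub_nonneg.2 (hle n))] at this
    simpa using this

end LipPath

namespace IsCableSystem

variable {G : SimpleGraph V} {ℓ : V → V → ℝ} [MetricSpace X] [MeasurableSpace X]
  {μ : Measure X} {vtx : V → X} {em : V → V → ℝ → X}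

theorem lipPath_edge (hcs : IsCableSystem G ℓ μ vtx em) {u v : V} (h : G.Adj u v) {s t : ℝ}
    (hs : s ∈ Icc 0 (ℓ u v)) (ht : t ∈ Icc 0 (ℓ u v)) :
    LipPath (em u v '' Icc 0 (ℓ u v)) (em u v s) (em u v t) |s - t| := by
  wlog hst : s ≤ t generalizing s t
  · rw [abs_sub_comm]
    exact (this ht hs (le_of_not_ge hst)).reverse
  rw [abs_sub_comm, abs_of_nonneg (sub_nonneg.2 hst)]
  have hsub : Icc s t ⊆ Icc 0 (ℓ u v) := Icc_subset_Icc hs.1 ht.2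
  refine LipPath.of_subinterval hst (LipschitzOnWith.of_dist_le_mul fun a ha b hb => ?_)
    fun a ha => mem_image_of_mem _ (hsub ha)
  simpa [Real.dist_eq] using hcs.edge_lip u v h a (hsub ha) b (hsub hb)

theorem exists_lipPath (hcs : IsCableSystem G ℓ μ vtx em) {x y : X} {L : ℝ}
    (h : EdgePath G ℓ em x y L) :
    ∃ S : Set {e : V × V // G.Adj e.1 e.2}, S.Finite ∧
      (LipPath (⋃ e ∈ S, em e.1.1 e.1.2 '' Icc 0 (ℓ e.1.1 e.1.2)) x y L ∨ x = y) := by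
  induction h with
  | nil => exact ⟨∅, finite_empty, Or.inr rfl⟩
  | @snoc L u v s t hp ha hs ht ih =>
    obtain ⟨S, hS, hp'⟩ := ih
    have hedge := (hcs.lipPath_edge ha hs ht).mono (K' := ⋃ e ∈ insert ⟨(u, v), ha⟩ S,
      em e.1.1 e.1.2 '' Icc 0 (ℓ e.1.1 e.1.2)) (subset_biUnion_of_mem
        (u := fun e : {e : V × V // G.Adj e.1 e.2} => em e.1.1 e.1.2 '' Icc 0 (ℓ e.1.1 e.1.2))
        (mem_insert (⟨(u, v), ha⟩ : {e : V × V // G.Adj e.1 e.2}) S))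
    refine ⟨insert ⟨(u, v), ha⟩ S, hS.insert _, Or.inl ?_⟩
    have hx : LipPath (⋃ e ∈ insert (⟨(u, v), ha⟩ : {e : V × V // G.Adj e.1 e.2}) S,
        em e.1.1 e.1.2 '' Icc 0 (ℓ e.1.1 e.1.2)) x (em u v s) L := by
      rcases hp' with hp' | rfl
      · exact hp'.mono (biUnion_subset_biUnion_left (subset_insert _ _))
      · refine ⟨hp.nonneg, fun _ => em u v s, LipschitzOnWith.of_dist_le_mul fun a _ b _ => ?_,
          rfl, rfl, fun t _ => ?_⟩
        · simp
        · exact mem_biUnion (mem_insert _ _) (mem_image_of_mem _ hs)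
    exact hx.append hedge

theorem one_div_le_modulus_of_edgePath (hcs : IsCableSystem G (fun _ _ => 1) μ vtx em)
    {E F : Set X} {x y : X} (hx : x ∈ E) (hy : y ∈ F) (hxy : x ≠ y) {L : ℝ}
    (h : EdgePath G (fun _ _ => 1) em x y L) :
    ENNReal.ofReal (1 / L) ≤ modulus μ (JoiningCurves E F) := by
  have := hcs.isBorel
  obtain ⟨S, hS, hp⟩ := hcs.exists_lipPath h
  replace hp := hp.resolve_right hxy
  have hKc : IsCompact (⋃ e ∈ S, em e.1.1 e.1.2 '' Icc (0 : ℝ) 1) :=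
    hS.isCompact_biUnion fun e _ => isCompact_Icc.image_of_continuousOn (hcs.continuousOn_edge e.2)
  obtain ⟨M, hML, ⟨hM0, γ, hγ, hγ0, hγ1, hγK⟩, hmin⟩ := hp.exists_minimal hKc
  have hMpos : 0 < M := by
    refine lt_of_le_of_ne hM0 fun h => hxy ?_
    rw [← hγ0, ← hγ1, ← h]
  have hshort : ∀ e ∈ S, ∀ a ∈ Icc (0 : ℝ) 1, ∀ b ∈ Icc (0 : ℝ) 1, ∀ t ∈ Icc 0 M,
      ∀ t' ∈ Icc 0 M, γ t = em e.1.1 e.1.2 a → γ t' = em e.1.1 e.1.2 b → t ≤ t' →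
        t' - t ≤ |a - b| := by
    intro e he a ha b hb t ht t' ht' h1 h2 htt
    have p1 := LipPath.of_subinterval ht.1 (hγ.mono (Icc_subset_Icc le_rfl ht.2))
      fun r hr => hγK r ⟨hr.1, hr.2.trans ht.2⟩
    have p2 := LipPath.of_subinterval ht'.2 (hγ.mono (Icc_subset_Icc ht'.1 le_rfl))
      fun r hr => hγK r ⟨ht'.1.trans hr.1, hr.2⟩
    have p3 := (hcs.lipPath_edge e.2 ha hb).mono (subset_biUnion_of_mem
        (u := fun e : {e : V × V // G.Adj e.1 e.2} => em e.1.1 e.1.2 '' Icc (0 : ℝ) 1) he)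
    rw [← h1, ← h2] at p3
    have := hmin _ (by simpa only [hγ0, hγ1] using (p1.append p3).append p2)
    linarith
  set g : ℝ → X := fun t => γ (projIcc 0 M hM0 t) with hg
  have hgγ : ∀ t ∈ Icc 0 M, g t = γ t := fun t ht => by rw [hg]; simp [projIcc_of_mem hM0 ht]
  have hgc : Continuous g := (hγ.continuousOn.domRestrict).comp continuous_projIcc
  have hpush : ∀ B, MeasurableSet B → (volume.restrict (Icc 0 M)).map g B ≤ μ B := by
    intro B hB
    have : Countable S := hS.countable
    set K := ⋃ e ∈ S, em e.1.1 e.1.2 '' Icc (0 : ℝ) 1 with hK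
    have hgK : (volume.restrict (Icc 0 M)).map g Kᶜ = 0 := by
      rw [Measure.map_apply hgc.measurable hKc.measurableSet.compl,
        Measure.restrict_apply (hgc.measurable hKc.measurableSet.compl)]
      have hemp : g ⁻¹' Kᶜ ∩ Icc 0 M = ∅ :=
        eq_empty_of_forall_notMem fun t ht => ht.1 ((hgγ t ht.2).symm ▸ hγK t ht.2)
      rw [hemp, measure_empty]
    have hBK : (volume.restrict (Icc 0 M)).map g (B ∩ K) ≤ μ (B ∩ K) := by
      refine measure_le_of_countable_cover _ _
        (fun e : S => em e.1.1.1 e.1.1.2 '' Icc (0 : ℝ) 1)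
        (fun e => hcs.measurableSet_edge_image e.1.2 measurableSet_Icc le_rfl) ?_
        (hB.inter hKc.measurableSet) ?_
      · rintro ⟨e, he⟩ B hB hBe
        set A := Icc (0 : ℝ) 1 ∩ em e.1.1 e.1.2 ⁻¹' B with hA
        have hBA : B = em e.1.1 e.1.2 '' A := by
          rw [hA, image_inter_preimage, inter_eq_right.2 hBe]
        have hAm : MeasurableSet A :=
          hcs.measurableSet_edge_preimage e.2 hB measurableSet_Icc le_rfl
        have hμ : μ B = volume A := by
          rw [hBA, hcs.measure_edge _ _ e.2 A hAm inter_subset_left]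
          simp
        rw [hμ, Measure.map_apply hgc.measurable hB, Measure.restrict_apply (hgc.measurable hB)]
        have hex : ∀ a : ℝ, ∃ t, (∃ t' ∈ Icc 0 M, γ t' = em e.1.1 e.1.2 a) →
            t ∈ Icc 0 M ∧ γ t = em e.1.1 e.1.2 a := by
          intro a
          by_cases h : ∃ t' ∈ Icc 0 M, γ t' = em e.1.1 e.1.2 a
          · exact ⟨h.choose, fun _ => h.choose_spec⟩
          · exact ⟨0, fun h' => (h h').elim⟩
        choose κ hκ using hex
        set A' := {a ∈ A | ∃ t' ∈ Icc 0 M, γ t' = em e.1.1 e.1.2 a} with hA'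
        have hLip : LipschitzOnWith 1 κ A' := by
          refine LipschitzOnWith.of_dist_le_mul fun a ha b hb => ?_
          rw [NNReal.coe_one, one_mul, Real.dist_eq, Real.dist_eq]
          obtain ⟨m1, e1⟩ := hκ a ha.2
          obtain ⟨m2, e2⟩ := hκ b hb.2
          rcases le_total (κ a) (κ b) with h | h
          · rw [abs_sub_comm, abs_of_nonneg (sub_nonneg.2 h)]
            exact hshort e he a ha.1.1 b hb.1.1 _ m1 _ m2 e1 e2 h
          · rw [abs_of_nonneg (sub_nonneg.2 h), abs_sub_comm a b]
            exact hshort e he b hb.1.1 a ha.1.1 _ m2 _ m1 e2 e1 h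
        have hsub : g ⁻¹' B ∩ Icc 0 M ⊆ κ '' A' := by
          rintro t ⟨htB, ht⟩
          rw [mem_preimage, hgγ t ht, hBA] at htB
          obtain ⟨a, ha, hat⟩ := htB
          refine ⟨a, ⟨ha, t, ht, hat.symm⟩, ?_⟩
          obtain ⟨m1, e1⟩ := hκ a ⟨t, ht, hat.symm⟩
          rcases le_total (κ a) t with h | h
          · have := hshort e he a ha.1 a ha.1 _ m1 _ ht e1 hat.symm h
            simp only [sub_self, abs_zero] at this
            linarith
          · have := hshort e he a ha.1 a ha.1 _ ht _ m1 hat.symm e1 h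
            simp only [sub_self, abs_zero] at this
            linarith
        have himg := hLip.hausdorffMeasure_image_le (d := 1) zero_le_one
        rw [hausdorffMeasure_real] at himg
        calc volume (g ⁻¹' B ∩ Icc 0 M) ≤ volume (κ '' A') := measure_mono hsub
          _ ≤ volume A' := by simpa using himg
          _ ≤ volume A := measure_mono fun a ha => ha.1
      · rw [iUnion_coe_set]
        exact inter_subset_right
    calc (volume.restrict (Icc 0 M)).map g B
        ≤ (volume.restrict (Icc 0 M)).map g (B ∩ K) +
            (volume.restrict (Icc 0 M)).map g (B \ K) := measure_le_inter_add_sdiff _ _ _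
      _ ≤ μ (B ∩ K) + 0 := by
          gcongr
          exact (measure_mono (sdiff_subset_compl _ _)).trans hgK.le
      _ ≤ μ B := by
          rw [add_zero]
          exact measure_mono inter_subset_left
  have hpushle : (volume.restrict (Icc 0 M)).map g ≤ μ := Measure.le_iff.2 hpush
  refine le_iInf₂ fun ρ hρ => ?_
  have hadm : 1 ≤ ∫⁻ t in Icc 0 M, ρ (g t) := by
    have hgL : LipschitzOnWith 1 g (Icc 0 M) := by
      refine LipschitzOnWith.of_dist_le_mul fun s hs t ht => ?_
      rw [hgγ s hs, hgγ t ht]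
      exact hγ.dist_le_mul s hs t ht
    refine hρ.2 (0, M, g) ⟨hM0, hgc.continuousOn, ?_, ?_⟩ g M
      ⟨hM0, hgL, id, monotoneOn_id, by simp, fun t _ => rfl⟩
    · simpa [hgγ 0 ⟨le_rfl, hM0⟩, hγ0] using hx
    · simpa [hgγ M ⟨hM0, le_rfl⟩, hγ1] using hy
  calc ENNReal.ofReal (1 / L) ≤ ENNReal.ofReal (1 / M) :=
        ENNReal.ofReal_le_ofReal (one_div_le_one_div_of_le hMpos hML)
    _ ≤ ∫⁻ t in Icc 0 M, ρ (g t) ^ 2 := inv_length_le_lintegral_sq hMpos _ hadm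
    _ = ∫⁻ x, ρ x ^ 2 ∂(volume.restrict (Icc 0 M)).map g :=
        (lintegral_map (hρ.1.pow_const 2) hgc.measurable).symm
    _ ≤ ∫⁻ x, ρ x ^ 2 ∂μ := lintegral_mono' hpushle le_rfl

theorem one_div_setDist_le_modulus (hcs : IsCableSystem G (fun _ _ => 1) μ vtx em)
    (hG : G.Connected) {E F : Set X} (hE : E.Nonempty) (hF : F.Nonempty) (hEF : Disjoint E F) :
    ENNReal.ofReal (1 / setDist E F) ≤ modulus μ (JoiningCurves E F) := by
  rcases le_or_gt (setDist E F) 0 with h0 | h0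
  · rw [ENNReal.ofReal_of_nonpos (one_div_nonpos.2 h0)]
    exact zero_le
  have hlt : ∀ r, setDist E F < r → ENNReal.ofReal (1 / r) ≤ modulus μ (JoiningCurves E F) := by
    intro r hr
    obtain ⟨-, ⟨⟨x, y⟩, ⟨hx, hy⟩, rfl⟩, hd⟩ :=
      exists_lt_of_csInf_lt ((hE.prod hF).image _) hr
    obtain ⟨L, hL, hp⟩ := hcs.exists_edgePath_lt hG hd
    have hxy : x ≠ y := fun h => disjoint_left.1 hEF hx (h ▸ hy)
    have hL0 : 0 < L := (dist_pos.2 hxy).trans_le (hcs.dist_le_of_edgePath hp)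
    exact (ENNReal.ofReal_le_ofReal (one_div_le_one_div_of_le hL0 hL.le)).trans
      (hcs.one_div_le_modulus_of_edgePath hx hy hxy hp)
  have hc : ContinuousAt (fun r : ℝ => ENNReal.ofReal (1 / r)) (setDist E F) :=
    ENNReal.continuous_ofReal.continuousAt.comp
      (continuousAt_const.div continuousAt_id h0.ne')
  exact le_of_tendsto (hc.mono_left nhdsWithin_le_nhds : Tendsto _ (nhdsWithin _ (Ioi _)) _)
    (eventually_mem_nhdsWithin.mono hlt)

end IsCableSystem

/-! ### Local structure of the metric near an edge -/

/-- `Descend G ℓ em e c p y L`: the point `y` is reached from `p`, within length `L`, by walking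
away from initial points of successive edges different from `e` and of length at least `c`. -/
inductive Descend (G : SimpleGraph V) (ℓ : V → V → ℝ) (em : V → V → ℝ → X) (e : Sym2 V) (c : ℝ)
    (p : X) : X → ℝ → Prop
  | base {L : ℝ} : 0 ≤ L → Descend G ℓ em e c p p L
  | down {u v : V} {s L L' : ℝ} : Descend G ℓ em e c p (em u v 0) L → G.Adj u v →
      s(u, v) ≠ e → c ≤ ℓ u v → s ∈ Ioo 0 (ℓ u v) → L + s ≤ L' →
      Descend G ℓ em e c p (em u v s) L'

namespace Descend

variable {G : SimpleGraph V} {ℓ : V → V → ℝ} {em : V → V → ℝ → X} {e : Sym2 V} {c : ℝ} {p y : X}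
  {L L' : ℝ}

theorem nonneg (h : Descend G ℓ em e c p y L) : 0 ≤ L := by
  induction h with
  | base h => exact h
  | down _ _ _ _ hs hL ih => linarith [hs.1]

theorem mono (h : Descend G ℓ em e c p y L) (hL : L ≤ L') : Descend G ℓ em e c p y L' := by
  cases h with
  | base h => exact .base (h.trans hL)
  | down h ha hne hc hs hL' => exact .down h ha hne hc hs (hL'.trans hL)

theorem inv (h : Descend G ℓ em e c p y L) :
    y = p ∨ ∃ u v s L₀, Descend G ℓ em e c p (em u v 0) L₀ ∧ G.Adj u v ∧ s(u, v) ≠ e ∧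
      c ≤ ℓ u v ∧ s ∈ Ioo 0 (ℓ u v) ∧ L₀ + s ≤ L ∧ y = em u v s := by
  cases h with
  | base h => exact Or.inl rfl
  | down h ha hne hc hs hL' => exact Or.inr ⟨_, _, _, _, h, ha, hne, hc, hs, hL', rfl⟩

end Descend

namespace IsCableSystem

variable {G : SimpleGraph V} {ℓ : V → V → ℝ} [MetricSpace X] [MeasurableSpace X]
  {μ : Measure X} {vtx : V → X} {em : V → V → ℝ → X} {a b : V} {c : ℝ}

theorem dist_le_of_descend (hcs : IsCableSystem G ℓ μ vtx em) {e : Sym2 V} {p y : X} {L : ℝ}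
    (h : Descend G ℓ em e c p y L) : dist p y ≤ L := by
  induction h with
  | base h => simpa
  | @down u v s L L' _ ha _ _ hs hL ih =>
    have := hcs.edge_lip u v ha 0 (hcs.left_mem ha) s (Ioo_subset_Icc_self hs)
    rw [zero_sub, abs_neg, abs_of_pos hs.1] at this
    linarith [dist_triangle p (em u v 0) (em u v s)]

theorem mk_eq_of_interior_eq (hcs : IsCableSystem G ℓ μ vtx em) {u v u' v' : V}
    (h : G.Adj u v) (h' : G.Adj u' v') {s s' : ℝ} (hs : s ∈ Ioo 0 (ℓ u v))
    (hs' : s' ∈ Ioo 0 (ℓ u' v')) (heq : em u v s = em u' v' s') : s(u, v) = s(u', v') := by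
  rcases hcs.interior_disjoint u v u' v' h h' s hs s' hs' heq with ⟨rfl, rfl, -⟩ | ⟨rfl, rfl, -⟩
  · rfl
  · exact Sym2.eq_swap

theorem descend_step (hcs : IsCableSystem G ℓ μ vtx em) (hab : G.Adj a b) {σ : ℝ}
    (hσ : σ ∈ Ioo 0 (ℓ a b)) {u v : V} {s t L : ℝ}
    (h : Descend G ℓ em s(a, b) c (em a b σ) (em u v s) L) (ha : G.Adj u v)
    (hne : s(u, v) ≠ s(a, b)) (hc : c ≤ ℓ u v) (hs : s ∈ Icc 0 (ℓ u v)) (ht : t ∈ Icc 0 (ℓ u v))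
    (hL : L + |s - t| < c) : Descend G ℓ em s(a, b) c (em a b σ) (em u v t) (L + |s - t|) := by
  have hL0 := h.nonneg
  have hstart : ∀ {u v : V} {t L₀ L' : ℝ},
      Descend G ℓ em s(a, b) c (em a b σ) (em u v 0) L₀ → G.Adj u v → s(u, v) ≠ s(a, b) →
      c ≤ ℓ u v → t ∈ Icc 0 (ℓ u v) → t < c → L₀ + t ≤ L' →
      Descend G ℓ em s(a, b) c (em a b σ) (em u v t) L' := by
    intro u v t L₀ L' h ha hne hc ht htc hL'
    rcases ht.1.eq_or_lt with rfl | h0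
    · exact h.mono (by linarith)
    · exact h.down ha hne hc ⟨h0, htc.trans_le hc⟩ hL'
  have hflip : s(v, u) ≠ s(a, b) := by rwa [Sym2.eq_swap]
  have hcv : c ≤ ℓ v u := by rwa [hcs.len_symm]
  have htv : ℓ u v - t ∈ Icc 0 (ℓ v u) := by
    rw [hcs.len_symm v u]
    exact ⟨sub_nonneg.2 ht.2, by linarith [ht.1]⟩
  rcases hs.1.eq_or_lt with rfl | h0
  · have habs : |0 - t| = t := by rw [zero_sub, abs_neg, abs_of_nonneg ht.1]
    rw [habs] at hL ⊢
    exact hstart h ha hne hc ht (by linarith) le_rfl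
  rcases hs.2.eq_or_lt with rfl | h1
  · rw [abs_of_nonneg (sub_nonneg.2 ht.2)] at hL ⊢
    rw [hcs.edge_flip u v ha] at h ⊢
    rw [sub_self] at h
    exact hstart h ha.symm hflip hcv htv (by linarith) le_rfl
  rcases h.inv with h | ⟨u', v', s', L₀, h', ha', hne', hc', hs', hL', heq⟩
  · exact (hne (hcs.mk_eq_of_interior_eq ha hab ⟨h0, h1⟩ hσ h)).elim
  have hL₀ := h'.nonneg
  rcases hcs.interior_disjoint u v u' v' ha ha' s ⟨h0, h1⟩ s' hs' heq with
    ⟨rfl, rfl, rfl⟩ | ⟨rfl, rfl, rfl⟩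
  · have := neg_abs_le (s - t)
    exact hstart h' ha hne hc ht (by linarith) (by linarith)
  · have := le_abs_self (ℓ u v - s' - t)
    rw [hcs.edge_flip u v ha t]
    exact hstart h' ha.symm hflip hcv htv (by linarith) (by linarith)

theorem descend_unique (hcs : IsCableSystem G ℓ μ vtx em) (hab : G.Adj a b) {σ σ' : ℝ}
    (hσ : σ ∈ Ioo 0 (ℓ a b)) (hσ' : σ' ∈ Ioo 0 (ℓ a b)) {y : X} {L L' : ℝ}
    (h : Descend G ℓ em s(a, b) c (em a b σ) y L) (h' : Descend G ℓ em s(a, b) c (em a b σ') y L')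
    (hL : L + L' < c) : σ = σ' := by
  induction h generalizing L' with
  | base _ =>
    rcases h'.inv with h | ⟨u, v, s, L₀, -, ha, hne, -, hs, -, heq⟩
    · exact hcs.edge_inj a b hab (Ioo_subset_Icc_self hσ) (Ioo_subset_Icc_self hσ') h
    · exact (hne (hcs.mk_eq_of_interior_eq ha hab hs hσ heq.symm)).elim
  | @down u v s L L₁ hd ha hne hc hs hL₁ ih =>
    have habs : |s - 0| = s := by rw [sub_zero, abs_of_pos hs.1]
    have hd0 := hd.nonneg
    have := hcs.descend_step hab hσ' h' ha hne hc (Ioo_subset_Icc_self hs) (hcs.left_mem ha)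
      (by rw [habs]; linarith)
    rw [habs] at this
    exact ih this (by linarith)

theorem exists_descend_root (hcs : IsCableSystem G ℓ μ vtx em) (hab : G.Adj a b) (c : ℝ) (y : X) :
    ∃ q, ∀ σ ∈ Ioo 0 (ℓ a b), ∀ L < c / 2, Descend G ℓ em s(a, b) c (em a b σ) y L → σ = q := by
  by_cases h : ∃ q ∈ Ioo 0 (ℓ a b), ∃ L < c / 2, Descend G ℓ em s(a, b) c (em a b q) y L
  · obtain ⟨q, hq, L', hL', hd'⟩ := h
    exact ⟨q, fun σ hσ L hL hd => hcs.descend_unique hab hσ hq hd hd' (by linarith)⟩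
  · push Not at h
    exact ⟨0, fun σ hσ L hL hd => (h σ hσ L hL hd).elim⟩

/-- Near an edge, a `1`-Lipschitz function of the arclength parameter that vanishes at the end
points and at two further exceptional points does not increase distances. -/
theorem exists_exceptional_points (hcs : IsCableSystem G ℓ μ vtx em) (hab : G.Adj a b) (c : ℝ) :
    ∃ q₀ q₁ : ℝ, ∀ x₀ : X,
      (∀ u v, G.Adj u v → ∀ s ∈ Icc 0 (ℓ u v), dist x₀ (em u v s) < c → c ≤ ℓ u v) →
      ∀ h : ℝ → ℝ, LipschitzWith 1 h → (∀ s, 0 ≤ h s) → (∀ s, h s ≤ c / 2) →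
      (∀ s ∈ Icc 0 (ℓ a b), 0 < h s → dist x₀ (em a b s) < c / 2) →
      h 0 = 0 → h (ℓ a b) = 0 → h q₀ = 0 → h q₁ = 0 →
      ∀ s ∈ Icc 0 (ℓ a b), ∀ t ∈ Icc 0 (ℓ a b), |h s - h t| ≤ dist (em a b s) (em a b t) := by
  obtain ⟨q₀, hq₀⟩ := hcs.exists_descend_root hab c (em a b 0)
  obtain ⟨q₁, hq₁⟩ := hcs.exists_descend_root hab c (em a b (ℓ a b))
  refine ⟨q₀, q₁, fun x₀ hx₀ h hLip h0 hc2 hnear hz hzℓ hz₀ hz₁ => ?_⟩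
  have hLip' : ∀ s t, h s ≤ h t + |s - t| := by
    intro s t
    have := hLip.dist_le_mul s t
    rw [Real.dist_eq, Real.dist_eq, NNReal.coe_one, one_mul] at this
    linarith [le_abs_self (h s - h t)]
  have hroot : ∀ σ ∈ Ioo 0 (ℓ a b), ∀ s ∈ Icc 0 (ℓ a b), ∀ L < c / 2,
      Descend G ℓ em s(a, b) c (em a b σ) (em a b s) L → 0 < h σ → σ = s := by
    intro σ hσ s hs L hL hd hpos
    rcases hs.1.eq_or_lt with rfl | hs0
    · exact (hpos.ne' (hq₀ σ hσ L hL hd ▸ hz₀)).elim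
    rcases hs.2.eq_or_lt with rfl | hs1
    · exact (hpos.ne' (hq₁ σ hσ L hL hd ▸ hz₁)).elim
    have := hd.nonneg
    exact hcs.descend_unique hab hσ ⟨hs0, hs1⟩ hd (.base le_rfl) (by linarith)
  set S : X → Set ℝ := fun y => {r | r = 0 ∨ ∃ σ ∈ Ioo 0 (ℓ a b), ∃ L,
    Descend G ℓ em s(a, b) c (em a b σ) y L ∧ r = min (h σ) (c / 2 - L)} with hS
  have hc : 0 ≤ c / 2 := (h0 0).trans (hc2 0)
  have hbdd : ∀ y, BddAbove (S y) := by
    refine fun y => ⟨c / 2, ?_⟩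
    rintro r (rfl | ⟨σ, -, L, -, rfl⟩)
    · exact hc
    · exact (min_le_left _ _).trans (hc2 σ)
  have hne : ∀ y, (S y).Nonempty := fun y => ⟨0, Or.inl rfl⟩
  set φ : X → ℝ := fun y => sSup (S y) with hφ
  have hφ0 : ∀ y, 0 ≤ φ y := fun y => le_csSup (hbdd y) (Or.inl rfl)
  have hφle : ∀ s ∈ Icc 0 (ℓ a b), h s ≤ φ (em a b s) := by
    intro s hs
    rcases hs.1.eq_or_lt with rfl | hs0
    · exact hz.le.trans (hφ0 _)
    rcases hs.2.eq_or_lt with rfl | hs1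
    · exact hzℓ.le.trans (hφ0 _)
    refine le_csSup (hbdd _) (Or.inr ⟨s, ⟨hs0, hs1⟩, 0, .base le_rfl, ?_⟩)
    rw [sub_zero, min_eq_left (hc2 s)]
  have hφeq : ∀ s ∈ Icc 0 (ℓ a b), φ (em a b s) = h s := by
    refine fun s hs => le_antisymm (csSup_le (hne _) ?_) (hφle s hs)
    rintro r (rfl | ⟨σ, hσ, L, hd, rfl⟩)
    · exact h0 s
    by_contra! hlt
    have hpos := (h0 s).trans_lt hlt
    obtain rfl := hroot σ hσ s hs L (by linarith [min_le_right (h σ) (c / 2 - L)]) hd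
      (hpos.trans_le (min_le_left _ _))
    exact hlt.not_ge (min_le_left _ _)
  have hstep : ∀ u v, G.Adj u v → ∀ s ∈ Icc 0 (ℓ u v), ∀ t ∈ Icc 0 (ℓ u v),
      φ (em u v s) ≤ φ (em u v t) + |s - t| := by
    intro u v ha s hs t ht
    by_cases he : s(u, v) = s(a, b)
    · rcases Sym2.eq_iff.1 he with ⟨rfl, rfl⟩ | ⟨rfl, rfl⟩
      · rw [hφeq s hs, hφeq t ht]
        exact hLip' s t
      · have hm : ∀ r ∈ Icc 0 (ℓ u v), ℓ u v - r ∈ Icc 0 (ℓ v u) := fun r hr => by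
          rw [hcs.len_symm v u]
          exact ⟨sub_nonneg.2 hr.2, by linarith [hr.1]⟩
        rw [hcs.edge_flip u v ha s, hcs.edge_flip u v ha t, hφeq _ (hm s hs), hφeq _ (hm t ht)]
        have := hLip' (ℓ u v - s) (ℓ u v - t)
        rwa [show ℓ u v - s - (ℓ u v - t) = t - s by ring, abs_sub_comm] at this
    · refine csSup_le (hne _) ?_
      rintro r (rfl | ⟨σ, hσ, L, hd, rfl⟩)
      · exact add_nonneg (hφ0 _) (abs_nonneg _)
      by_contra! hlt
      have h1 := min_le_left (h σ) (c / 2 - L)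
      have h2 := min_le_right (h σ) (c / 2 - L)
      have h3 := hφ0 (em u v t)
      have h4 := abs_nonneg (s - t)
      have h5 := hnear σ (Ioo_subset_Icc_self hσ) (by linarith)
      have h6 := hcs.dist_le_of_descend hd
      have h7 := hx₀ u v ha s hs (by linarith [dist_triangle x₀ (em a b σ) (em u v s)])
      have hd' := hcs.descend_step hab hσ hd ha he h7 hs ht (by linarith)
      have h8 : min (h σ) (c / 2 - (L + |s - t|)) ≤ φ (em u v t) :=
        le_csSup (hbdd _) (Or.inr ⟨σ, hσ, _, hd', rfl⟩)
      have h9 : min (h σ) (c / 2 - L) - |s - t| ≤ min (h σ) (c / 2 - (L + |s - t|)) :=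
        le_min (by linarith) (by linarith)
      linarith
  intro s hs t ht
  rw [← hφeq s hs, ← hφeq t ht]
  refine hcs.dist_maximal (fun x y => |φ x - φ y|) (by simp) (fun x y => abs_sub_comm _ _)
    (fun x y z => abs_sub_le _ _ _) (fun u v ha s hs t ht => ?_) _ _
  have h1 := hstep u v ha s hs t ht
  have h2 := hstep u v ha t ht s hs
  rw [abs_sub_comm t s] at h2
  exact abs_sub_le_iff.2 ⟨by linarith, by linarith⟩

end IsCableSystem

/-- The tent function of height `m` centred at `z`. -/
def tent (z m s : ℝ) : ℝ := max 0 (m - |s - z|)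

theorem lipschitzWith_tent (z m : ℝ) : LipschitzWith 1 (tent z m) := by
  refine LipschitzWith.of_le_add fun s t => ?_
  have := abs_sub_le t s z
  rw [Real.dist_eq, abs_sub_comm s t]
  refine max_le (by unfold tent; positivity) ?_
  have := le_max_right 0 (m - |t - z|)
  unfold tent
  linarith

theorem tent_nonneg (z m s : ℝ) : 0 ≤ tent z m s := le_max_left _ _

theorem tent_le {m : ℝ} (hm : 0 ≤ m) (z s : ℝ) : tent z m s ≤ m :=
  max_le hm (by linarith [abs_nonneg (s - z)])

theorem tent_eq_zero {z m s : ℝ} (h : m ≤ |s - z|) : tent z m s = 0 :=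
  max_eq_left (by linarith)

theorem tent_of_le {z m s : ℝ} (h : |s - z| ≤ m) : tent z m s = m - |s - z| :=
  max_eq_right (by linarith)

theorem abs_sub_lt_of_tent_pos {z m s : ℝ} (h : 0 < tent z m s) : |s - z| < m := by
  by_contra! h'
  exact h.ne' (tent_eq_zero h')

/-- The lengths of the edges near `x` are bounded below. -/
def LocallyLong (G : SimpleGraph V) (ℓ : V → V → ℝ) [MetricSpace X] (em : V → V → ℝ → X)
    (x : X) (c : ℝ) : Prop :=
  ∀ u v, G.Adj u v → ∀ s ∈ Icc 0 (ℓ u v), dist x (em u v s) < c → c ≤ ℓ u v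

namespace IsCableSystem

variable {G : SimpleGraph V} {ℓ : V → V → ℝ} [MetricSpace X] [MeasurableSpace X]
  {μ : Measure X} {vtx : V → X} {em : V → V → ℝ → X} {a b : V} {c : ℝ}

/-- All but countably many points of an edge have a neighbourhood in the edge that is
isometrically embedded. -/
theorem exists_countable_isometric_window (hcs : IsCableSystem G ℓ μ vtx em)
    (hlong : ∀ x : X, ∃ c > 0, LocallyLong G ℓ em x c) (hab : G.Adj a b) :
    ∃ N : Set ℝ, N.Countable ∧ ∀ σ ∈ Ioo 0 (ℓ a b) \ N, ∃ m > 0,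
      Ioo (σ - m) (σ + m) ⊆ Ioo 0 (ℓ a b) ∧ ∀ s ∈ Ioo (σ - m) (σ + m),
        ∀ t ∈ Ioo (σ - m) (σ + m), |s - t| ≤ dist (em a b s) (em a b t) := by
  choose q₀ q₁ hq using fun n : ℕ => hcs.exists_exceptional_points hab (1 / ((n : ℝ) + 1))
  refine ⟨range q₀ ∪ range q₁, (countable_range q₀).union (countable_range q₁), ?_⟩
  rintro σ ⟨hσ, hσN⟩
  obtain ⟨c, hc, hlc⟩ := hlong (em a b σ)
  obtain ⟨n, hn⟩ := exists_nat_one_div_lt hc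
  set c' := 1 / ((n : ℝ) + 1)
  have hc' : 0 < c' := Nat.one_div_pos_of_nat
  have h0 : 0 < |q₀ n - σ| := abs_sub_pos.2 fun h => hσN (Or.inl ⟨n, h⟩)
  have h1 : 0 < |q₁ n - σ| := abs_sub_pos.2 fun h => hσN (Or.inr ⟨n, h⟩)
  obtain ⟨m, hm, hm'⟩ : ∃ m > 0, 3 * m ≤ |q₀ n - σ| ∧ 3 * m ≤ |q₁ n - σ| ∧ 3 * m ≤ σ ∧
      3 * m ≤ ℓ a b - σ ∧ 3 * m ≤ c' / 2 := by
    refine ⟨min (min |q₀ n - σ| |q₁ n - σ|) (min (min σ (ℓ a b - σ)) (c' / 2)) / 3, ?_, ?_⟩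
    · have := sub_pos.2 hσ.2
      have := hσ.1
      positivity
    · simp only [mul_div_cancel₀ _ (three_ne_zero' ℝ), min_le_iff, le_refl, true_or, or_true,
        and_self]
  obtain ⟨m0, m1, m2, m3, m4⟩ := hm'
  have hsub : Ioo (σ - m) (σ + m) ⊆ Ioo 0 (ℓ a b) := fun s hs =>
    ⟨by linarith [hs.1], by linarith [hs.2]⟩
  refine ⟨m, hm, hsub, fun s hs t ht => ?_⟩
  have hzero : ∀ q, 3 * m ≤ |q - σ| → tent (σ + m) (2 * m) q = 0 := by
    intro q hq
    refine tent_eq_zero ?_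
    have := abs_sub_le q (σ + m) σ
    rw [add_sub_cancel_left, abs_of_pos hm] at this
    linarith
  have hval : ∀ s ∈ Ioo (σ - m) (σ + m), tent (σ + m) (2 * m) s = s - (σ - m) := by
    intro s hs
    have : |s - (σ + m)| = σ + m - s := by
      rw [abs_sub_comm, abs_of_pos (by linarith [hs.2])]
    rw [tent_of_le (by rw [this]; linarith [hs.1]), this]
    ring
  have := hq n (em a b σ) (fun u v ha s hs hd => hn.le.trans (hlc u v ha s hs (hd.trans hn)))
    (tent (σ + m) (2 * m)) (lipschitzWith_tent _ _) (tent_nonneg _ _)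
    (fun s => (tent_le (by linarith) _ _).trans (by linarith)) ?_
    (hzero 0 ?_) (hzero _ ?_) (hzero _ m0) (hzero _ m1) s (Ioo_subset_Icc_self (hsub hs))
    t (Ioo_subset_Icc_self (hsub ht))
  · rwa [hval s hs, hval t ht, sub_sub_sub_cancel_right] at this
  · intro s hs hpos
    have h2 := abs_sub_lt_of_tent_pos hpos
    have h3 := hcs.edge_lip a b hab σ (Ioo_subset_Icc_self hσ) s hs
    have h4 : |σ - s| ≤ |s - (σ + m)| + m := by
      have := abs_sub_le s (σ + m) σ
      rw [add_sub_cancel_left, abs_of_pos hm] at this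
      rwa [abs_sub_comm]
    linarith
  · rw [zero_sub, abs_neg, abs_of_pos hσ.1]
    exact m2
  · rw [abs_of_pos (by linarith)]
    exact m3

/-- A lower bound for the diameter of a portion of an edge. -/
theorem exists_le_dist_edge (hcs : IsCableSystem G ℓ μ vtx em) (hab : G.Adj a b) (hc : 0 < c)
    {x : X} (hlong : LocallyLong G ℓ em x c) {α β : ℝ} (hα : 0 ≤ α) (hαβ : α < β)
    (hβ : β ≤ ℓ a b) (hnear : ∀ s ∈ Icc α β, dist x (em a b s) < c / 4) :
    ∃ s ∈ Icc α β, ∃ t ∈ Icc α β, min ((β - α) / 10) (c / 4) ≤ dist (em a b s) (em a b t) := by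
  obtain ⟨q₀, q₁, hq⟩ := hcs.exists_exceptional_points hab c
  set d := β - α with hd
  have hd0 : 0 < d := sub_pos.2 hαβ
  obtain ⟨z, hz1, hz2, hz3, hz4⟩ : ∃ z, α + d / 4 ≤ z ∧ z ≤ β - d / 4 ∧ d / 10 ≤ |q₀ - z| ∧
      d / 10 ≤ |q₁ - z| := by
    by_contra! h
    have key : ∀ k ∈ Icc (1 : ℝ) 3, |q₀ - (α + k * (d / 4))| < d / 10 ∨
        |q₁ - (α + k * (d / 4))| < d / 10 := by
      intro k hk
      by_contra! h'
      exact (h (α + k * (d / 4)) (by nlinarith [hk.1]) (by nlinarith [hk.2]) h'.1).not_ge h'.2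
    have k1 := key 1 ⟨le_rfl, by norm_num⟩
    have k2 := key 2 ⟨by norm_num, by norm_num⟩
    have k3 := key 3 ⟨by norm_num, le_rfl⟩
    simp only [abs_lt] at k1 k2 k3
    rcases k1 with k1 | k1 <;> rcases k2 with k2 | k2 <;> rcases k3 with k3 | k3 <;> linarith
  set κ := min (d / 10) (c / 4) with hκ
  have hκ0 : 0 < κ := by positivity
  have hκd : κ ≤ d / 10 := min_le_left _ _
  have hκc : κ ≤ c / 4 := min_le_right _ _
  have hzm : z ∈ Icc α β := ⟨by linarith, by linarith⟩
  have hIcc : Icc α β ⊆ Icc 0 (ℓ a b) := Icc_subset_Icc hα hβ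
  refine ⟨z, hzm, α, left_mem_Icc.2 hαβ.le, ?_⟩
  have hout : ∀ s, s ≤ α → tent z κ s = 0 := fun s hs => tent_eq_zero (by
    rw [abs_sub_comm, abs_of_pos] <;> linarith)
  have := hq x hlong (tent z κ) (lipschitzWith_tent _ _) (tent_nonneg _ _)
    (fun s => (tent_le hκ0.le _ _).trans (by linarith)) ?_
    (hout 0 hα) (tent_eq_zero ?_) (tent_eq_zero (hκd.trans hz3)) (tent_eq_zero (hκd.trans hz4))
    z (hIcc hzm) α (hIcc (left_mem_Icc.2 hαβ.le))
  · rw [hout α le_rfl, sub_zero, tent_of_le (by simpa using hκ0.le)] at this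
    simpa [abs_of_pos hκ0] using this
  · intro s hs hpos
    have h2 := abs_sub_lt_of_tent_pos hpos
    have h3 := hcs.edge_lip a b hab z (hIcc hzm) s hs
    have h4 := hnear z hzm
    rw [abs_sub_comm] at h3
    linarith [dist_triangle x (em a b z) (em a b s)]
  · rw [abs_of_pos] <;> linarith

/-- Length functions of homeomorphic cable systems: the length of the edges is locally bounded
below. -/
theorem exists_locallyLong (hcs : IsCableSystem G ℓ μ vtx em) {X₁ : Type*} [MetricSpace X₁]
    [MeasurableSpace X₁] {μ₁ : Measure X₁} {vtx₁ : V → X₁} {em₁ : V → V → ℝ → X₁}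
    (hcs₁ : IsCableSystem G (fun _ _ => 1) μ₁ vtx₁ em₁) {Φ : X → X₁} (hΦc : Continuous Φ)
    (hΦ : ∀ u v, G.Adj u v → ∀ s ∈ Icc 0 (ℓ u v), Φ (em u v s) = em₁ u v (s / ℓ u v)) (x : X) :
    ∃ c > 0, LocallyLong G ℓ em x c := by
  obtain ⟨δ, hδ, hball⟩ := Metric.continuousAt_iff.1 (hΦc.continuousAt (x := x)) (1 / 100)
    (by norm_num)
  refine ⟨δ / 2, by positivity, fun u v ha s hs hd => ?_⟩
  by_contra! hlt
  have hℓ := hcs.len_pos u v ha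
  have hin : ∀ r ∈ Icc (0 : ℝ) 1, dist (Φ x) (em₁ u v r) < 1 / 100 := by
    intro r hr
    have hr' : r * ℓ u v ∈ Icc 0 (ℓ u v) :=
      ⟨mul_nonneg hr.1 hℓ.le, mul_le_of_le_one_left hℓ.le hr.2⟩
    have h1 := hcs.edge_lip u v ha s hs _ hr'
    have h2 : |s - r * ℓ u v| ≤ ℓ u v := by
      rw [abs_le]
      constructor <;> linarith [hs.1, hs.2, hr'.1, hr'.2]
    have h3 : dist (em u v (r * ℓ u v)) x < δ := by
      rw [dist_comm]
      linarith [dist_triangle x (em u v s) (em u v (r * ℓ u v))]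
    have h4 := hball h3
    rwa [hΦ u v ha _ hr', mul_div_cancel_right₀ _ hℓ.ne', dist_comm] at h4
  obtain ⟨r, hr, t, ht, hrt⟩ := hcs₁.exists_le_dist_edge ha one_pos (x := Φ x) (α := 0) (β := 1)
    (fun _ _ _ _ _ _ => le_rfl) le_rfl one_pos le_rfl
    (fun r hr => (hin r hr).trans (by norm_num))
  norm_num at hrt
  have h1 := hin r hr
  have h2 := hin t ht
  linarith [dist_triangle_left (em₁ u v r) (em₁ u v t) (Φ x)]

/-- Length functions of homeomorphic cable systems: the length of the edges is locally bounded
above. -/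
theorem exists_locally_le (hcs : IsCableSystem G ℓ μ vtx em) {X₁ : Type*} [MetricSpace X₁]
    [MeasurableSpace X₁] {μ₁ : Measure X₁} {vtx₁ : V → X₁} {em₁ : V → V → ℝ → X₁}
    (hcs₁ : IsCableSystem G (fun _ _ => 1) μ₁ vtx₁ em₁) (Φ : X ≃ₜ X₁)
    (hΦ : ∀ u v, G.Adj u v → ∀ s ∈ Icc 0 (ℓ u v), Φ (em u v s) = em₁ u v (s / ℓ u v)) (x : X) :
    ∃ ε > 0, ∃ C, ∀ u v, G.Adj u v → ∀ s ∈ Icc 0 (ℓ u v), dist (Φ (em u v s)) (Φ x) < ε →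
      ℓ u v ≤ C := by
  obtain ⟨c, hc, hlong⟩ := hcs.exists_locallyLong hcs₁ Φ.continuous hΦ x
  obtain ⟨ε, hε, hball⟩ := Metric.continuousAt_iff.1
    (Φ.symm.continuous.continuousAt (x := Φ x)) (c / 30) (by positivity)
  simp only [Homeomorph.symm_apply_apply] at hball
  have hnear : ∀ y, dist (Φ y) (Φ x) < ε → dist x y < c / 30 := by
    intro y hy
    have := hball hy
    rwa [Homeomorph.symm_apply_apply, dist_comm] at this
  refine ⟨ε / 2, by positivity, 2 * c / ε, fun u v ha s hs hd => ?_⟩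
  by_contra! hlt
  have hℓ := hcs.len_pos u v ha
  have hcℓ : c ≤ ℓ u v := hlong u v ha s hs
    ((hnear _ (hd.trans (by linarith))).trans (by linarith))
  rw [div_lt_iff₀ hε] at hlt
  obtain ⟨α, hα, hαs, hαc, hβ⟩ : ∃ α, 0 ≤ α ∧ α ≤ s ∧ s ≤ α + c ∧ α + c ≤ ℓ u v := by
    rcases le_total (s + c) (ℓ u v) with h | h
    · exact ⟨s, hs.1, le_rfl, by linarith, h⟩
    · exact ⟨ℓ u v - c, by linarith, by linarith, by linarith [hs.2], by linarith⟩
  have hin : ∀ r ∈ Icc α (α + c), dist x (em u v r) < c / 30 := by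
    intro r hr
    have hr' : r ∈ Icc 0 (ℓ u v) := ⟨hα.trans hr.1, hr.2.trans hβ⟩
    have hdiv : ∀ r ∈ Icc 0 (ℓ u v), r / ℓ u v ∈ Icc (0 : ℝ) 1 := fun r hr =>
      ⟨div_nonneg hr.1 hℓ.le, div_le_one_of_le₀ hr.2 hℓ.le⟩
    have h1 := hcs₁.edge_lip u v ha _ (hdiv r hr') _ (hdiv s hs)
    rw [← hΦ u v ha r hr', ← hΦ u v ha s hs, ← sub_div, abs_div, abs_of_pos hℓ] at h1
    have h2 : |r - s| / ℓ u v < ε / 2 := by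
      rw [div_lt_iff₀ hℓ]
      have : |r - s| ≤ c := by
        rw [abs_le]
        constructor <;> linarith [hr.1, hr.2]
      linarith
    exact hnear _ (by linarith [dist_triangle (Φ (em u v r)) (Φ (em u v s)) (Φ x)])
  obtain ⟨r, hr, t, ht, hrt⟩ := hcs.exists_le_dist_edge ha hc hlong hα (by linarith) hβ
    (fun r hr => (hin r hr).trans (by linarith))
  rw [add_sub_cancel_left, min_eq_left (by linarith)] at hrt
  have h1 := hin r hr
  have h2 := hin t ht
  linarith [dist_triangle_left (em u v r) (em u v t) x]

end IsCableSystem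

/-! ### Change of parameter -/

theorem edist_le_hausdorffMeasure_image [MetricSpace X] [MeasurableSpace X] [BorelSpace X]
    {γ : ℝ → X} {a b : ℝ} (hab : a ≤ b) (hγ : ContinuousOn γ (Icc a b)) :
    edist (γ a) (γ b) ≤ μH[1] (γ '' Icc a b) := by
  have hLip : LipschitzWith 1 fun x => dist (γ a) x := LipschitzWith.dist_right _
  have hsub : Icc 0 (dist (γ a) (γ b)) ⊆ (fun x => dist (γ a) x) '' (γ '' Icc a b) := by
    have := intermediate_value_Icc hab (hLip.continuous.comp_continuousOn hγ)
    rw [image_image]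
    simpa using this
  have := (hLip.lipschitzOnWith (s := γ '' Icc a b)).hausdorffMeasure_image_le
    (d := 1) zero_le_one
  rw [hausdorffMeasure_real] at this
  calc edist (γ a) (γ b) = volume (Icc 0 (dist (γ a) (γ b))) := by
        rw [Real.volume_Icc, sub_zero, edist_dist]
    _ ≤ _ := measure_mono hsub
    _ ≤ _ := by simpa using this

/-- If the speed of a curve `g` is bounded by `w`, then `g` has a `1`-Lipschitz reparametrisation
along which line integrals are bounded by the integrals along `g` weighted with `w`. -/
theorem exists_lipschitz_reparam [MetricSpace X] [MeasurableSpace X] [BorelSpace X] {g : ℝ → X}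
    (hg : Continuous g) {w : ℝ → ℝ≥0∞} (hw : Measurable w) {L : ℝ} (hL : 0 ≤ L)
    (hfin : ∫⁻ t in Icc 0 L, w t ≠ ⊤)
    (hspeed : ∀ a b, 0 ≤ a → a ≤ b → b ≤ L → edist (g a) (g b) ≤ ∫⁻ t in Icc a b, w t) :
    ∃ (H : ℝ) (h : ℝ → ℝ) (γ : ℝ → X), 0 ≤ H ∧ MonotoneOn h (Icc 0 L) ∧
      h '' Icc 0 L = Icc 0 H ∧ LipschitzOnWith 1 γ (Icc 0 H) ∧ (∀ t ∈ Icc 0 L, γ (h t) = g t) ∧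
      ∀ ρ : X → ℝ≥0∞, Measurable ρ →
        ∫⁻ t in Icc 0 H, ρ (γ t) ≤ ∫⁻ t in Icc 0 L, w t * ρ (g t) := by
  set ν := (volume.restrict (Icc 0 L)).withDensity w with hν
  have hνfin : IsFiniteMeasure ν := isFiniteMeasure_withDensity hfin
  have hνapp : ∀ a b, 0 ≤ a → b ≤ L → ν (Icc a b) = ∫⁻ t in Icc a b, w t := by
    intro a b ha hb
    rw [hν, withDensity_apply _ measurableSet_Icc, Measure.restrict_restrict measurableSet_Icc,
      inter_eq_left.2 (Icc_subset_Icc ha hb)]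
  have hνac : ν ≪ volume := (withDensity_absolutelyContinuous _ _).trans
    Measure.restrict_le_self.absolutelyContinuous
  have hνatom : ∀ x, ν {x} = 0 := fun x => hνac Real.volume_singleton
  set h : ℝ → ℝ := fun t => ν.real (Icc 0 t) with hh
  have hadd : ∀ a b, 0 ≤ a → a ≤ b → h b = h a + ν.real (Icc a b) := by
    intro a b ha hab
    have h1 : ν.real (Icc a b) = ν.real (Ioc a b) := by
      rw [measureReal_def, measureReal_def, ← Icc_union_Ioc_eq_Icc le_rfl hab, Icc_self]
      congr 1
      refine le_antisymm ((measure_union_le _ _).trans ?_) (measure_mono subset_union_right)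
      rw [hνatom, zero_add]
    rw [hh]
    dsimp only
    rw [h1, ← measureReal_union _ measurableSet_Ioc, Icc_union_Ioc_eq_Icc ha hab]
    exact disjoint_left.2 fun x hx hx' => hx'.1.not_ge hx.2
  have hmono : Monotone h := fun a b hab => measureReal_mono (Icc_subset_Icc le_rfl hab)
  have h00 : h 0 = 0 := by
    rw [hh]
    dsimp only
    rw [Icc_self, measureReal_def, hνatom, ENNReal.toReal_zero]
  have hcont : ContinuousOn h (Icc 0 L) := by
    have : NullSingletonClass ν := ⟨fun x => hνatom x⟩
    have := intervalIntegral.continuousOn_primitive_Icc (μ := ν) (f := fun _ => (1 : ℝ)) (a := 0) (b := L)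
      (integrable_const _).integrableOn
    simpa using this
  set H := h L with hH
  have himg : h '' Icc 0 L = Icc 0 H := by
    refine subset_antisymm ?_ ?_
    · rintro _ ⟨t, ht, rfl⟩
      exact ⟨measureReal_nonneg, hmono ht.2⟩
    · have := intermediate_value_Icc hL hcont
      rwa [h00] at this
  have hdist : ∀ a ∈ Icc 0 L, ∀ b ∈ Icc 0 L, dist (g a) (g b) ≤ |h a - h b| := by
    intro a ha b hb
    wlog hab : a ≤ b generalizing a b
    · rw [dist_comm, abs_sub_comm]
      exact this b hb a ha (le_of_not_ge hab)
    rw [hadd a b ha.1 hab, sub_add_cancel_left, abs_neg, abs_of_nonneg measureReal_nonneg,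
      dist_edist, measureReal_def, hνapp a b ha.1 hb.2]
    refine ENNReal.toReal_mono ?_ (hspeed a b ha.1 hab hb.2)
    rw [← hνapp a b ha.1 hb.2]
    exact measure_ne_top _ _
  have hinv : ∀ τ, ∃ t, τ ∈ Icc 0 H → t ∈ Icc 0 L ∧ h t = τ := by
    intro τ
    by_cases hτ : τ ∈ Icc 0 H
    · obtain ⟨t, ht, hht⟩ := himg.symm ▸ hτ
      exact ⟨t, fun _ => ⟨ht, hht⟩⟩
    · exact ⟨0, fun hτ' => (hτ hτ').elim⟩
  choose k hk using hinv
  have hγ : ∀ t ∈ Icc 0 L, g (k (h t)) = g t := by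
    intro t ht
    obtain ⟨h1, h2⟩ := hk (h t) (himg ▸ mem_image_of_mem h ht)
    have := hdist _ h1 t ht
    rwa [h2, sub_self, abs_zero, dist_le_zero] at this
  refine ⟨H, h, fun τ => g (k τ), measureReal_nonneg, hmono.monotoneOn _, himg,
    LipschitzOnWith.of_dist_le_mul fun s hs t ht => ?_, hγ, fun ρ hρ => ?_⟩
  · obtain ⟨h1, h2⟩ := hk s hs
    obtain ⟨h3, h4⟩ := hk t ht
    have := hdist _ h1 _ h3
    rwa [h2, h4, ← Real.dist_eq, ← one_mul (dist s t)] at this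
  have hae : ∀ᵐ t ∂ν, t ∈ Icc 0 L :=
    (withDensity_absolutelyContinuous _ _).ae_le (ae_restrict_mem measurableSet_Icc)
  have hmap : ν.map h = volume.restrict (Icc 0 H) := by
    have : IsFiniteMeasure (ν.map h) := Measure.isFiniteMeasure_map _ _
    refine Measure.ext_of_Iic _ _ fun a => ?_
    have hnull : ν (Icc 0 L)ᶜ = 0 := hae
    have hrest : ∀ s, ν s = ν (s ∩ Icc 0 L) := fun s =>
      (measure_inter_conull hnull).symm
    rw [Measure.map_apply hmono.measurable measurableSet_Iic,
      Measure.restrict_apply measurableSet_Iic, hrest]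
    rcases lt_or_ge a 0 with ha | ha
    · have e1 : h ⁻¹' Iic a ∩ Icc 0 L = ∅ := eq_empty_of_forall_notMem fun t ht =>
        (measureReal_nonneg.trans ht.1).not_gt ha
      have e2 : Iic a ∩ Icc 0 H = ∅ := eq_empty_of_forall_notMem fun t ht =>
        (ht.2.1.trans ht.1).not_gt ha
      rw [e1, e2, measure_empty, measure_empty]
    have hcomp : IsCompact (h ⁻¹' Iic a ∩ Icc 0 L) := by
      rw [inter_comm]
      exact isCompact_Icc.of_isClosed_subset
        (hcont.preimage_isClosed_of_isClosed isClosed_Icc isClosed_Iic) inter_subset_left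
    obtain ⟨t₁, ht₁, hmax⟩ := hcomp.exists_isGreatest ⟨0, by simpa [h00] using ha, le_rfl, hL⟩
    have e1 : h ⁻¹' Iic a ∩ Icc 0 L = Icc 0 t₁ := by
      refine subset_antisymm (fun t ht => ⟨ht.2.1, hmax ht⟩) fun t ht =>
        ⟨(hmono ht.2).trans ht₁.1, ht.1, ht.2.trans ht₁.2.2⟩
    have e2 : Iic a ∩ Icc 0 H = Icc 0 (h t₁) := by
      refine subset_antisymm (fun τ hτ => ⟨hτ.2.1, ?_⟩) fun τ hτ =>
        ⟨hτ.2.trans ht₁.1, hτ.1, hτ.2.trans (hmono ht₁.2.2)⟩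
      obtain ⟨m1, m2⟩ := hk τ hτ.2
      rw [← m2]
      exact hmono (hmax ⟨m2.le.trans hτ.1, m1⟩)
    rw [e1, e2, Real.volume_Icc, sub_zero, ofReal_measureReal]
  rw [← hmap]
  refine (lintegral_map_le _ _).trans (le_of_eq ?_)
  calc ∫⁻ t, ρ (g (k (h t))) ∂ν = ∫⁻ t, ρ (g t) ∂ν :=
        lintegral_congr_ae (hae.mono fun t ht => by simp only [hγ t ht])
    _ = ∫⁻ t in Icc 0 L, w t * ρ (g t) :=
        lintegral_withDensity_eq_lintegral_mul _ hw (hρ.comp hg.measurable)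

/-! ### Conformal invariance of the modulus -/

namespace IsCableSystem

variable {G : SimpleGraph V} {ℓ : V → V → ℝ} [MetricSpace X] [MeasurableSpace X]
  {μ : Measure X} {vtx : V → X} {em : V → V → ℝ → X}

/-- Up to a countable set, a cable system is covered by countably many isometrically embedded
open intervals. -/
theorem exists_countable_window_cover [Countable V] (hcs : IsCableSystem G ℓ μ vtx em)
    (hlong : ∀ x : X, ∃ c > 0, LocallyLong G ℓ em x c) :
    ∃ P : Set X, P.Countable ∧ ∀ x ∉ P, ∃ u v, ∃ q r : ℚ, G.Adj u v ∧
      Ioo (q : ℝ) r ⊆ Ioo 0 (ℓ u v) ∧ (∀ s ∈ Ioo (q : ℝ) r, ∀ t ∈ Ioo (q : ℝ) r,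
        |s - t| ≤ dist (em u v s) (em u v t)) ∧ x ∈ em u v '' Ioo (q : ℝ) r := by
  choose N hNc hN using fun e : {e : V × V // G.Adj e.1 e.2} =>
    hcs.exists_countable_isometric_window hlong e.2
  refine ⟨range vtx ∪ ⋃ e : {e : V × V // G.Adj e.1 e.2}, em e.1.1 e.1.2 '' N e,
    (countable_range _).union (countable_iUnion fun e => (hNc e).image _), fun x hx => ?_⟩
  simp only [mem_union, mem_iUnion, not_or, not_exists] at hx
  obtain ⟨u, v, s, ha, hs, rfl⟩ := hcs.cover x
  have h0 : 0 ≠ s := by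
    rintro rfl
    exact hx.1 ⟨u, (hcs.edge_start u v ha).symm⟩
  have h1 : s ≠ ℓ u v := by
    rintro rfl
    exact hx.1 ⟨v, (hcs.edge_end ha).symm⟩
  obtain ⟨m, hm, hsub, hiso⟩ := hN ⟨(u, v), ha⟩ s
    ⟨⟨hs.1.lt_of_ne h0, hs.2.lt_of_ne h1⟩, fun h => hx.2 ⟨(u, v), ha⟩ (mem_image_of_mem _ h)⟩
  obtain ⟨q, hq1, hq2⟩ := exists_rat_btwn (sub_lt_self s hm)
  obtain ⟨r, hr1, hr2⟩ := exists_rat_btwn (lt_add_of_pos_right s hm)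
  have hI : Ioo (q : ℝ) r ⊆ Ioo (s - m) (s + m) := Ioo_subset_Ioo hq1.le hr2.le
  exact ⟨u, v, q, r, ha, hI.trans hsub, fun t ht t' ht' => hiso t (hI ht) t' (hI ht'),
    mem_image_of_mem _ ⟨hq2, hr1⟩⟩

/-- The ratio of two length functions on the open edges, extended by zero. -/
def edgeRatio (G : SimpleGraph V) (ℓ' : V → V → ℝ) (em' : V → V → ℝ → X) (ℓ : V → V → ℝ) (x : X) :
    ℝ≥0∞ :=
  ⨆ e : {e : V × V // G.Adj e.1 e.2}, (em' e.1.1 e.1.2 '' Ioo 0 (ℓ' e.1.1 e.1.2)).indicator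
    (fun _ => ENNReal.ofReal (ℓ e.1.1 e.1.2 / ℓ' e.1.1 e.1.2)) x

theorem edgeRatio_eq_zero {Y : Type*} {ℓ' : V → V → ℝ} {em' : V → V → ℝ → Y} {x : Y}
    (hx : ∀ u v, G.Adj u v → x ∉ em' u v '' Ioo 0 (ℓ' u v)) : edgeRatio G ℓ' em' ℓ x = 0 := by
  refine le_antisymm (iSup_le fun e => ?_) zero_le
  rw [indicator_of_notMem (hx _ _ e.2)]

variable {ℓ' : V → V → ℝ} {X' : Type*} [MetricSpace X'] [MeasurableSpace X']
  {μ' : Measure X'} {vtx' : V → X'} {em' : V → V → ℝ → X'}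

theorem measurable_edgeRatio [Countable V] (hcs' : IsCableSystem G ℓ' μ' vtx' em') :
    Measurable (edgeRatio G ℓ' em' ℓ) :=
  Measurable.iSup fun e => measurable_const.indicator
    (hcs'.measurableSet_edge_image e.2 measurableSet_Ioo Ioo_subset_Icc_self)

theorem edgeRatio_edge (hcs' : IsCableSystem G ℓ' μ' vtx' em') (hsymm : ∀ u v, ℓ u v = ℓ v u)
    {u v : V} (ha : G.Adj u v) {s : ℝ} (hs : s ∈ Ioo 0 (ℓ' u v)) :
    edgeRatio G ℓ' em' ℓ (em' u v s) = ENNReal.ofReal (ℓ u v / ℓ' u v) := by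
  refine le_antisymm (iSup_le ?_) (le_iSup_of_le ⟨(u, v), ha⟩ ?_)
  · rintro ⟨⟨u', v'⟩, ha'⟩
    by_cases h : em' u v s ∈ em' u' v' '' Ioo 0 (ℓ' u' v')
    · rw [indicator_of_mem h]
      obtain ⟨s', hs', he⟩ := h
      rcases hcs'.interior_disjoint u v u' v' ha ha' s hs s' hs' he.symm with
        ⟨rfl, rfl, -⟩ | ⟨rfl, rfl, -⟩
      · exact le_rfl
      · rw [hsymm, hcs'.len_symm]
    · rw [indicator_of_notMem h]
      exact zero_le
  · rw [indicator_of_mem (mem_image_of_mem _ hs)]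

theorem exists_edgeRatio_le (hcs' : IsCableSystem G ℓ' μ' vtx' em')
    (hsymm : ∀ u v, ℓ u v = ℓ v u)
    (hbd : ∀ x, ∃ ε > 0, ∃ C, ∀ u v, G.Adj u v → ∀ s ∈ Icc 0 (ℓ' u v),
      dist (em' u v s) x < ε → ℓ u v / ℓ' u v ≤ C) {K : Set X'} (hK : IsCompact K) :
    ∃ C : ℝ≥0, ∀ x ∈ K, edgeRatio G ℓ' em' ℓ x ≤ C := by
  refine hK.induction_on (p := fun K => ∃ C : ℝ≥0, ∀ x ∈ K, edgeRatio G ℓ' em' ℓ x ≤ C)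
    ⟨0, by simp⟩ ?_ ?_ ?_
  · rintro s t hst ⟨C, hC⟩
    exact ⟨C, fun x hx => hC x (hst hx)⟩
  · rintro s t ⟨C, hC⟩ ⟨D, hD⟩
    refine ⟨max C D, fun x hx => hx.elim (fun h => (hC x h).trans ?_) fun h => (hD x h).trans ?_⟩
    · exact_mod_cast le_max_left C D
    · exact_mod_cast le_max_right C D
  · intro x _
    obtain ⟨ε, hε, C, hC⟩ := hbd x
    refine ⟨ball x ε, mem_nhdsWithin_of_mem_nhds (ball_mem_nhds x hε), C.toNNReal, fun y hy => ?_⟩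
    by_cases h : ∃ u v s, G.Adj u v ∧ s ∈ Ioo 0 (ℓ' u v) ∧ em' u v s = y
    · obtain ⟨u, v, s, ha, hs, rfl⟩ := h
      rw [hcs'.edgeRatio_edge hsymm ha hs]
      exact ENNReal.ofReal_le_ofReal (hC u v ha s (Ioo_subset_Icc_self hs) hy)
    · rw [edgeRatio_eq_zero]
      · exact zero_le
      · rintro u v ha ⟨s, hs, rfl⟩
        exact h ⟨u, v, s, ha, hs, rfl⟩

/-- The speed of a curve is multiplied by at most the ratio of the length functions. -/
theorem edist_le_lintegral_edgeRatio [Countable V] (hcs : IsCableSystem G ℓ μ vtx em)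
    (hcs' : IsCableSystem G ℓ' μ' vtx' em') (Ψ : X' ≃ₜ X)
    (hΨ : ∀ u v, G.Adj u v → ∀ s ∈ Icc 0 (ℓ' u v),
      Ψ (em' u v s) = em u v (s * (ℓ u v / ℓ' u v)))
    (hlong : ∀ x : X', ∃ c > 0, LocallyLong G ℓ' em' x c) {g : ℝ → X'} {a b : ℝ} (hab : a ≤ b)
    (hg : Continuous g) (hgL : LipschitzOnWith 1 g (Icc a b)) :
    edist (Ψ (g a)) (Ψ (g b)) ≤ ∫⁻ t in Icc a b, edgeRatio G ℓ' em' ℓ (g t) := by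
  have := hcs.isBorel
  have := hcs'.isBorel
  set w := edgeRatio G ℓ' em' ℓ with hw
  have hwm : Measurable w := hcs'.measurable_edgeRatio
  set K : Set X' := g '' Icc a b with hK
  have hKm : MeasurableSet K := (isCompact_Icc.image hg).measurableSet
  set ν₁ : Measure X' := (μH[1].map Ψ.symm).restrict K with hν₁
  set ν₂ : Measure X' := ((volume.restrict (Icc a b)).withDensity (w ∘ g)).map g with hν₂
  have happ₁ : ∀ B, MeasurableSet B → ν₁ B = μH[1] (Ψ '' (B ∩ K)) := by
    intro B hB
    rw [hν₁, Measure.restrict_apply hB,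
      Measure.map_apply Ψ.symm.continuous.measurable (hB.inter hKm), Ψ.image_eq_preimage_symm]
  have happ₂ : ∀ B, MeasurableSet B → ν₂ B = ∫⁻ t in g ⁻¹' B ∩ Icc a b, w (g t) := by
    intro B hB
    rw [hν₂, Measure.map_apply hg.measurable hB, withDensity_apply _ (hg.measurable hB),
      Measure.restrict_restrict (hg.measurable hB)]
    rfl
  obtain ⟨P, hPc, hP⟩ := hcs'.exists_countable_window_cover hlong
  have hle : ν₁ univ ≤ ν₂ univ := by
    set I := {i : (V × V) × ℚ × ℚ // G.Adj i.1.1 i.1.2 ∧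
      Ioo (i.2.1 : ℝ) i.2.2 ⊆ Ioo 0 (ℓ' i.1.1 i.1.2) ∧
      (∀ s ∈ Ioo (i.2.1 : ℝ) i.2.2, ∀ t ∈ Ioo (i.2.1 : ℝ) i.2.2,
        |s - t| ≤ dist (em' i.1.1 i.1.2 s) (em' i.1.1 i.1.2 t))}
    refine measure_le_of_countable_cover ν₁ ν₂
      (fun i : Option I => i.elim P fun i => em' i.1.1.1 i.1.1.2 '' Ioo (i.1.2.1 : ℝ) i.1.2.2)
      ?_ ?_ MeasurableSet.univ ?_
    · rintro (_ | ⟨⟨⟨u, v⟩, q, r⟩, ha, hsub, hiso⟩)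
      · exact hPc.measurableSet
      · exact hcs'.measurableSet_edge_image ha measurableSet_Ioo (hsub.trans Ioo_subset_Icc_self)
    · rintro (_ | ⟨⟨⟨u, v⟩, q, r⟩, ha, hsub, hiso⟩) B hB hBs
      · have : (Ψ '' (B ∩ K)).Countable := (hPc.mono (inter_subset_left.trans hBs)).image _
        have h0 : μH[1] (Ψ '' (B ∩ K)) = 0 := by
          have := Measure.nullSingletonClass_hausdorff X (d := 1) one_pos
          exact Countable.measure_zero ‹_› _
        rw [happ₁ B hB, h0]
        exact zero_le
      · simp only [Option.elim] at ha hsub hiso hBs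
        set lam := ℓ u v / ℓ' u v with hlam
        have hℓ := hcs.len_pos u v ha
        have hℓ' := hcs'.len_pos u v ha
        have hlam0 : 0 < lam := div_pos hℓ hℓ'
        set T := g ⁻¹' B ∩ Icc a b with hT
        have hTm : MeasurableSet T := (hg.measurable hB).inter measurableSet_Icc
        have himg : Ψ '' (B ∩ K) ⊆ (fun t => Ψ (g t)) '' T := by
          rintro _ ⟨_, ⟨hx, t, ht, rfl⟩, rfl⟩
          exact ⟨t, ⟨hx, ht⟩, rfl⟩
        have hmul : ∀ σ ∈ Ioo (q : ℝ) r, σ * lam ∈ Icc 0 (ℓ u v) := by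
          intro σ hσ
          have := hsub hσ
          refine ⟨mul_nonneg this.1.le hlam0.le, ?_⟩
          calc σ * lam ≤ ℓ' u v * lam := by gcongr; exact this.2.le
            _ = ℓ u v := by rw [hlam]; field_simp
        have hLip : LipschitzOnWith lam.toNNReal (fun t => Ψ (g t)) T := by
          refine LipschitzOnWith.of_dist_le_mul fun s hs t ht => ?_
          rw [Real.coe_toNNReal _ hlam0.le]
          obtain ⟨σ, hσ, hσs⟩ := hBs hs.1
          obtain ⟨τ, hτ, hτt⟩ := hBs ht.1
          have h1 := hgL.dist_le_mul s hs.2 t ht.2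
          rw [NNReal.coe_one, one_mul, ← hσs, ← hτt] at h1
          rw [← hσs, ← hτt, hΨ u v ha σ (Ioo_subset_Icc_self (hsub hσ)),
            hΨ u v ha τ (Ioo_subset_Icc_self (hsub hτ))]
          calc _ ≤ |σ * lam - τ * lam| :=
                hcs.edge_lip u v ha _ (hmul σ hσ) _ (hmul τ hτ)
            _ = lam * |σ - τ| := by rw [← sub_mul, abs_mul, abs_of_pos hlam0, mul_comm]
            _ ≤ lam * dist s t := by gcongr; exact (hiso σ hσ τ hτ).trans h1
        have h2 := hLip.hausdorffMeasure_image_le (d := 1) zero_le_one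
        rw [hausdorffMeasure_real, ENNReal.rpow_one] at h2
        have h3 : ∫⁻ t in T, w (g t) = ENNReal.ofReal lam * volume T := by
          rw [← setLIntegral_const]
          refine setLIntegral_congr_fun hTm fun t ht => ?_
          obtain ⟨σ, hσ, hσt⟩ := hBs ht.1
          rw [← hσt]
          exact hcs'.edgeRatio_edge hcs.len_symm ha (hsub hσ)
        rw [happ₁ B hB, happ₂ B hB, h3]
        exact (measure_mono himg).trans h2
    · intro x _
      rw [mem_iUnion]
      by_cases hx : x ∈ P
      · exact ⟨none, hx⟩
      · obtain ⟨u, v, q, r, ha, hsub, hiso, hx⟩ := hP x hx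
        exact ⟨some ⟨((u, v), q, r), ha, hsub, hiso⟩, hx⟩
  have h1 := edist_le_hausdorffMeasure_image hab (Ψ.continuous.comp hg).continuousOn
  rw [happ₁ _ MeasurableSet.univ, happ₂ _ MeasurableSet.univ, univ_inter, preimage_univ,
    univ_inter, hK, ← image_comp] at hle
  exact h1.trans hle

theorem lintegral_edgeRatio_sq_le [Countable V] (hcs : IsCableSystem G ℓ μ vtx em)
    (hcs' : IsCableSystem G ℓ' μ' vtx' em') (Ψ : X' ≃ₜ X)
    (hΨ : ∀ u v, G.Adj u v → ∀ s ∈ Icc 0 (ℓ' u v),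
      Ψ (em' u v s) = em u v (s * (ℓ u v / ℓ' u v))) {ρ : X → ℝ≥0∞} (hρ : Measurable ρ) :
    ∫⁻ x, (edgeRatio G ℓ' em' ℓ x * ρ (Ψ x)) ^ 2 ∂μ' ≤ ∫⁻ x, ρ x ^ 2 ∂μ := by
  have := hcs.isBorel
  have := hcs'.isBorel
  set w := edgeRatio G ℓ' em' ℓ with hw
  have hwm : Measurable w := hcs'.measurable_edgeRatio
  have hle : μ'.withDensity (fun x => w x ^ 2) ≤ μ.map Ψ.symm := by
    refine Measure.le_iff.2 fun B hB => ?_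
    set U : Set X' := ⋃ e : {e : V × V // G.Adj e.1 e.2},
      em' e.1.1 e.1.2 '' Ioo 0 (ℓ' e.1.1 e.1.2) with hU
    have hUm : ∀ e : {e : V × V // G.Adj e.1 e.2},
        MeasurableSet (em' e.1.1 e.1.2 '' Ioo 0 (ℓ' e.1.1 e.1.2)) := fun e =>
      hcs'.measurableSet_edge_image e.2 measurableSet_Ioo Ioo_subset_Icc_self
    refine measure_le_of_countable_cover _ _ (fun i : Option {e : V × V // G.Adj e.1 e.2} =>
      i.elim Uᶜ fun e => em' e.1.1 e.1.2 '' Ioo 0 (ℓ' e.1.1 e.1.2)) ?_ ?_ hB ?_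
    · rintro (_ | e)
      · exact (MeasurableSet.iUnion hUm).compl
      · exact hUm e
    · rintro (_ | ⟨⟨u, v⟩, ha⟩) B hB hBs
      · rw [withDensity_apply _ hB, setLIntegral_congr_fun hB (g := fun _ => 0)]
        · simp
        · intro x hx
          have : w x = 0 := edgeRatio_eq_zero fun u v ha hxe =>
            hBs hx (mem_iUnion.2 ⟨⟨(u, v), ha⟩, hxe⟩)
          simp [this]
      · simp only [Option.elim] at ha hBs
        have hℓ := hcs.len_pos u v ha
        have hℓ' := hcs'.len_pos u v ha
        set lam := ℓ u v / ℓ' u v with hlam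
        have hlam0 : 0 < lam := div_pos hℓ hℓ'
        set A := Ioo 0 (ℓ' u v) ∩ em' u v ⁻¹' B with hA
        have hAm : MeasurableSet A :=
          hcs'.measurableSet_edge_preimage ha hB measurableSet_Ioo Ioo_subset_Icc_self
        have hBA : B = em' u v '' A := by rw [hA, image_inter_preimage, inter_eq_right.2 hBs]
        have hAs : A ⊆ Icc 0 (ℓ' u v) := inter_subset_left.trans Ioo_subset_Icc_self
        have hΨB : Ψ.symm ⁻¹' B = em u v '' ((fun s => s * lam) '' A) := by
          rw [← Ψ.image_eq_preimage_symm, hBA, ← image_comp, ← image_comp]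
          exact image_congr fun s hs => hΨ u v ha s (hAs hs)
        have hAl : MeasurableSet ((fun s => s * lam) '' A) :=
          (Homeomorph.mulRight₀ lam hlam0.ne').measurableEmbedding.measurableSet_image.2 hAm
        have hvol : volume ((fun s => s * lam) '' A) = ENNReal.ofReal lam * volume A := by
          have : (fun s => s * lam) '' A = (fun s => s * lam⁻¹) ⁻¹' A :=
            (Homeomorph.mulRight₀ lam hlam0.ne').image_eq_preimage_symm A
          rw [this, Real.volume_preimage_mul_right (inv_ne_zero hlam0.ne'), inv_inv,
            abs_of_pos hlam0]
        have hAls : (fun s => s * lam) '' A ⊆ Icc 0 (ℓ u v) := by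
          rintro _ ⟨s, hs, rfl⟩
          refine ⟨mul_nonneg (hAs hs).1 hlam0.le, ?_⟩
          calc s * lam ≤ ℓ' u v * lam := by gcongr; exact (hAs hs).2
            _ = ℓ u v := by rw [hlam]; field_simp
        have hint : ∫⁻ x in B, w x ^ 2 ∂μ' = ENNReal.ofReal lam ^ 2 * μ' B := by
          rw [← setLIntegral_const]
          refine setLIntegral_congr_fun hB fun x hx => ?_
          obtain ⟨s, hs, rfl⟩ := hBs hx
          rw [hw, hcs'.edgeRatio_edge hcs.len_symm ha hs]
        rw [withDensity_apply _ hB, hint, Measure.map_apply Ψ.symm.continuous.measurable hB, hΨB,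
          hcs.measure_edge u v ha _ hAl hAls, hvol, hBA, hcs'.measure_edge u v ha A hAm hAs,
          ← mul_assoc, ← mul_assoc, ← ENNReal.ofReal_pow hlam0.le,
          ← ENNReal.ofReal_mul (by positivity),
          ← ENNReal.ofReal_mul hℓ.le]
        refine le_of_eq ?_
        congr 2
        rw [hlam]
        field_simp
    · intro x _
      rw [mem_iUnion]
      by_cases hx : x ∈ U
      · obtain ⟨e, he⟩ := mem_iUnion.1 hx
        exact ⟨some e, he⟩
      · exact ⟨none, hx⟩
  have hm : Measurable fun x => ρ (Ψ x) ^ 2 := (hρ.comp Ψ.continuous.measurable).pow_const 2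
  calc ∫⁻ x, (w x * ρ (Ψ x)) ^ 2 ∂μ' = ∫⁻ x, ρ (Ψ x) ^ 2 ∂μ'.withDensity (fun x => w x ^ 2) := by
        rw [lintegral_withDensity_eq_lintegral_mul _ (hwm.pow_const 2) hm]
        simp only [Pi.mul_apply, mul_pow]
    _ ≤ ∫⁻ x, ρ (Ψ x) ^ 2 ∂μ.map Ψ.symm := lintegral_mono' hle le_rfl
    _ = ∫⁻ x, ρ x ^ 2 ∂μ := by
        rw [lintegral_map hm Ψ.symm.continuous.measurable]
        simp

/-- One half of the conformal invariance of the modulus on cable systems. -/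
theorem modulus_le_of_homeomorph [Countable V] (hcs : IsCableSystem G ℓ μ vtx em)
    (hcs' : IsCableSystem G ℓ' μ' vtx' em') (Ψ : X' ≃ₜ X)
    (hΨ : ∀ u v, G.Adj u v → ∀ s ∈ Icc 0 (ℓ' u v),
      Ψ (em' u v s) = em u v (s * (ℓ u v / ℓ' u v)))
    (hlong : ∀ x : X', ∃ c > 0, LocallyLong G ℓ' em' x c)
    (hbd : ∀ x, ∃ ε > 0, ∃ C, ∀ u v, G.Adj u v → ∀ s ∈ Icc 0 (ℓ' u v),
      dist (em' u v s) x < ε → ℓ u v / ℓ' u v ≤ C) (E F : Set X') :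
    modulus μ' (JoiningCurves E F) ≤ modulus μ (JoiningCurves (Ψ '' E) (Ψ '' F)) := by
  have := hcs.isBorel
  have := hcs'.isBorel
  have hwm : Measurable (edgeRatio G ℓ' em' ℓ) := hcs'.measurable_edgeRatio
  refine le_iInf₂ fun ρ hρ => iInf₂_le_of_le (fun x => edgeRatio G ℓ' em' ℓ x * ρ (Ψ x))
    ⟨hwm.mul (hρ.1.comp Ψ.continuous.measurable), ?_⟩
    (hcs.lintegral_edgeRatio_sq_le hcs' Ψ hΨ hρ.1)
  rintro c ⟨hc, hcc, hcE, hcF⟩ g₀ L ⟨hL, hg₀, φ, hφm, hφi, hφ⟩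
  set g : ℝ → X' := fun t => g₀ (projIcc 0 L hL t) with hg
  have hgg : ∀ t ∈ Icc 0 L, g t = g₀ t := fun t ht => by rw [hg]; simp [projIcc_of_mem hL ht]
  have hgc : Continuous g := (hg₀.continuousOn.domRestrict).comp continuous_projIcc
  have hgL : LipschitzOnWith 1 g (Icc 0 L) := fun s hs t ht => by
    rw [hgg s hs, hgg t ht]
    exact hg₀ hs ht
  obtain ⟨C, hC⟩ := hcs'.exists_edgeRatio_le hcs.len_symm hbd
    ((isCompact_Icc (a := 0) (b := L)).image hgc)
  have hfin : ∫⁻ t in Icc 0 L, edgeRatio G ℓ' em' ℓ (g t) ≠ ⊤ := by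
    refine ((setLIntegral_mono measurable_const fun t ht =>
      hC _ (mem_image_of_mem g ht)).trans_lt ?_).ne
    rw [setLIntegral_const, Real.volume_Icc]
    exact ENNReal.mul_lt_top ENNReal.coe_lt_top ENNReal.ofReal_lt_top
  obtain ⟨H, h, γ, hH, hm, hi, hγ, hγg, hint⟩ := exists_lipschitz_reparam
    (Ψ.continuous.comp hgc) (hwm.comp hgc.measurable) hL hfin fun a b ha hab hb =>
      hcs.edist_le_lintegral_edgeRatio hcs' Ψ hΨ hlong hab hgc
        (hgL.mono (Icc_subset_Icc ha hb))
  have hφmem : ∀ t ∈ Icc c.1 c.2.1, φ t ∈ Icc 0 L := fun t ht => hφi ▸ mem_image_of_mem φ ht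
  calc 1 ≤ ∫⁻ t in Icc 0 H, ρ (γ t) := by
        refine hρ.2 (c.1, c.2.1, fun t => Ψ (c.2.2 t)) ⟨hc, Ψ.continuous.comp_continuousOn hcc,
          mem_image_of_mem _ hcE, mem_image_of_mem _ hcF⟩ γ H ⟨hH, hγ, h ∘ φ,
            hm.comp hφm hφmem, ?_, fun t ht => ?_⟩
        · rw [image_comp, hφi, hi]
        · dsimp only [Function.comp]
          rw [hγg _ (hφmem t ht), Function.comp, hgg _ (hφmem t ht), hφ t ht]
    _ ≤ _ := hint ρ hρ.1
    _ = _ := setLIntegral_congr_fun measurableSet_Icc fun t ht => by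
        dsimp only [Function.comp]
        rw [hgg t ht]

end IsCableSystem

/-- **Lemma (modulus lower bound by the combinatorial distance).**  Let `(X, d_ℓ, μ)` be
the cable system of a good straight-line embedding of a planar graph with carrier `ℝ²`,
and let `(X₁, d₁, μ₁)` be the cable system of the same graph for the unit length function,
identified with `X` via the canonical homeomorphism `Φ`.  Then for every pair of disjoint
continua `E, F ⊆ X`, the modulus computed in `(d_ℓ, μ)` agrees with the modulus computed
in `(d₁, μ₁)` (conformal invariance), and `Mod(E,F) ≥ 1 / dist₁(E,F)`. -/
theorem modulus_ge_inv_dist_one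
    {V X X₁ : Type*} [MetricSpace X] [MeasurableSpace X]
    [MetricSpace X₁] [MeasurableSpace X₁]
    (G : SimpleGraph V) (hconn : G.Connected) (hlf : ∀ v : V, (G.neighborSet v).Finite)
    (p : V → EuclideanSpace ℝ (Fin 2)) (D₀ η : ℝ) (hgood : IsGoodEmbedding G p D₀ η)
    (hcarr : carrier G p = Set.univ)
    (μ : Measure X) (vtx : V → X) (em : V → V → ℝ → X)
    (hcs : IsCableSystem G (fun u v => dist (p u) (p v)) μ vtx em)
    (μ₁ : Measure X₁) (vtx₁ : V → X₁) (em₁ : V → V → ℝ → X₁)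
    (hcs₁ : IsCableSystem G (fun _ _ => 1) μ₁ vtx₁ em₁)
    (Φ : X ≃ₜ X₁)
    (hΦ : ∀ u v, G.Adj u v → ∀ s ∈ Icc (0 : ℝ) (dist (p u) (p v)),
      Φ (em u v s) = em₁ u v (s / dist (p u) (p v)))
    (E F : Set X) (hEc : IsCompact E) (hFc : IsCompact F)
    (hEconn : IsConnected E) (hFconn : IsConnected F)
    (hEnt : E.Nontrivial) (hFnt : F.Nontrivial) (hdisj : Disjoint E F) :
    modulus μ (JoiningCurves E F) = modulus μ₁ (JoiningCurves (Φ '' E) (Φ '' F)) ∧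
      ENNReal.ofReal (1 / setDist (Φ '' E) (Φ '' F)) ≤ modulus μ (JoiningCurves E F) := by
  have : Countable V := IsCableSystem.countable_vertices hconn hlf
  have hpos : ∀ u v, G.Adj u v → 0 < dist (p u) (p v) := hcs.len_pos
  have hmul : ∀ u v, G.Adj u v → ∀ s ∈ Icc (0 : ℝ) 1,
      s * dist (p u) (p v) ∈ Icc 0 (dist (p u) (p v)) := fun u v ha s hs =>
    ⟨mul_nonneg hs.1 dist_nonneg, mul_le_of_le_one_left dist_nonneg hs.2⟩
  have hΦ₁ : ∀ u v, G.Adj u v → ∀ s ∈ Icc (0 : ℝ) 1,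
      Φ (em u v (s * dist (p u) (p v))) = em₁ u v s := fun u v ha s hs => by
    rw [hΦ u v ha _ (hmul u v ha s hs), mul_div_cancel_right₀ _ (hpos u v ha).ne']
  have heq : modulus μ (JoiningCurves E F) =
      modulus μ₁ (JoiningCurves (Φ '' E) (Φ '' F)) := by
    refine le_antisymm (hcs₁.modulus_le_of_homeomorph hcs Φ (fun u v ha s hs => ?_)
      (hcs.exists_locallyLong hcs₁ Φ.continuous hΦ) (fun x => ?_) E F) ?_
    · rw [hΦ u v ha s hs, mul_one_div]
    · obtain ⟨c, hc, hlong⟩ := hcs.exists_locallyLong hcs₁ Φ.continuous hΦ x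
      refine ⟨c, hc, 1 / c, fun u v ha s hs h => one_div_le_one_div_of_le hc ?_⟩
      exact hlong u v ha s hs (by rwa [dist_comm])
    · have h := hcs.modulus_le_of_homeomorph hcs₁ Φ.symm (fun u v ha s hs => ?_)
        (fun x => ⟨1, one_pos, fun u v ha s hs h => le_rfl⟩) (fun x => ?_) (Φ '' E) (Φ '' F)
      · have hi : ∀ S, Φ.symm '' (Φ '' S) = S := Φ.toEquiv.symm_image_image
        rwa [hi, hi] at h
      · rw [div_one, ← hΦ₁ u v ha s hs, Φ.symm_apply_apply]
      · obtain ⟨ε, hε, C, hC⟩ := hcs.exists_locally_le hcs₁ Φ hΦ (Φ.symm x)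
        refine ⟨ε, hε, C, fun u v ha s hs h => ?_⟩
        rw [div_one]
        refine hC u v ha _ (hmul u v ha s hs) ?_
        rwa [hΦ₁ u v ha s hs, Φ.apply_symm_apply]
  refine ⟨heq, heq ▸ hcs₁.one_div_setDist_le_modulus hconn (hEconn.nonempty.image Φ)
    (hFconn.nonempty.image Φ) ((disjoint_image_iff Φ.injective).2 hdisj)⟩

end
end

section
/- Let G be a connected, locally finite, simple graph of polynomial growth with volume growth exponent d ≥ 2, and let (X,d₁,μ₁) be its cable system with unit length function. Suppose (X,d₁,μ₁) satisfies the Poincaré inequality PI(Ψ) with Ψ(r) = r² ∨ r^d. Then there exists a constant c > 0 such that for all x ∈ X, all r ≥ 1 and all y, z ∈ B₁(x,2r)∖B₁(x,r) with d₁(y,z) > r/4, the modulus of the family of curves joining the closed balls E = cl(B₁(y,r/8)) and F = cl(B₁(z,r/8)) satisfies Mod(E,F) ≥ c. -/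
open MeasureTheory Set Metric Filter
open scoped ENNReal NNReal

noncomputable section

variable {V : Type*} {X : Type*}

/-! ### Upper gradients on the unit interval -/

/-- `k` is an upper gradient of `F` on the unit interval. -/
def IsUnitUpperGradient (F : ℝ → ℝ) (k : ℝ → ℝ≥0∞) : Prop :=
  ∀ s t : ℝ, 0 ≤ s → s ≤ t → t ≤ 1 → ENNReal.ofReal |F t - F s| ≤ ∫⁻ x in Ioc s t, k x

theorem sq_setLIntegral_Ioc_le {k : ℝ → ℝ≥0∞} (hk : Measurable k) (s t : ℝ) :
    (∫⁻ x in Ioc s t, k x) ^ 2 ≤ ENNReal.ofReal (t - s) * ∫⁻ x in Ioc s t, k x ^ 2 := by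
  have h := ENNReal.lintegral_mul_le_Lp_mul_Lq (volume.restrict (Ioc s t))
    Real.HolderConjugate.two_two (f := fun _ => 1) (g := k) aemeasurable_const hk.aemeasurable
  simp only [Pi.mul_apply, one_mul, ENNReal.one_rpow, lintegral_const,
    MeasurableSet.univ, Measure.restrict_apply, univ_inter, Real.volume_Ioc] at h
  calc _ ≤ _ := pow_le_pow_left' h 2
    _ = _ := by
      rw [mul_pow, ← ENNReal.rpow_natCast, ← ENNReal.rpow_natCast, ← ENNReal.rpow_mul,
        ← ENNReal.rpow_mul]
      norm_num

theorem IsUnitUpperGradient.sq_sub_le {F : ℝ → ℝ} {k : ℝ → ℝ≥0∞} (h : IsUnitUpperGradient F k)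
    (hk : Measurable k) {s t : ℝ} (hs : s ∈ Icc (0 : ℝ) 1) (ht : t ∈ Icc (0 : ℝ) 1) :
    ENNReal.ofReal ((F s - F t) ^ 2) ≤
      ENNReal.ofReal |s - t| * ∫⁻ x in Icc (0 : ℝ) 1, k x ^ 2 := by
  wlog hst : s ≤ t generalizing s t
  · rw [show (F s - F t) ^ 2 = (F t - F s) ^ 2 by ring, abs_sub_comm]
    exact this ht hs (le_of_not_ge hst)
  have h1 := h s t hs.1 hst ht.2
  calc ENNReal.ofReal ((F s - F t) ^ 2) = ENNReal.ofReal |F t - F s| ^ 2 := by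
        rw [← ENNReal.ofReal_pow (abs_nonneg _), sq_abs]; congr 1; ring
    _ ≤ (∫⁻ x in Ioc s t, k x) ^ 2 := pow_le_pow_left' h1 2
    _ ≤ _ := sq_setLIntegral_Ioc_le hk s t
    _ ≤ _ := by
      rw [abs_sub_comm, abs_of_nonneg (sub_nonneg.2 hst)]
      gcongr
      exact fun x hx => ⟨hs.1.trans hx.1.le, hx.2.trans ht.2⟩

theorem IsUnitUpperGradient.continuousOn {F : ℝ → ℝ} {k : ℝ → ℝ≥0∞}
    (h : IsUnitUpperGradient F k) (hk : Measurable k)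
    (hfin : ∫⁻ x in Icc (0 : ℝ) 1, k x ^ 2 ≠ ∞) : ContinuousOn F (Icc 0 1) := by
  intro t ht
  set E := (∫⁻ x in Icc (0 : ℝ) 1, k x ^ 2).toReal
  have hb : ∀ s ∈ Icc (0 : ℝ) 1, |F s - F t| ≤ √(|s - t| * E) := by
    intro s hs
    apply Real.abs_le_sqrt
    have h1 := h.sq_sub_le hk hs ht
    rw [← ENNReal.ofReal_toReal hfin, ← ENNReal.ofReal_mul (abs_nonneg _)] at h1
    exact (ENNReal.ofReal_le_ofReal_iff (by positivity)).1 h1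
  rw [ContinuousWithinAt, tendsto_iff_dist_tendsto_zero]
  have hc : Tendsto (fun s => √(|s - t| * E)) (nhdsWithin t (Icc 0 1)) (nhds 0) := by
    have : Continuous (fun s => √(|s - t| * E)) := by fun_prop
    simpa using (this.tendsto t).mono_left nhdsWithin_le_nhds
  refine squeeze_zero' (Eventually.of_forall fun _ => dist_nonneg) ?_ hc
  filter_upwards [self_mem_nhdsWithin] with s hs
  exact hb s hs

theorem IsUnitUpperGradient.neg {F : ℝ → ℝ} {k : ℝ → ℝ≥0∞} (h : IsUnitUpperGradient F k) :
    IsUnitUpperGradient (fun t => -F t) k := by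
  intro s t hs hst ht
  have := h s t hs hst ht
  rwa [← abs_neg, show -(-F t - -F s) = F t - F s by ring]

/-- Truncating a function from above by `b` restricts its upper gradient to `{F < b}`. -/
theorem IsUnitUpperGradient.min_const {F : ℝ → ℝ} {k : ℝ → ℝ≥0∞} (h : IsUnitUpperGradient F k)
    (hF : ContinuousOn F (Icc 0 1)) (b : ℝ) :
    IsUnitUpperGradient (fun t => min (F t) b) ({x | x ∈ Icc 0 1 ∧ F x < b}.indicator k) := by
  have hF' : ∀ {s t : ℝ}, 0 ≤ s → t ≤ 1 → ContinuousOn F (Icc s t) := fun hs ht =>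
    hF.mono (Icc_subset_Icc hs ht)
  have below : ∀ s t : ℝ, 0 ≤ s → s ≤ t → t ≤ 1 → (∀ x ∈ Ioo s t, F x < b) →
      ENNReal.ofReal |F t - F s| ≤
        ∫⁻ x in Ioc s t, ({x | x ∈ Icc 0 1 ∧ F x < b}.indicator k) x := by
    intro s t hs hst ht hlt
    refine (h s t hs hst ht).trans_eq ?_
    rw [← setLIntegral_congr Ioo_ae_eq_Ioc, ← setLIntegral_congr Ioo_ae_eq_Ioc]
    refine setLIntegral_congr_fun measurableSet_Ioo fun x hx => ?_
    rw [indicator_of_mem]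
    exact ⟨⟨hs.trans hx.1.le, hx.2.le.trans ht⟩, hlt x hx⟩
  have up : ∀ s t : ℝ, 0 ≤ s → s ≤ t → t ≤ 1 → F s < b → b ≤ F t →
      ENNReal.ofReal (b - F s) ≤
        ∫⁻ x in Ioc s t, ({x | x ∈ Icc 0 1 ∧ F x < b}.indicator k) x := by
    intro s t hs hst ht hsb htb
    have hcl : IsCompact (Icc s t ∩ F ⁻¹' Ici b) :=
      isCompact_Icc.of_isClosed_subset ((hF' hs ht).preimage_isClosed_of_isClosed
        isClosed_Icc isClosed_Ici) inter_subset_left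
    obtain ⟨τ, ⟨hτ, hτb⟩, hmin⟩ := hcl.exists_isLeast ⟨t, ⟨hst, le_rfl⟩, htb⟩
    have h1 := below s τ hs hτ.1 (hτ.2.trans ht) fun x hx => by
      by_contra! hx'
      exact absurd (hmin ⟨⟨hx.1.le, hx.2.le.trans hτ.2⟩, hx'⟩) (not_le.2 hx.2)
    refine (ENNReal.ofReal_le_ofReal ?_).trans (h1.trans
      (lintegral_mono_set (Ioc_subset_Ioc_right hτ.2)))
    exact (sub_le_sub_right hτb _).trans (le_abs_self _)
  have down : ∀ s t : ℝ, 0 ≤ s → s ≤ t → t ≤ 1 → F t < b → b ≤ F s →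
      ENNReal.ofReal (b - F t) ≤
        ∫⁻ x in Ioc s t, ({x | x ∈ Icc 0 1 ∧ F x < b}.indicator k) x := by
    intro s t hs hst ht htb hsb
    have hcl : IsCompact (Icc s t ∩ F ⁻¹' Ici b) :=
      isCompact_Icc.of_isClosed_subset ((hF' hs ht).preimage_isClosed_of_isClosed
        isClosed_Icc isClosed_Ici) inter_subset_left
    obtain ⟨τ, ⟨hτ, hτb⟩, hmax⟩ := hcl.exists_isGreatest ⟨s, ⟨le_rfl, hst⟩, hsb⟩
    have h1 := below τ t (hs.trans hτ.1) hτ.2 ht fun x hx => by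
      by_contra! hx'
      exact absurd (hmax ⟨⟨hτ.1.trans hx.1.le, hx.2.le⟩, hx'⟩) (not_le.2 hx.1)
    refine (ENNReal.ofReal_le_ofReal ?_).trans (h1.trans
      (lintegral_mono_set (Ioc_subset_Ioc_left hτ.1)))
    rw [abs_sub_comm]
    exact (sub_le_sub_right hτb _).trans (le_abs_self _)
  intro s t hs hst ht
  beta_reduce
  rcases lt_or_ge (F s) b with hsb | hsb <;> rcases lt_or_ge (F t) b with htb | htb
  · rw [min_eq_left hsb.le, min_eq_left htb.le]
    by_cases hall : ∀ x ∈ Ioo s t, F x < b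
    · exact below s t hs hst ht hall
    push Not at hall
    obtain ⟨m, hm, hmb⟩ := hall
    rcases le_total (F s) (F t) with hle | hle
    · rw [abs_of_nonneg (sub_nonneg.2 hle)]
      refine (ENNReal.ofReal_le_ofReal ?_).trans ((up s m hs hm.1.le (hm.2.le.trans ht) hsb
        hmb).trans (lintegral_mono_set (Ioc_subset_Ioc_right hm.2.le)))
      linarith
    · rw [abs_of_nonpos (sub_nonpos.2 hle)]
      refine (ENNReal.ofReal_le_ofReal ?_).trans ((down m t (hs.trans hm.1.le) hm.2.le ht htb
        hmb).trans (lintegral_mono_set (Ioc_subset_Ioc_left hm.1.le)))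
      linarith
  · rw [min_eq_left hsb.le, min_eq_right htb, abs_of_pos (sub_pos.2 hsb)]
    exact up s t hs hst ht hsb htb
  · rw [min_eq_right hsb, min_eq_left htb.le, abs_of_neg (sub_neg.2 htb), neg_sub]
    exact down s t hs hst ht htb hsb
  · simp [min_eq_right hsb, min_eq_right htb]

/-- Truncating a function from below by `b` restricts its upper gradient to `{F > b}`. -/
theorem IsUnitUpperGradient.max_const {F : ℝ → ℝ} {k : ℝ → ℝ≥0∞} (h : IsUnitUpperGradient F k)
    (hF : ContinuousOn F (Icc 0 1)) (b : ℝ) :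
    IsUnitUpperGradient (fun t => max (F t) b) ({x | x ∈ Icc 0 1 ∧ b < F x}.indicator k) := by
  have := (h.neg.min_const hF.neg (-b)).neg
  simpa only [← max_neg_neg, neg_neg, neg_lt_neg_iff] using this

theorem abs_le_abs_of_hasDerivAt {F R : ℝ → ℝ} {a b t : ℝ} (hF : HasDerivAt F a t)
    (hR : HasDerivAt R b t) (h : ∀ᶠ y in nhds t, |F y - F t| ≤ |R y - R t|) : |a| ≤ |b| := by
  refine le_of_tendsto_of_tendsto (hasDerivAt_iff_tendsto_slope.1 hF).abs
    (hasDerivAt_iff_tendsto_slope.1 hR).abs ?_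
  filter_upwards [nhdsWithin_le_nhds h] with y hy
  simp only [slope_def_field, abs_div]
  gcongr

/-- A function with a square-integrable upper gradient `k` is the integral of its derivative,
which is dominated by `k`. -/
theorem IsUnitUpperGradient.deriv_spec {F : ℝ → ℝ} {k : ℝ → ℝ≥0∞}
    (h : IsUnitUpperGradient F k) (hk : Measurable k)
    (hfin : ∫⁻ x in Icc (0 : ℝ) 1, k x ^ 2 ≠ ∞) :
    IntegrableOn (deriv F) (Icc 0 1) ∧
    (∀ t ∈ Icc (0 : ℝ) 1, F t = F 0 + ∫ s in Ioc 0 t, deriv F s) ∧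
    ∀ᵐ t ∂volume.restrict (Icc (0 : ℝ) 1), ENNReal.ofReal |deriv F t| ≤ k t := by
  have hfin1 : ∫⁻ x in Icc (0 : ℝ) 1, k x ≠ ∞ := by
    have h1 := sq_setLIntegral_Ioc_le hk 0 1
    rw [setLIntegral_congr Ioc_ae_eq_Icc, setLIntegral_congr Ioc_ae_eq_Icc] at h1
    intro h2
    simp [h2, hfin] at h1
  have hae : ∀ᵐ x ∂volume.restrict (Icc (0 : ℝ) 1), k x < ∞ := ae_lt_top hk hfin1
  have hint : IntegrableOn (fun x => (k x).toReal) (Icc 0 1) :=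
    integrable_toReal_of_lintegral_ne_top hk.aemeasurable hfin1
  have hii : IntervalIntegrable (fun x => (k x).toReal) volume 0 1 :=
    (intervalIntegrable_iff_integrableOn_Icc_of_le zero_le_one).2 hint
  set R : ℝ → ℝ := fun x => ∫ v in (0 : ℝ)..x, (k v).toReal with hRdef
  have hsub : ∀ s ∈ Icc (0 : ℝ) 1, ∀ t ∈ Icc (0 : ℝ) 1, |F t - F s| ≤ |R t - R s| := by
    intro s hs t ht
    wlog hst : s ≤ t generalizing s t
    · rw [abs_sub_comm, abs_sub_comm (R t)]
      exact this t ht s hs (le_of_not_ge hst)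
    have hI : ∀ x ∈ Icc (0 : ℝ) 1, IntervalIntegrable (fun x => (k x).toReal) volume 0 x :=
      fun x hx => hii.mono_set (by
        rw [uIcc_of_le hx.1, uIcc_of_le zero_le_one]; exact Icc_subset_Icc_right hx.2)
    rw [hRdef]
    simp only
    rw [intervalIntegral.integral_interval_sub_left (hI t ht) (hI s hs),
      intervalIntegral.integral_of_le hst]
    have hss : Ioc s t ⊆ Icc 0 1 := fun x hx => ⟨hs.1.trans hx.1.le, hx.2.trans ht.2⟩
    rw [integral_toReal hk.aemeasurable (ae_restrict_of_ae_restrict_of_subset hss hae),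
      abs_of_nonneg ENNReal.toReal_nonneg]
    exact (ENNReal.ofReal_le_iff_le_toReal
      (ne_top_of_le_ne_top hfin1 (lintegral_mono_set hss))).1 (h s t hs.1 hst ht.2)
  have hR : AbsolutelyContinuousOnInterval R 0 1 :=
    hii.absolutelyContinuousOnInterval_intervalIntegral (by simp)
  have hF : AbsolutelyContinuousOnInterval F 0 1 := by
    refine squeeze_zero' (Eventually.of_forall fun E => Finset.sum_nonneg fun _ _ => dist_nonneg)
      ?_ hR
    filter_upwards [mem_inf_of_right (mem_principal_self _)] with E hE
    refine Finset.sum_le_sum fun i hi => ?_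
    obtain ⟨h1, h2⟩ := hE.1 i hi
    rw [uIcc_of_le zero_le_one] at h1 h2
    exact hsub _ h2 _ h1
  refine ⟨(intervalIntegrable_iff_integrableOn_Icc_of_le zero_le_one).1
    hF.intervalIntegrable_deriv, fun t ht => ?_, ?_⟩
  · have := (hF.mono (c := 0) (d := t) (by
      rw [uIcc_of_le ht.1, uIcc_of_le zero_le_one]
      exact Icc_subset_Icc_right ht.2)).integral_deriv_eq_sub
    rw [intervalIntegral.integral_of_le ht.1] at this
    linarith
  · rw [restrict_Ioo_eq_restrict_Icc.symm, ae_restrict_iff' measurableSet_Ioo]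
    filter_upwards [hF.ae_differentiableAt, hii.ae_hasDerivAt_integral,
      (ae_restrict_iff' measurableSet_Icc).1 hae] with t h1 h2 h3 ht
    have htI : t ∈ uIcc (0 : ℝ) 1 := by
      rw [uIcc_of_le zero_le_one]; exact Ioo_subset_Icc_self ht
    have h4 := abs_le_abs_of_hasDerivAt (h1 htI).hasDerivAt (h2 htI 0 (by simp)) (by
      filter_upwards [Ioo_mem_nhds ht.1 ht.2] with y hy
      exact hsub t (Ioo_subset_Icc_self ht) y (Ioo_subset_Icc_self hy))
    rw [abs_of_nonneg ENNReal.toReal_nonneg] at h4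
    exact ENNReal.ofReal_le_of_le_toReal h4

/-! ### Effective resistance on a cable system -/

/-- `k` is an upper gradient of `f` along every oriented edge. -/
def IsEdgeUpperGradient (G : SimpleGraph V) (em : V → V → ℝ → X) (f : X → ℝ)
    (k : G.Dart → ℝ → ℝ≥0∞) : Prop :=
  ∀ e : G.Dart, Measurable (k e) ∧ IsUnitUpperGradient (fun t => f (em e.fst e.snd t)) (k e)

/-- The energy of a family of edgewise upper gradients, summed over all oriented edges. -/
def edgeEnergy {G : SimpleGraph V} (k : G.Dart → ℝ → ℝ≥0∞) : ℝ≥0∞ :=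
  ∑' e, ∫⁻ t in Icc (0 : ℝ) 1, k e t ^ 2

theorem setLIntegral_sq_le_edgeEnergy {G : SimpleGraph V} (k : G.Dart → ℝ → ℝ≥0∞) (e : G.Dart) :
    ∫⁻ t in Icc (0 : ℝ) 1, k e t ^ 2 ≤ edgeEnergy k :=
  ENNReal.le_tsum e

theorem IsEdgeUpperGradient.neg {G : SimpleGraph V} {em : V → V → ℝ → X} {f : X → ℝ}
    {k : G.Dart → ℝ → ℝ≥0∞} (h : IsEdgeUpperGradient G em f k) :
    IsEdgeUpperGradient G em (fun x => -f x) k :=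
  fun e => ⟨(h e).1, (h e).2.neg⟩

/-- Cutting `f` at height `b` splits its energy between the two truncations. -/
theorem IsEdgeUpperGradient.exists_truncation {G : SimpleGraph V} {em : V → V → ℝ → X}
    {f : X → ℝ} {k : G.Dart → ℝ → ℝ≥0∞} (h : IsEdgeUpperGradient G em f k)
    (hE : edgeEnergy k ≠ ∞) (b : ℝ) :
    ∃ k₁ k₂ : G.Dart → ℝ → ℝ≥0∞, IsEdgeUpperGradient G em (fun x => min (f x) b) k₁ ∧
      IsEdgeUpperGradient G em (fun x => max (f x) b) k₂ ∧
      edgeEnergy k₁ + edgeEnergy k₂ ≤ edgeEnergy k := by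
  have hc : ∀ e : G.Dart, ContinuousOn (fun t => f (em e.fst e.snd t)) (Icc 0 1) := fun e =>
    (h e).2.continuousOn (h e).1 (ne_top_of_le_ne_top hE (setLIntegral_sq_le_edgeEnergy k e))
  have hms : ∀ (e : G.Dart) (U : Set ℝ), IsOpen U →
      MeasurableSet {t : ℝ | t ∈ Icc 0 1 ∧ f (em e.fst e.snd t) ∈ U} := by
    intro e U hU
    obtain ⟨W, hW, hWU⟩ := continuousOn_iff'.1 (hc e) U hU
    have : {t : ℝ | t ∈ Icc 0 1 ∧ f (em e.fst e.snd t) ∈ U} = W ∩ Icc 0 1 := by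
      rw [← hWU]; ext t; simp [and_comm]
    rw [this]
    exact hW.measurableSet.inter measurableSet_Icc
  have h1 : ∀ e : G.Dart, MeasurableSet {t : ℝ | t ∈ Icc 0 1 ∧ f (em e.fst e.snd t) < b} :=
    fun e => hms e (Iio b) isOpen_Iio
  have h2 : ∀ e : G.Dart, MeasurableSet {t : ℝ | t ∈ Icc 0 1 ∧ b < f (em e.fst e.snd t)} :=
    fun e => hms e (Ioi b) isOpen_Ioi
  refine ⟨fun e => {t | t ∈ Icc 0 1 ∧ f (em e.fst e.snd t) < b}.indicator (k e),
    fun e => {t | t ∈ Icc 0 1 ∧ b < f (em e.fst e.snd t)}.indicator (k e),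
    fun e => ⟨(h e).1.indicator (h1 e), (h e).2.min_const (hc e) b⟩,
    fun e => ⟨(h e).1.indicator (h2 e), (h e).2.max_const (hc e) b⟩, ?_⟩
  unfold edgeEnergy
  rw [← ENNReal.tsum_add]
  refine ENNReal.tsum_le_tsum fun e => ?_
  refine (lintegral_add_left (((h e).1.indicator (h1 e)).pow_const 2) _).symm.trans_le ?_
  refine lintegral_mono fun t => ?_
  simp only [indicator_apply]
  by_cases ha : t ∈ {t | t ∈ Icc (0 : ℝ) 1 ∧ f (em e.fst e.snd t) < b}
  · rw [if_pos ha, if_neg (fun hb => lt_asymm ha.2 hb.2)]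
    simp
  · rw [if_neg ha]
    split_ifs <;> simp

/-- The effective resistance between `p` and `q` is at most `c`. -/
def ResistanceLE (G : SimpleGraph V) (em : V → V → ℝ → X) (c : ℝ) (p q : X) : Prop :=
  ∀ (f : X → ℝ) (k : G.Dart → ℝ → ℝ≥0∞), IsEdgeUpperGradient G em f k → edgeEnergy k ≠ ∞ →
    (f p - f q) ^ 2 ≤ c * (edgeEnergy k).toReal

theorem ResistanceLE.symm {G : SimpleGraph V} {em : V → V → ℝ → X} {c : ℝ} {p q : X}
    (h : ResistanceLE G em c p q) : ResistanceLE G em c q p := fun f k hf hE => by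
  rw [show (f q - f p) ^ 2 = (f p - f q) ^ 2 by ring]
  exact h f k hf hE

theorem add_sq_le_of_sq_le {x y c₁ c₂ E₁ E₂ : ℝ} (hc₁ : 0 ≤ c₁) (hc₂ : 0 ≤ c₂) (hE₁ : 0 ≤ E₁)
    (hE₂ : 0 ≤ E₂) (hx : x ^ 2 ≤ c₁ * E₁) (hy : y ^ 2 ≤ c₂ * E₂) :
    (x + y) ^ 2 ≤ (c₁ + c₂) * (E₁ + E₂) := by
  have h : 2 * (x * y) ≤ c₁ * E₂ + c₂ * E₁ := by
    refine le_of_abs_le (abs_le_of_sq_le_sq ?_ (by positivity))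
    nlinarith [mul_le_mul hx hy (sq_nonneg y) (mul_nonneg hc₁ hE₁),
      sq_nonneg (c₁ * E₂ - c₂ * E₁)]
  nlinarith

theorem ResistanceLE.trans {G : SimpleGraph V} {em : V → V → ℝ → X} {c₁ c₂ : ℝ} {p q r : X}
    (hc₁ : 0 ≤ c₁) (hc₂ : 0 ≤ c₂) (h₁ : ResistanceLE G em c₁ p q)
    (h₂ : ResistanceLE G em c₂ q r) : ResistanceLE G em (c₁ + c₂) p r := by
  intro f k hf hE
  wlog hpr : f p ≤ f r generalizing f
  · have := this (fun x => -f x) hf.neg (neg_le_neg (le_of_not_ge hpr))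
    rwa [show (-f p - -f r) ^ 2 = (f p - f r) ^ 2 by ring] at this
  have hE0 : 0 ≤ (edgeEnergy k).toReal := ENNReal.toReal_nonneg
  rcases lt_or_ge (f q) (f p) with hqp | hqp
  · have := h₂ f k hf hE
    nlinarith [mul_nonneg hc₁ hE0]
  rcases lt_or_ge (f r) (f q) with hrq | hrq
  · have := h₁ f k hf hE
    nlinarith [mul_nonneg hc₂ hE0]
  obtain ⟨k₁, k₂, hk₁, hk₂, hle⟩ := hf.exists_truncation hE (f q)
  have hE₁ := ne_top_of_le_ne_top hE (le_self_add.trans hle)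
  have hE₂ := ne_top_of_le_ne_top hE (le_add_self.trans hle)
  have hx := h₁ _ k₁ hk₁ hE₁
  have hy := h₂ _ k₂ hk₂ hE₂
  simp only [min_self, max_self, min_eq_left hqp, max_eq_left hrq] at hx hy
  have hsum : (edgeEnergy k₁).toReal + (edgeEnergy k₂).toReal ≤ (edgeEnergy k).toReal := by
    rw [← ENNReal.toReal_add hE₁ hE₂]
    exact ENNReal.toReal_mono hE hle
  have := add_sq_le_of_sq_le hc₁ hc₂ ENNReal.toReal_nonneg ENNReal.toReal_nonneg hx hy
  calc (f p - f r) ^ 2 = (f p - f q + (f q - f r)) ^ 2 := by ring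
    _ ≤ _ := this
    _ ≤ _ := by gcongr

theorem resistanceLE_zero (G : SimpleGraph V) (em : V → V → ℝ → X) (p : X) :
    ResistanceLE G em 0 p p := fun f k _ _ => by simp

theorem resistanceLE_edge {G : SimpleGraph V} (em : V → V → ℝ → X) {u v : V} (h : G.Adj u v)
    {s t : ℝ} (hs : s ∈ Icc (0 : ℝ) 1) (ht : t ∈ Icc (0 : ℝ) 1) :
    ResistanceLE G em |s - t| (em u v s) (em u v t) := by
  intro f k hf hE
  have h1 := ((hf ⟨(u, v), h⟩).2.sq_sub_le (hf ⟨(u, v), h⟩).1 hs ht).trans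
    (mul_le_mul_right (setLIntegral_sq_le_edgeEnergy k ⟨(u, v), h⟩) _)
  rw [← ENNReal.ofReal_toReal hE, ← ENNReal.ofReal_mul (abs_nonneg _)] at h1
  exact (ENNReal.ofReal_le_ofReal_iff (by positivity)).1 h1

section CableSystem

variable [MetricSpace X] [MeasurableSpace X] {G : SimpleGraph V} {μ : Measure X} {vtx : V → X}
  {em : V → V → ℝ → X}

theorem IsCableSystem.edge_one (hcs : IsCableSystem G (fun _ _ => 1) μ vtx em) {u v : V}
    (h : G.Adj u v) : em u v 1 = vtx v := by
  rw [hcs.edge_flip u v h, sub_self, hcs.edge_start v u h.symm]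

theorem IsCableSystem.exists_resistanceLE (hcs : IsCableSystem G (fun _ _ => 1) μ vtx em)
    (hconn : G.Connected) (p q : X) : ∃ c, 0 ≤ c ∧ ResistanceLE G em c p q := by
  obtain ⟨u, v, s, huv, hs, rfl⟩ := hcs.cover p
  obtain ⟨u', v', s', huv', hs', rfl⟩ := hcs.cover q
  have h0 : (0 : ℝ) ∈ Icc (0 : ℝ) 1 := by simp
  have h1 : (1 : ℝ) ∈ Icc (0 : ℝ) 1 := by simp
  have key : ∀ a b, G.Walk a b → ∃ c, 0 ≤ c ∧ ResistanceLE G em c (vtx a) (vtx b) := by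
    intro a b w
    induction w with
    | nil => exact ⟨0, le_rfl, resistanceLE_zero G em _⟩
    | cons hadj _ ih =>
      obtain ⟨c, hc, hR⟩ := ih
      have := resistanceLE_edge em hadj h0 h1
      rw [hcs.edge_start _ _ hadj, hcs.edge_one hadj] at this
      exact ⟨_, by positivity, this.trans (abs_nonneg _) hc hR⟩
  obtain ⟨w⟩ := hconn.preconnected u u'
  obtain ⟨c, hc, hR⟩ := key u u' w
  have ha := resistanceLE_edge em huv hs h0
  have hb := resistanceLE_edge em huv' h0 hs'
  rw [hcs.edge_start _ _ huv] at ha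
  rw [hcs.edge_start _ _ huv'] at hb
  exact ⟨_, by positivity, (ha.trans (abs_nonneg _) hc hR).trans (by positivity)
    (abs_nonneg _) hb⟩

/-- On a cable system, the effective resistance is at most the distance. -/
theorem IsCableSystem.resistanceLE_dist (hcs : IsCableSystem G (fun _ _ => 1) μ vtx em)
    (hconn : G.Connected) (p q : X) : ResistanceLE G em (dist p q) p q := by
  set S : X → X → Set ℝ := fun p q => {c | 0 ≤ c ∧ ResistanceLE G em c p q} with hS
  have hne : ∀ p q, (S p q).Nonempty := hcs.exists_resistanceLE hconn
  have hbdd : ∀ p q, BddBelow (S p q) := fun p q => ⟨0, fun c hc => hc.1⟩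
  have hmem : ∀ p q, sInf (S p q) ∈ S p q := by
    refine fun p q => ⟨le_csInf (hne p q) fun c hc => hc.1, fun f k hf hE => ?_⟩
    rcases (ENNReal.toReal_nonneg : 0 ≤ (edgeEnergy k).toReal).eq_or_lt with h0 | h0
    · obtain ⟨c, hc⟩ := hne p q
      simpa [← h0] using hc.2 f k hf hE
    · rw [← div_le_iff₀ h0]
      exact le_csInf (hne p q) fun c hc => (div_le_iff₀ h0).2 (hc.2 f k hf hE)
  have hle : sInf (S p q) ≤ dist p q := by
    refine hcs.dist_maximal (fun p q => sInf (S p q)) (fun p => ?_) (fun p q => ?_)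
      (fun p q r => ?_) (fun u v huv s hs t ht => ?_) p q
    · exact le_antisymm (csInf_le (hbdd p p) ⟨le_rfl, resistanceLE_zero G em p⟩) (hmem p p).1
    · exact congrArg sInf (Set.ext fun c => and_congr_right fun _ =>
        ⟨ResistanceLE.symm, ResistanceLE.symm⟩)
    · exact csInf_le (hbdd p r) ⟨add_nonneg (hmem p q).1 (hmem q r).1,
        (hmem p q).2.trans (hmem p q).1 (hmem q r).1 (hmem q r).2⟩
    · exact csInf_le (hbdd _ _) ⟨abs_nonneg _, resistanceLE_edge em huv hs ht⟩
  intro f k hf hE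
  exact ((hmem p q).2 f k hf hE).trans (mul_le_mul_of_nonneg_right hle ENNReal.toReal_nonneg)

theorem IsCableSystem.continuous_of_edgeUpperGradient
    (hcs : IsCableSystem G (fun _ _ => 1) μ vtx em) (hconn : G.Connected) {f : X → ℝ}
    {k : G.Dart → ℝ → ℝ≥0∞} (hf : IsEdgeUpperGradient G em f k) (hE : edgeEnergy k ≠ ∞) :
    Continuous f := by
  rw [continuous_iff_continuousAt]
  intro p
  rw [ContinuousAt, tendsto_iff_dist_tendsto_zero]
  have hc : Tendsto (fun q => √(dist q p * (edgeEnergy k).toReal)) (nhds p) (nhds 0) := by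
    have : Continuous (fun q => √(dist q p * (edgeEnergy k).toReal)) := by fun_prop
    simpa using this.tendsto p
  refine squeeze_zero (fun _ => dist_nonneg) (fun q => ?_) hc
  exact Real.abs_le_sqrt (hcs.resistanceLE_dist hconn q p f k hf hE)

theorem IsCableSystem.lipschitzOnWith (hcs : IsCableSystem G (fun _ _ => 1) μ vtx em) {u v : V}
    (h : G.Adj u v) : LipschitzOnWith 1 (em u v) (Icc 0 1) :=
  LipschitzOnWith.of_dist_le_mul fun s hs t ht => by
    simpa [Real.dist_eq] using hcs.edge_lip u v h s hs t ht

theorem IsCableSystem.continuous_edge_projIcc (hcs : IsCableSystem G (fun _ _ => 1) μ vtx em)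
    {u v : V} (h : G.Adj u v) :
    Continuous fun t : ℝ => em u v (projIcc (0 : ℝ) 1 zero_le_one t) :=
  (hcs.lipschitzOnWith h).continuousOn.comp_continuous
    (continuous_subtype_val.comp continuous_projIcc) fun t => (projIcc 0 1 zero_le_one t).2

theorem IsCableSystem.map_edge_restrict (hcs : IsCableSystem G (fun _ _ => 1) μ vtx em)
    {u v : V} (h : G.Adj u v) {A : Set ℝ} (hA : MeasurableSet A) (hA1 : A ⊆ Icc 0 1) :
    Measure.map (fun t : ℝ => em u v (projIcc (0 : ℝ) 1 zero_le_one t)) (volume.restrict A) =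
      μ.restrict (em u v '' A) := by
  have := hcs.isBorel
  have hm := (hcs.continuous_edge_projIcc h).measurable
  ext B hB
  rw [Measure.map_apply hm hB, Measure.restrict_apply (hm hB), Measure.restrict_apply hB]
  have himg : B ∩ em u v '' A =
      em u v '' ((fun t : ℝ => em u v (projIcc (0 : ℝ) 1 zero_le_one t)) ⁻¹' B ∩ A) := by
    ext x
    constructor
    · rintro ⟨hxB, t, ht, rfl⟩
      exact ⟨t, ⟨by simpa [projIcc_of_mem zero_le_one (hA1 ht)] using hxB, ht⟩, rfl⟩
    · rintro ⟨t, ⟨htB, ht⟩, rfl⟩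
      exact ⟨by simpa [projIcc_of_mem zero_le_one (hA1 ht)] using htB, t, ht, rfl⟩
  rw [himg, hcs.measure_edge u v h _ ((hm hB).inter hA) (inter_subset_right.trans hA1)]
  simp

theorem IsCableSystem.setLIntegral_edge (hcs : IsCableSystem G (fun _ _ => 1) μ vtx em)
    {u v : V} (h : G.Adj u v) {φ : X → ℝ≥0∞} (hφ : Measurable φ) :
    ∫⁻ t in Icc (0 : ℝ) 1, φ (em u v t) = ∫⁻ x in em u v '' Ioo 0 1, φ x ∂μ := by
  have := hcs.isBorel
  rw [← hcs.map_edge_restrict h measurableSet_Ioo Ioo_subset_Icc_self,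
    lintegral_map hφ (hcs.continuous_edge_projIcc h).measurable,
    ← setLIntegral_congr Ioo_ae_eq_Icc]
  refine setLIntegral_congr_fun measurableSet_Ioo fun t ht => ?_
  simp [projIcc_of_mem zero_le_one (Ioo_subset_Icc_self ht)]

theorem IsCableSystem.lintegral_edge_le (hcs : IsCableSystem G (fun _ _ => 1) μ vtx em)
    {u v : V} (h : G.Adj u v) (φ : X → ℝ≥0∞) :
    ∫⁻ x in em u v '' Icc 0 1, φ x ∂μ ≤ ∫⁻ t in Icc (0 : ℝ) 1, φ (em u v t) := by
  rw [← hcs.map_edge_restrict h measurableSet_Icc subset_rfl]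
  refine (lintegral_map_le _ _).trans_eq (setLIntegral_congr_fun measurableSet_Icc fun t ht => ?_)
  simp [projIcc_of_mem zero_le_one ht]

theorem IsCableSystem.measurableSet_edge_interior
    (hcs : IsCableSystem G (fun _ _ => 1) μ vtx em) {u v : V} (h : G.Adj u v) :
    MeasurableSet (em u v '' Ioo 0 1) := by
  have := hcs.isBorel
  have h1 : Ioo (0 : ℝ) 1 = Icc 0 1 \ {0, 1} := by
    rw [Icc_sdiff_both]
  rw [h1, (hcs.edge_inj u v h).image_sdiff_subset (by intro x; simp; rintro (rfl | rfl) <;> simp)]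
  exact (isCompact_Icc.image_of_continuousOn (hcs.lipschitzOnWith h).continuousOn).measurableSet.diff
    ((Set.toFinite _).image _).measurableSet

/-- Each unoriented edge carries two orientations, so integrating over all oriented edges
counts the measure at most twice. -/
theorem IsCableSystem.tsum_edge_le (hcs : IsCableSystem G (fun _ _ => 1) μ vtx em)
    [Countable V] {φ : X → ℝ≥0∞} (hφ : Measurable φ) :
    ∑' e : G.Dart, ∫⁻ t in Icc (0 : ℝ) 1, φ (em e.fst e.snd t) ≤ 2 * ∫⁻ x, φ x ∂μ := by
  classical
  have : Countable G.Dart := (SimpleGraph.Dart.toProd_injective (G := G)).countable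
  have hm := fun e : G.Dart => hcs.measurableSet_edge_interior e.adj
  calc ∑' e : G.Dart, ∫⁻ t in Icc (0 : ℝ) 1, φ (em e.fst e.snd t)
      = ∑' e : G.Dart, ∫⁻ x, (em e.fst e.snd '' Ioo 0 1).indicator φ x ∂μ :=
        tsum_congr fun e => by
          rw [hcs.setLIntegral_edge e.adj hφ, lintegral_indicator (hm e)]
    _ = ∫⁻ x, ∑' e : G.Dart, (em e.fst e.snd '' Ioo 0 1).indicator φ x ∂μ :=
        (lintegral_tsum fun e => (hφ.indicator (hm e)).aemeasurable).symm
    _ ≤ ∫⁻ x, 2 * φ x ∂μ := ?_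
    _ = 2 * ∫⁻ x, φ x ∂μ := lintegral_const_mul _ hφ
  refine lintegral_mono fun x => ?_
  by_cases hx : ∃ e₀ : G.Dart, x ∈ em e₀.fst e₀.snd '' Ioo 0 1
  · obtain ⟨e₀, s₀, hs₀, rfl⟩ := hx
    rw [tsum_eq_sum (s := {e₀, e₀.symm})]
    · calc _ ≤ ∑ _e ∈ ({e₀, e₀.symm} : Finset G.Dart), φ (em e₀.fst e₀.snd s₀) :=
            Finset.sum_le_sum fun e _ => indicator_le_self _ _ _
        _ ≤ _ := by
            rw [Finset.sum_const, nsmul_eq_mul]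
            gcongr
            exact_mod_cast Finset.card_le_two
    · intro e he
      refine indicator_of_notMem ?_ _
      rintro ⟨s, hs, hss⟩
      refine he ?_
      rcases hcs.interior_disjoint _ _ _ _ e.adj e₀.adj s hs s₀ hs₀ hss with
        ⟨h1, h2, -⟩ | ⟨h1, h2, -⟩
      · exact Finset.mem_insert.2 (Or.inl (SimpleGraph.Dart.ext _ _ (Prod.ext h1 h2)))
      · exact Finset.mem_insert.2 (Or.inr (Finset.mem_singleton.2
          (SimpleGraph.Dart.ext _ _ (Prod.ext h1 h2))))
  · push Not at hx
    simp [indicator_of_notMem (hx _)]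

theorem IsCableSystem.lintegral_le_tsum_edge (hcs : IsCableSystem G (fun _ _ => 1) μ vtx em)
    [Countable V] (φ : X → ℝ≥0∞) :
    ∫⁻ x, φ x ∂μ ≤ ∑' e : G.Dart, ∫⁻ t in Icc (0 : ℝ) 1, φ (em e.fst e.snd t) := by
  have : Countable G.Dart := (SimpleGraph.Dart.toProd_injective (G := G)).countable
  have hcov : ⋃ e : G.Dart, em e.fst e.snd '' Icc 0 1 = univ := by
    refine eq_univ_of_forall fun x => ?_
    obtain ⟨u, v, s, h, hs, rfl⟩ := hcs.cover x
    exact mem_iUnion.2 ⟨⟨(u, v), h⟩, s, hs, rfl⟩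
  rw [← setLIntegral_univ, ← hcov]
  exact (lintegral_iUnion_le _ _).trans
    (ENNReal.tsum_le_tsum fun e => hcs.lintegral_edge_le e.adj φ)

/-- A function with an edgewise upper gradient of finite energy has a gradient of no larger
energy. -/
theorem IsCableSystem.exists_hasGradMod (hcs : IsCableSystem G (fun _ _ => 1) μ vtx em)
    (hconn : G.Connected) [Countable V] {f : X → ℝ} {k : G.Dart → ℝ → ℝ≥0∞}
    (hf : IsEdgeUpperGradient G em f k) (hE : edgeEnergy k ≠ ∞) :
    ∃ g : X → ℝ, HasGradMod G (fun _ _ => 1) em f g ∧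
      ∫⁻ x, ENNReal.ofReal (g x ^ 2) ∂μ ≤ edgeEnergy k := by
  classical
  set g : X → ℝ := fun x =>
    if h : ∃ (e : G.Dart) (t : ℝ), t ∈ Ioo (0 : ℝ) 1 ∧ em e.fst e.snd t = x then
      |deriv (fun t => f (em h.choose.fst h.choose.snd t)) h.choose_spec.choose| else 0 with hg
  have hspec := fun e : G.Dart => (hf e).2.deriv_spec (hf e).1
    (ne_top_of_le_ne_top hE (setLIntegral_sq_le_edgeEnergy k e))
  have hval : ∀ (e : G.Dart), ∀ t ∈ Ioo (0 : ℝ) 1,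
      |deriv (fun t => f (em e.fst e.snd t)) t| = g (em e.fst e.snd t) := by
    intro e t ht
    have h : ∃ (e' : G.Dart) (t' : ℝ), t' ∈ Ioo (0 : ℝ) 1 ∧
        em e'.fst e'.snd t' = em e.fst e.snd t := ⟨e, t, ht, rfl⟩
    simp only [hg, dif_pos h]
    obtain ⟨h1, h2⟩ := h.choose_spec.choose_spec
    generalize h.choose_spec.choose = t' at h1 h2
    generalize h.choose = e' at h1 h2
    rcases hcs.interior_disjoint _ _ _ _ e'.adj e.adj t' h1 t ht h2 with
      ⟨h3, h4, rfl⟩ | ⟨h3, h4, rfl⟩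
    · rw [h3, h4]
    · rw [h3, h4]
      have : (fun t => f (em e.snd e.fst t)) = fun t => f (em e.fst e.snd (1 - t)) := by
        funext t
        rw [hcs.edge_flip e.snd e.fst e.adj.symm]
      rw [this, deriv_comp_const_sub (f := fun t => f (em e.fst e.snd t)), abs_neg, sub_sub_cancel]
  have hval' : ∀ e : G.Dart, ∀ᵐ t ∂volume.restrict (Icc (0 : ℝ) 1),
      |deriv (fun t => f (em e.fst e.snd t)) t| = g (em e.fst e.snd t) := by
    intro e
    rw [← restrict_Ioo_eq_restrict_Icc, ae_restrict_iff' measurableSet_Ioo]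
    exact Eventually.of_forall (hval e)
  refine ⟨g, ⟨hcs.continuous_of_edgeUpperGradient hconn hf hE, fun x => ?_, fun u v h => ?_⟩, ?_⟩
  · simp only [hg]
    split_ifs
    · exact abs_nonneg _
    · exact le_rfl
  · exact ⟨_, (hspec ⟨(u, v), h⟩).1, hval' ⟨(u, v), h⟩, (hspec ⟨(u, v), h⟩).2.1⟩
  · refine (hcs.lintegral_le_tsum_edge _).trans (ENNReal.tsum_le_tsum fun e => ?_)
    refine lintegral_mono_ae ?_
    filter_upwards [hval' e, (hspec e).2.2] with t h1 h2
    rw [← h1, ENNReal.ofReal_pow (abs_nonneg _)]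
    exact pow_le_pow_left' h2 2


/-! ### The cost of reaching a point -/

/-- The least integral of `ρ` along `1`-Lipschitz curves from `E` to `p`. -/
def pathCost (ρ : X → ℝ≥0∞) (E : Set X) (p : X) : ℝ≥0∞ :=
  ⨅ (g : ℝ → X) (L : ℝ) (_ : 0 ≤ L ∧ LipschitzOnWith 1 g (Icc 0 L) ∧ g 0 ∈ E ∧ g L = p),
    ∫⁻ t in Icc 0 L, ρ (g t)

theorem pathCost_eq_zero {Y : Type*} [MetricSpace Y] (ρ : Y → ℝ≥0∞) {E : Set Y} {p : Y}
    (hp : p ∈ E) :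
    pathCost ρ E p = 0 := by
  refine le_antisymm ((iInf_le _ fun _ => p).trans ((iInf_le _ 0).trans
    ((iInf_le _ ⟨le_rfl, LipschitzWith.const' p |>.lipschitzOnWith, hp, rfl⟩).trans ?_))) bot_le
  simp

theorem LipschitzOnWith.concat {Y : Type*} [MetricSpace Y] {g σ : ℝ → Y} {L δ : ℝ}
    (hg : LipschitzOnWith 1 g (Icc 0 L)) (hσ : LipschitzOnWith 1 σ (Icc 0 δ))
    (hL : 0 ≤ L) (hδ : 0 ≤ δ) (h : σ 0 = g L) :
    LipschitzOnWith 1 (fun t => if t ≤ L then g t else σ (t - L)) (Icc 0 (L + δ)) := by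
  refine LipschitzOnWith.of_dist_le_mul fun a ha b hb => ?_
  wlog hab : a ≤ b generalizing a b
  · rw [dist_comm, dist_comm a b]
    exact this b hb a ha (le_of_not_ge hab)
  have hg' := hg.dist_le_mul
  have hσ' := hσ.dist_le_mul
  simp only [NNReal.coe_one, one_mul] at hg' hσ' ⊢
  rw [dist_comm a b, Real.dist_eq, abs_of_nonneg (sub_nonneg.2 hab)]
  by_cases hbL : b ≤ L
  · rw [if_pos hbL, if_pos (hab.trans hbL)]
    refine (hg' a ⟨ha.1, hab.trans hbL⟩ b ⟨hb.1, hbL⟩).trans_eq ?_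
    rw [dist_comm, Real.dist_eq, abs_of_nonneg (sub_nonneg.2 hab)]
  · push Not at hbL
    rw [if_neg hbL.not_ge]
    by_cases haL : a ≤ L
    · rw [if_pos haL]
      have h1 := hg' a ⟨ha.1, haL⟩ L ⟨hL, le_rfl⟩
      have h2 := hσ' 0 ⟨le_rfl, hδ⟩ (b - L) ⟨by linarith, by linarith [hb.2]⟩
      rw [dist_comm a, Real.dist_eq, abs_of_nonneg (by linarith)] at h1
      rw [dist_comm 0, Real.dist_eq, abs_of_nonneg (by linarith), h] at h2
      linarith [dist_triangle (g a) (g L) (σ (b - L))]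
    · push Not at haL
      rw [if_neg haL.not_ge]
      have h2 := hσ' (a - L) ⟨by linarith, by linarith [hb.2]⟩ (b - L)
        ⟨by linarith, by linarith [hb.2]⟩
      rw [dist_comm (a - L), Real.dist_eq, abs_of_nonneg (by linarith)] at h2
      linarith

theorem pathCost_le_add {Y : Type*} [MetricSpace Y] (ρ : Y → ℝ≥0∞) (E : Set Y) {σ : ℝ → Y} {δ : ℝ}
    (hσ : LipschitzOnWith 1 σ (Icc 0 δ)) (hδ : 0 ≤ δ) :
    pathCost ρ E (σ δ) ≤ pathCost ρ E (σ 0) + ∫⁻ t in Icc 0 δ, ρ (σ t) := by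
  simp only [pathCost, ENNReal.iInf_add]
  refine le_iInf fun g => le_iInf fun L => le_iInf fun ⟨hL, hg, h0, hp⟩ => ?_
  set c : ℝ → Y := fun t => if t ≤ L then g t else σ (t - L) with hc
  have hcδ : c (L + δ) = σ δ := by
    rcases hδ.eq_or_lt with rfl | hδ
    · simp [hc, hp]
    · simp [hc, hδ]
  refine (iInf_le _ c).trans ((iInf_le _ (L + δ)).trans ((iInf_le _ ⟨add_nonneg hL hδ,
    hg.concat hσ hL hδ hp.symm, by simpa [hc, hL] using h0, hcδ⟩).trans ?_))
  have hsplit : Icc 0 (L + δ) = Icc 0 L ∪ Ioc L (L + δ) :=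
    (Icc_union_Ioc_eq_Icc hL (le_add_of_nonneg_right hδ)).symm
  rw [hsplit]
  refine (lintegral_union_le _ _ _).trans (add_le_add (le_of_eq ?_) ?_)
  · refine setLIntegral_congr_fun measurableSet_Icc fun t ht => ?_
    simp [hc, ht.2]
  · calc ∫⁻ t in Ioc L (L + δ), ρ (c t) = ∫⁻ t in Ioc L (L + δ), ρ (σ (t - L)) := by
          refine setLIntegral_congr_fun measurableSet_Ioc fun t ht => ?_
          simp [hc, ht.1.not_ge]
      _ ≤ ∫⁻ t in Icc L (L + δ), ρ (σ (t - L)) := lintegral_mono_set Ioc_subset_Icc_self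
      _ = ∫⁻ t in Icc 0 δ, ρ (σ t) := by
          rw [(measurePreserving_sub_right volume L).setLIntegral_comp_emb
            (measurableEmbedding_subRight L) (fun t => ρ (σ t))]
          simp

theorem one_le_pathCost {Y : Type*} [MetricSpace Y] {ρ : Y → ℝ≥0∞} {E F : Set Y}
    (hρ : ModAdmissible (JoiningCurves E F) ρ) {p : Y} (hp : p ∈ F) : 1 ≤ pathCost ρ E p := by
  refine le_iInf fun g => le_iInf fun L => le_iInf fun ⟨hL, hg, h0, hgp⟩ => ?_
  exact hρ (0, L, g) ⟨hL, hg.continuousOn, h0, by simpa [hgp] using hp⟩ g L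
    ⟨hL, hg, id, monotoneOn_id, by simp, fun t _ => rfl⟩

theorem IsCableSystem.pathCost_edge_le (hcs : IsCableSystem G (fun _ _ => 1) μ vtx em) {u v : V}
    (h : G.Adj u v) (ρ : X → ℝ≥0∞) (E : Set X) {s t : ℝ} (hs : 0 ≤ s) (hst : s ≤ t)
    (ht : t ≤ 1) :
    pathCost ρ E (em u v t) ≤ pathCost ρ E (em u v s) + ∫⁻ τ in Ioc s t, ρ (em u v τ) ∧
    pathCost ρ E (em u v s) ≤ pathCost ρ E (em u v t) + ∫⁻ τ in Ioc s t, ρ (em u v τ) := by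
  have hlip := hcs.lipschitzOnWith h
  constructor
  · have h1 := pathCost_le_add ρ E (σ := fun τ => em u v (s + τ)) (δ := t - s)
      (LipschitzOnWith.of_dist_le_mul fun a ha b hb => by
        simpa using hlip.dist_le_mul (s + a) ⟨by linarith [ha.1], by linarith [ha.2]⟩
          (s + b) ⟨by linarith [hb.1], by linarith [hb.2]⟩) (by linarith)
    have h2 := (measurePreserving_add_left volume s).setLIntegral_comp_emb
      (measurableEmbedding_addLeft s) (fun t => ρ (em u v t)) (Icc 0 (t - s))
    rw [h2] at h1
    simpa [setLIntegral_congr Ioc_ae_eq_Icc] using h1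
  · have h1 := pathCost_le_add ρ E (σ := fun τ => em u v (t - τ)) (δ := t - s)
      (LipschitzOnWith.of_dist_le_mul fun a ha b hb => by
        simpa only [dist_sub_left] using hlip.dist_le_mul (t - a)
          ⟨by linarith [ha.2], by linarith [ha.1]⟩
          (t - b) ⟨by linarith [hb.2], by linarith [hb.1]⟩) (by linarith)
    have h2 := (Measure.measurePreserving_sub_left volume t).setLIntegral_comp_emb
      (measurableEmbedding_subLeft t) (fun t => ρ (em u v t)) (Icc 0 (t - s))
    rw [h2] at h1
    simpa [setLIntegral_congr Ioc_ae_eq_Icc] using h1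

theorem abs_toReal_min_one_sub_le {a b c : ℝ≥0∞} (h1 : a ≤ b + c) (h2 : b ≤ a + c) :
    ENNReal.ofReal |(min 1 a).toReal - (min 1 b).toReal| ≤ c := by
  wlog hab : b ≤ a generalizing a b
  · rw [abs_sub_comm]
    exact this h2 h1 (le_of_not_ge hab)
  have hfa : min 1 a ≠ ∞ := ne_top_of_le_ne_top ENNReal.one_ne_top (min_le_left _ _)
  have hfb : min 1 b ≠ ∞ := ne_top_of_le_ne_top ENNReal.one_ne_top (min_le_left _ _)
  have hle : min 1 b ≤ min 1 a := min_le_min_left _ hab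
  rw [abs_of_nonneg (sub_nonneg.2 (ENNReal.toReal_mono hfa hle)),
    ← ENNReal.toReal_sub_of_le hle hfa, ENNReal.ofReal_toReal (ENNReal.sub_ne_top hfa),
    tsub_le_iff_left]
  rcases le_total 1 b with hb | hb
  · exact (min_le_left _ _).trans (by rw [min_eq_left hb]; exact le_self_add)
  · rw [min_eq_right hb]
    exact (min_le_right _ _).trans h1

/-- An admissible density of finite energy yields a potential that separates `E` from `F`. -/
theorem IsCableSystem.exists_potential (hcs : IsCableSystem G (fun _ _ => 1) μ vtx em)
    [Countable V] {ρ : X → ℝ≥0∞} (hρ : Measurable ρ) {E F : Set X}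
    (hadm : ModAdmissible (JoiningCurves E F) ρ) :
    ∃ (f : X → ℝ) (k : G.Dart → ℝ → ℝ≥0∞), IsEdgeUpperGradient G em f k ∧
      edgeEnergy k ≤ 2 * ∫⁻ x, ρ x ^ 2 ∂μ ∧ (∀ p ∈ E, f p = 0) ∧ ∀ p ∈ F, f p = 1 := by
  have := hcs.isBorel
  refine ⟨fun p => (min 1 (pathCost ρ E p)).toReal,
    fun e t => ρ (em e.fst e.snd (projIcc (0 : ℝ) 1 zero_le_one t)), fun e =>
      ⟨hρ.comp (hcs.continuous_edge_projIcc e.adj).measurable, fun s t hs hst ht => ?_⟩, ?_,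
    fun p hp => by simp [pathCost_eq_zero ρ hp], fun p hp => by
      simp [min_eq_left (one_le_pathCost hadm hp)]⟩
  · have hcongr : ∫⁻ τ in Ioc s t, ρ (em e.fst e.snd (projIcc (0 : ℝ) 1 zero_le_one τ)) =
        ∫⁻ τ in Ioc s t, ρ (em e.fst e.snd τ) :=
      setLIntegral_congr_fun measurableSet_Ioc fun τ hτ => by
        simp [projIcc_of_mem zero_le_one (⟨hs.trans hτ.1.le, hτ.2.trans ht⟩ : τ ∈ Icc (0 : ℝ) 1)]
    rw [hcongr]
    obtain ⟨h1, h2⟩ := hcs.pathCost_edge_le e.adj ρ E hs hst ht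
    exact abs_toReal_min_one_sub_le h1 h2
  · refine le_trans (le_of_eq (tsum_congr fun e => ?_)) (hcs.tsum_edge_le (hρ.pow_const 2))
    refine setLIntegral_congr_fun measurableSet_Icc fun τ hτ => ?_
    simp [projIcc_of_mem zero_le_one hτ]

/-! ### Volume of balls -/

theorem HasPolynomialGrowth.countable {V : Type*} {G : SimpleGraph V} {d : ℝ}
    (h : HasPolynomialGrowth G d) : Countable V := by
  obtain ⟨C, hC, h⟩ := h
  rcases isEmpty_or_nonempty V with _ | ⟨⟨v⟩⟩
  · infer_instance
  · have hfin : ∀ n : ℕ, {y : V | (G.dist v y : ℝ) < n + 1}.Finite := by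
      intro n
      have h1 : (0 : ℝ) < Nat.card {y : V | (G.dist v y : ℝ) < n + 1} :=
        lt_of_lt_of_le (by positivity) (h v (n + 1) (by simp)).1
      exact Nat.finite_of_card_ne_zero (Nat.cast_pos.1 h1).ne'
    have hcov : ⋃ n : ℕ, {y : V | (G.dist v y : ℝ) < n + 1} = univ :=
      eq_univ_of_forall fun y => mem_iUnion.2 ⟨G.dist v y, by simp⟩
    rw [← countable_univ_iff, ← hcov]
    exact countable_iUnion fun n => (hfin n).countable

theorem IsCableSystem.dist_vtx_le (hcs : IsCableSystem G (fun _ _ => 1) μ vtx em)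
    (hconn : G.Connected) (a b : V) : dist (vtx a) (vtx b) ≤ G.dist a b := by
  obtain ⟨w, hw⟩ := hconn.exists_walk_length_eq_dist a b
  rw [← hw]
  clear hw
  induction w with
  | nil => simp
  | @cons a b c h w ih =>
    have h1 := hcs.edge_lip a b h 0 (by simp) 1 (by simp)
    rw [hcs.edge_start a b h, hcs.edge_one h] at h1
    rw [SimpleGraph.Walk.length_cons, Nat.cast_add, Nat.cast_one]
    norm_num at h1
    linarith [dist_triangle (vtx a) (vtx b) (vtx c)]

theorem IsCableSystem.card_le_measure_ball (hcs : IsCableSystem G (fun _ _ => 1) μ vtx em)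
    (hconn : G.Connected) [Countable V] [Nontrivial V] (u : V) (s : ℝ) :
    (ENat.card {w : V | (G.dist u w : ℝ) < s} : ℝ≥0∞) ≤ 2 * μ (ball (vtx u) (s + 1)) := by
  have := hcs.isBorel
  choose n hn using fun w : V => hconn.preconnected.exists_adj_of_nontrivial w
  have hinj : Function.Injective
      fun w : {w : V | (G.dist u w : ℝ) < s} => (⟨(w.1, n w.1), hn w.1⟩ : G.Dart) := by
    intro a b h
    exact Subtype.ext (congrArg (fun e : G.Dart => e.fst) h)
  have hmeas : MeasurableSet (ball (vtx u) (s + 1)) := isOpen_ball.measurableSet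
  calc (ENat.card {w : V | (G.dist u w : ℝ) < s} : ℝ≥0∞)
      = ∑' _w : {w : V | (G.dist u w : ℝ) < s}, (1 : ℝ≥0∞) := ENNReal.tsum_one.symm
    _ ≤ ∑' w : {w : V | (G.dist u w : ℝ) < s}, ∫⁻ t in Icc (0 : ℝ) 1,
          (ball (vtx u) (s + 1)).indicator 1 (em w.1 (n w.1) t) := by
        refine ENNReal.tsum_le_tsum fun ⟨w, hw⟩ => ?_
        rw [setLIntegral_congr_fun (g := fun _ => (1 : ℝ≥0∞)) measurableSet_Icc]
        · simp
        · intro t ht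
          have h1 := hcs.edge_lip w (n w) (hn w) t ht 0 (by simp)
          rw [hcs.edge_start w _ (hn w), sub_zero, abs_of_nonneg ht.1] at h1
          have h2 := hcs.dist_vtx_le hconn u w
          have h3 := dist_triangle (em w (n w) t) (vtx w) (vtx u)
          rw [dist_comm (vtx w)] at h3
          replace hw : (G.dist u w : ℝ) < s := hw
          exact indicator_of_mem (by rw [mem_ball]; linarith [ht.2]) _
    _ ≤ ∑' e : G.Dart, ∫⁻ t in Icc (0 : ℝ) 1,
          (ball (vtx u) (s + 1)).indicator 1 (em e.fst e.snd t) :=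
        ENNReal.tsum_comp_le_tsum_of_injective hinj fun e : G.Dart =>
          ∫⁻ t in Icc (0 : ℝ) 1, (ball (vtx u) (s + 1)).indicator 1 (em e.fst e.snd t)
    _ ≤ 2 * ∫⁻ x, (ball (vtx u) (s + 1)).indicator 1 x ∂μ :=
        hcs.tsum_edge_le (measurable_one.indicator hmeas)
    _ = 2 * μ (ball (vtx u) (s + 1)) := by rw [lintegral_indicator_one hmeas]

theorem IsCableSystem.growth_le_measure_ball (hcs : IsCableSystem G (fun _ _ => 1) μ vtx em)
    (hconn : G.Connected) [Countable V] {C d : ℝ}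
    (hgrowth : ∀ (x : V) (r : ℝ), 1 ≤ r →
      C⁻¹ * r ^ d ≤ (Nat.card {y : V | (G.dist x y : ℝ) < r} : ℝ))
    (y : X) {r : ℝ} (hr : 32 ≤ r) :
    ENNReal.ofReal (C⁻¹ * (r / 16) ^ d) ≤ 2 * μ (ball y (r / 8)) := by
  obtain ⟨u, v, t, h, ht, rfl⟩ := hcs.cover y
  have : Nontrivial V := ⟨u, v, h.ne⟩
  have h1 := hcs.edge_lip u v h t ht 0 (by simp)
  rw [hcs.edge_start u v h, sub_zero, abs_of_nonneg ht.1, dist_comm] at h1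
  calc ENNReal.ofReal (C⁻¹ * (r / 16) ^ d)
      ≤ ENNReal.ofReal (Nat.card {w : V | (G.dist u w : ℝ) < r / 16}) :=
        ENNReal.ofReal_le_ofReal (hgrowth u (r / 16) (by linarith))
    _ ≤ (ENat.card {w : V | (G.dist u w : ℝ) < r / 16} : ℝ≥0∞) := by
        rw [ENNReal.ofReal_natCast, Nat.card, ← ENat.toENNReal_coe]
        exact ENat.toENNReal_mono (ENat.natCast_toNat_le_self _)
    _ ≤ 2 * μ (ball (vtx u) (r / 16 + 1)) := hcs.card_le_measure_ball hconn u _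
    _ ≤ 2 * μ (ball (em u v t) (r / 8)) := by
        gcongr
        exact ball_subset_ball' (by linarith [ht.2])

/-! ### Lower bounds for the modulus -/

theorem IsCableSystem.le_modulus_of_dist_le (hcs : IsCableSystem G (fun _ _ => 1) μ vtx em)
    (hconn : G.Connected) [Countable V] {E F : Set X} {y z : X} (hy : y ∈ E) (hz : z ∈ F)
    {K : ℝ} (hK : 0 < K) (h : dist y z ≤ K) :
    ENNReal.ofReal (1 / (2 * K)) ≤ modulus μ (JoiningCurves E F) := by
  refine le_iInf₂ fun ρ ⟨hρ, hadm⟩ => ?_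
  by_cases hE : ∫⁻ x, ρ x ^ 2 ∂μ = ∞
  · simp [hE]
  obtain ⟨f, k, hk, hkE, h0, h1⟩ := hcs.exists_potential hρ hadm
  have h2E : 2 * ∫⁻ x, ρ x ^ 2 ∂μ ≠ ∞ := ENNReal.mul_ne_top (by simp) hE
  have h2 := hcs.resistanceLE_dist hconn y z f k hk (ne_top_of_le_ne_top h2E hkE)
  have h3 := ENNReal.toReal_mono h2E hkE
  rw [h0 y hy, h1 z hz] at h2
  rw [ENNReal.toReal_mul, ENNReal.toReal_ofNat] at h3
  rw [ENNReal.ofReal_le_iff_le_toReal hE, div_le_iff₀ (by positivity)]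
  nlinarith [mul_le_mul h h3 ENNReal.toReal_nonneg hK.le]

/-- A function equal to `0` on `A` and `1` on `B` is far from any constant. -/
theorem le_setLIntegral_sq_sub {Y : Type*} [MeasurableSpace Y] {μ : Measure Y} {A B S : Set Y}
    (hA : MeasurableSet A) (hB : MeasurableSet B) (hAS : A ⊆ S) (hBS : B ⊆ S)
    {f : Y → ℝ} (h0 : ∀ p ∈ A, f p = 0) (h1 : ∀ p ∈ B, f p = 1)
    (m : ℝ) {a : ℝ≥0∞} (haA : a ≤ μ A) (haB : a ≤ μ B) :
    ENNReal.ofReal (1 / 4) * a ≤ ∫⁻ x in S, ENNReal.ofReal ((f x - m) ^ 2) ∂μ := by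
  have key : ∀ D : Set Y, MeasurableSet D → D ⊆ S → a ≤ μ D → (∀ p ∈ D, 1 / 4 ≤ (f p - m) ^ 2) →
      ENNReal.ofReal (1 / 4) * a ≤ ∫⁻ x in S, ENNReal.ofReal ((f x - m) ^ 2) ∂μ := by
    intro D hD hDS haD hfD
    calc ENNReal.ofReal (1 / 4) * a ≤ ENNReal.ofReal (1 / 4) * μ D := by gcongr
      _ = ∫⁻ _ in D, ENNReal.ofReal (1 / 4) ∂μ := (setLIntegral_const _ _).symm
      _ ≤ ∫⁻ x in D, ENNReal.ofReal ((f x - m) ^ 2) ∂μ :=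
        setLIntegral_mono' hD fun p hp => ENNReal.ofReal_le_ofReal (hfD p hp)
      _ ≤ _ := lintegral_mono_set hDS
  rcases le_total (1 / 2) m with hm | hm
  · exact key A hA hAS haA fun p hp => by rw [h0 p hp]; nlinarith
  · exact key B hB hBS haB fun p hp => by rw [h1 p hp]; nlinarith

theorem IsCableSystem.le_modulus_of_poincare (hcs : IsCableSystem G (fun _ _ => 1) μ vtx em)
    (hconn : G.Connected) [Countable V] {C₀ C d : ℝ} (hC₀ : 0 < C₀) (hC : 0 < C) (hd : 2 ≤ d)
    (hgrowth : ∀ (x : V) (r : ℝ), 1 ≤ r →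
      C₀⁻¹ * r ^ d ≤ (Nat.card {y : V | (G.dist x y : ℝ) < r} : ℝ))
    {x y z : X} {r : ℝ} (hr : 32 ≤ r)
    (hPI : ∀ f g : X → ℝ, HasGradMod G (fun _ _ => 1) em f g →
      (∫⁻ x, ENNReal.ofReal (g x ^ 2) ∂μ) < ⊤ → ∃ m : ℝ,
        ∫⁻ p in ball x (3 * r), ENNReal.ofReal ((f p - m) ^ 2) ∂μ ≤
          ENNReal.ofReal (C * max ((3 * r) ^ 2) ((3 * r) ^ d)) *
            ∫⁻ p, ENNReal.ofReal (g p ^ 2) ∂μ)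
    (hy : dist y x < 2 * r) (hz : dist z x < 2 * r) :
    ENNReal.ofReal (C₀⁻¹ / (16 * C * 48 ^ d)) ≤
      modulus μ (JoiningCurves (closure (ball y (r / 8))) (closure (ball z (r / 8)))) := by
  have := hcs.isBorel
  refine le_iInf₂ fun ρ ⟨hρ, hadm⟩ => ?_
  by_cases hE : ∫⁻ x, ρ x ^ 2 ∂μ = ∞
  · simp [hE]
  obtain ⟨f, k, hk, hkE, h0, h1⟩ := hcs.exists_potential hρ hadm
  have h2E : 2 * ∫⁻ x, ρ x ^ 2 ∂μ ≠ ∞ := ENNReal.mul_ne_top (by simp) hE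
  obtain ⟨g, hg, hgE⟩ := hcs.exists_hasGradMod hconn hk (ne_top_of_le_ne_top h2E hkE)
  obtain ⟨m, hm⟩ := hPI f g hg (lt_top_iff_ne_top.2 (ne_top_of_le_ne_top h2E (hgE.trans hkE)))
  have hmax : max ((3 * r) ^ 2) ((3 * r) ^ d) = 48 ^ d * (r / 16) ^ d := by
    rw [← Real.mul_rpow (by norm_num) (by linarith), max_eq_right]
    · congr 1; ring
    · rw [← Real.rpow_natCast]
      exact Real.rpow_le_rpow_of_exponent_le (by linarith) (by exact_mod_cast hd)
  set a : ℝ≥0∞ := ENNReal.ofReal (C₀⁻¹ * (r / 16) ^ d) / 2 with ha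
  have hball : ∀ p : X, a ≤ μ (ball p (r / 8)) := fun p =>
    ENNReal.div_le_of_le_mul' (hcs.growth_le_measure_ball hconn hgrowth p hr)
  have hlow := le_setLIntegral_sq_sub (μ := μ) (A := ball y (r / 8)) (B := ball z (r / 8))
    isOpen_ball.measurableSet isOpen_ball.measurableSet
    (S := ball x (3 * r)) (ball_subset_ball' (by linarith)) (ball_subset_ball' (by linarith))
    (fun p hp => h0 p (subset_closure hp)) (fun p hp => h1 p (subset_closure hp)) m
    (hball y) (hball z)
  have htot := hlow.trans (hm.trans (mul_le_mul_right (hgE.trans hkE) _))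
  have htop := ENNReal.mul_ne_top
    (ENNReal.ofReal_ne_top (r := C * max ((3 * r) ^ 2) ((3 * r) ^ d))) h2E
  have hq : 0 < (r / 16) ^ d := Real.rpow_pos_of_pos (by linarith) d
  have h48 : (0 : ℝ) < 48 ^ d := Real.rpow_pos_of_pos (by norm_num) d
  have hreal := ENNReal.toReal_mono htop htot
  rw [ha, hmax] at hreal
  simp only [ENNReal.toReal_mul, ENNReal.toReal_div, ENNReal.toReal_ofNat] at hreal
  rw [ENNReal.toReal_ofReal (by norm_num), ENNReal.toReal_ofReal (by positivity),
    ENNReal.toReal_ofReal (by positivity)] at hreal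
  rw [ENNReal.ofReal_le_iff_le_toReal hE, div_le_iff₀ (by positivity)]
  refine le_of_mul_le_mul_right ?_ hq
  linarith

end CableSystem

/-- **Lemma (modulus lower bound from the Poincaré inequality).**  Let `G` be a connected,
locally finite, simple graph of polynomial growth with volume growth exponent `d ≥ 2`, and
let `(X, d₁, μ₁)` be its cable system with unit length function.  If the cable system
satisfies `PI(Ψ)` with `Ψ(r) = r² ∨ r^d`, then there is `c > 0` such that for all `x ∈ X`,
`r ≥ 1` and `y, z ∈ B(x,2r) ∖ B(x,r)` with `d₁(y,z) > r/4`, the modulus of the family of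
curves joining `cl(B(y,r/8))` and `cl(B(z,r/8))` is at least `c`. -/
theorem modulus_lower_bound_of_PI
    {V X : Type*} [MetricSpace X] [MeasurableSpace X] [CompleteSpace X]
    (G : SimpleGraph V) (hconn : G.Connected) (hlf : ∀ v : V, (G.neighborSet v).Finite)
    (d : ℝ) (hd : 2 ≤ d) (hpoly : HasPolynomialGrowth G d)
    (μ : Measure X) (vtx : V → X) (em : V → V → ℝ → X)
    (hcs : IsCableSystem G (fun _ _ => 1) μ vtx em)
    (hPI : PoincareIneq G (fun _ _ => 1) em μ (fun r => max (r ^ 2) (r ^ d))) :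
    ∃ c : ℝ, 0 < c ∧ ∀ (x : X) (r : ℝ), 1 ≤ r →
      ∀ y ∈ ball x (2 * r) \ ball x r, ∀ z ∈ ball x (2 * r) \ ball x r,
        r / 4 < dist y z →
        ENNReal.ofReal c ≤
          modulus μ (JoiningCurves (closure (ball y (r / 8))) (closure (ball z (r / 8)))) := by
  obtain ⟨C₀, hC₀, hgrowth⟩ := hpoly
  obtain ⟨C, M, hC, -, hPI⟩ := hPI
  have : Countable V := HasPolynomialGrowth.countable ⟨C₀, hC₀, hgrowth⟩
  set K : ℝ := 128 + (ediam (univ : Set X)).toReal with hK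
  have hK0 : 0 < K := by positivity
  have h48 : (0 : ℝ) < 48 ^ d := Real.rpow_pos_of_pos (by norm_num) d
  refine ⟨min (1 / (2 * K)) (C₀⁻¹ / (16 * C * 48 ^ d)), by positivity, ?_⟩
  intro x r hr y hy z hz _
  have hy2 := mem_ball.1 hy.1
  have hz2 := mem_ball.1 hz.1
  have hself : ∀ p : X, p ∈ closure (ball p (r / 8)) := fun p =>
    subset_closure (mem_ball_self (by linarith))
  by_cases hlarge : 32 ≤ r ∧ ediam (univ : Set X) = ⊤
  · refine (ENNReal.ofReal_le_ofReal (min_le_right _ _)).trans ?_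
    refine hcs.le_modulus_of_poincare hconn (by linarith) (by linarith) hd
      (fun v s hs => (hgrowth v s hs).1) hlarge.1 (x := x) (fun f g hg hgE => ?_) hy2 hz2
    exact ⟨_, (hPI f g hg hgE x (3 * r) (by linarith)
      (lt_of_lt_of_eq ENNReal.ofReal_lt_top hlarge.2.symm)).trans
        (mul_le_mul_right (setLIntegral_le_lintegral _ _) _)⟩
  · refine (ENNReal.ofReal_le_ofReal (min_le_left _ _)).trans ?_
    refine hcs.le_modulus_of_dist_le hconn (hself y) (hself z) hK0 ?_
    rcases not_and_or.1 hlarge with h | h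
    · have := dist_triangle_right y z x
      have : 0 ≤ (ediam (univ : Set X)).toReal := ENNReal.toReal_nonneg
      linarith
    · have h1 := ENNReal.toReal_mono h (edist_le_ediam_of_mem (mem_univ y) (mem_univ z))
      rw [edist_dist, ENNReal.toReal_ofReal dist_nonneg] at h1
      linarith

end
end
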